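/- Let $0<\mu<1$, $\frac{11}{12}<\gamma<1<c<3$ with $c\neq 2$, and let $\delta>0$ be sufficiently small. Then for all sufficiently large $X$ and all real $t$ with $|t|\le X^{(4\gamma-3c-1)/3-\delta}$, one has $\sum_{\substack{\mu X<n\le X\\ n=\lfloor k^{1/\gamma}\rfloor}}\Lambda(n)\,n^{1-\gamma}e(tn^{c})-\gamma\int_{\mu X}^{X}e(ty^{c})\,dy\ll \frac{X}{e^{(\log X)^{1/5}}}$, with the implied constant depending only on $\mu,\gamma,c,\delta$. -/

import Mathlib

open Finset
open scoped Classical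

/-- `e(x) = e^{2πix}`. -/
noncomputable def e (x : ℝ) : ℂ := Complex.exp (2 * Real.pi * Complex.I * x)

/-- `n` is of Piatetski-Shapiro type `γ`: `n = ⌊k^{1/γ}⌋` for some positive integer `k`. -/
def isPS (γ : ℝ) (n : ℕ) : Prop := ∃ k : ℕ, 0 < k ∧ n = ⌊(k : ℝ) ^ (1 / γ)⌋₊

namespace PiatetskiShapiro

open Filter Topology MeasureTheory in
lemma mellin_fract_facts (s : ℂ) (hs : 0 < s.re) :
    MellinConvergent (Set.indicator (Set.Ioi 1) fun u : ℝ => ((Int.fract u : ℝ) : ℂ)) (-s) ∧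
    DifferentiableAt ℂ
      (mellin (Set.indicator (Set.Ioi 1) fun u : ℝ => ((Int.fract u : ℝ) : ℂ))) (-s) := by
  set g : ℝ → ℂ := Set.indicator (Set.Ioi 1) fun u : ℝ => ((Int.fract u : ℝ) : ℂ) with hg
  have hgm : Measurable g := by
    apply Measurable.indicator _ measurableSet_Ioi
    fun_prop
  have hg1 : ∀ u, ‖g u‖ ≤ 1 := by
    intro u
    simp only [hg, Set.indicator]
    split_ifs
    · simp [abs_of_nonneg (Int.fract_nonneg u), (Int.fract_lt_one u).le]
    · simp
  have hloc : LocallyIntegrableOn g (Set.Ioi 0) := by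
    apply LocallyIntegrable.locallyIntegrableOn
    apply (locallyIntegrable_const (1 : ℝ)).mono hgm.aestronglyMeasurable
    exact Eventually.of_forall fun x => by simpa using hg1 x
  have htop : g =O[atTop] (fun x : ℝ => x ^ (-(0 : ℝ))) := by
    simp only [neg_zero, Real.rpow_zero]
    exact Asymptotics.isBigO_of_le _ fun x => by simpa using hg1 x
  have hbot : g =O[𝓝[>] 0] (fun x : ℝ => x ^ (-(-s.re - 1))) := by
    refine Asymptotics.IsBigO.of_bound 1 ?_
    have : ∀ᶠ x : ℝ in 𝓝[>] 0, x < 1 :=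
      nhdsWithin_le_nhds (eventually_lt_nhds one_pos)
    filter_upwards [this] with x hx
    simp [hg, not_lt.mpr hx.le]
  refine ⟨mellinConvergent_of_isBigO_rpow hloc htop (by simpa using hs) hbot (by simp),
    mellin_differentiableAt_of_isBigO_rpow hloc htop (by simpa using hs) hbot (by simp)⟩

open MeasureTheory in
lemma mellin_fract_eq (s : ℂ) :
    mellin (Set.indicator (Set.Ioi 1) fun u : ℝ => ((Int.fract u : ℝ) : ℂ)) (-s)
      = ∫ u in Set.Ioi (1 : ℝ), ((Int.fract u : ℝ) : ℂ) * (u : ℂ) ^ (-(s + 1)) := by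
  rw [mellin]
  have : ∀ u : ℝ, (u : ℂ) ^ (-s - 1) • Set.indicator (Set.Ioi 1)
      (fun u : ℝ => ((Int.fract u : ℝ) : ℂ)) u = Set.indicator (Set.Ioi 1)
      (fun u : ℝ => ((Int.fract u : ℝ) : ℂ) * (u : ℂ) ^ (-(s + 1))) u := by
    intro u
    simp only [Set.indicator]
    split_ifs
    · rw [smul_eq_mul, mul_comm, neg_add']
    · simp
  simp_rw [this]
  rw [setIntegral_indicator measurableSet_Ioi]
  congr 2
  ext x
  simp only [Set.mem_inter_iff, Set.mem_Ioi]
  constructor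
  · exact fun h => h.2
  · exact fun h => ⟨by linarith, h⟩

lemma norm_mellin_fract_le (s : ℂ) (hs : 0 < s.re) :
    ‖mellin (Set.indicator (Set.Ioi 1) fun u : ℝ => ((Int.fract u : ℝ) : ℂ)) (-s)‖
      ≤ 1 / s.re := by
  rw [mellin_fract_eq]
  have h1 : ∫ u in Set.Ioi (1 : ℝ), u ^ (-(s.re + 1)) = 1 / s.re := by
    rw [integral_Ioi_rpow_of_lt (by linarith) one_pos]
    simp
  rw [← h1]
  refine MeasureTheory.norm_integral_le_of_norm_le
    (integrableOn_Ioi_rpow_of_lt (by linarith) one_pos) ?_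
  refine (MeasureTheory.ae_restrict_mem measurableSet_Ioi).mono fun u hu => ?_
  have hu0 : (0 : ℝ) < u := lt_trans one_pos hu
  rw [norm_mul, Complex.norm_cpow_eq_rpow_re_of_pos hu0]
  have : ‖((Int.fract u : ℝ) : ℂ)‖ ≤ 1 := by
    simp [abs_of_nonneg (Int.fract_nonneg u), (Int.fract_lt_one u).le]
  calc _ ≤ 1 * u ^ (-(s + 1)).re := by gcongr
    _ = _ := by simp

open MeasureTheory in
lemma riemannZeta₁_eq_of_one_lt_re (s : ℂ) (hs : 1 < s.re) :
    riemannZeta₁ s = s - s * (s - 1) *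
      mellin (Set.indicator (Set.Ioi 1) fun u : ℝ => ((Int.fract u : ℝ) : ℂ)) (-s) := by
  have hs1 : s ≠ 1 := by rintro rfl; simp at hs
  have hs0 : s ≠ 0 := by rintro rfl; simp at hs; linarith
  have hs1' : s - 1 ≠ 0 := sub_ne_zero.mpr hs1
  have hζ : riemannZeta₁ s = (s - 1) * riemannZeta s := by
    rw [riemannZeta_eq_inv_sub_mul hs1]; field_simp
  have hL : riemannZeta s = s * ∫ t in Set.Ioi (1 : ℝ), (⌊t⌋₊ : ℂ) * t ^ (-(s + 1)) := by
    rw [← LSeries_one_eq_riemannZeta hs, LSeries_eq_mul_integral 1 zero_le_one hs]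
    · simp
    · exact LSeriesSummable_one_iff.mpr hs
    · simp
      exact Asymptotics.isBigO_of_le _ fun n => by simp
  have hconv := (mellin_fract_facts s (by linarith)).1
  have hint1 : IntegrableOn (fun u : ℝ => (u : ℂ) ^ (-s)) (Set.Ioi 1) :=
    integrableOn_Ioi_cpow_of_lt (by simpa using hs) one_pos
  have hint2 : IntegrableOn (fun u : ℝ => ((Int.fract u : ℝ) : ℂ) * (u : ℂ) ^ (-(s + 1)))
      (Set.Ioi 1) := by
    have h := (integrableOn_Ioi_cpow_of_lt (a := -(s+1)) (c := 1) (by simp; linarith) one_pos)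
    refine Integrable.mono' h.norm ?_ ?_
    · apply AEStronglyMeasurable.mul
      · fun_prop
      · exact h.aestronglyMeasurable
    · refine Filter.Eventually.of_forall fun u => ?_
      rw [norm_mul]
      have : ‖((Int.fract u : ℝ) : ℂ)‖ ≤ 1 := by
        simp [abs_of_nonneg (Int.fract_nonneg u), (Int.fract_lt_one u).le]
      exact mul_le_of_le_one_left (norm_nonneg _) this
  have hsub : ∫ t in Set.Ioi (1 : ℝ), (⌊t⌋₊ : ℂ) * (t : ℂ) ^ (-(s + 1))
      = (∫ t in Set.Ioi (1 : ℝ), (t : ℂ) ^ (-s)) -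
        ∫ u in Set.Ioi (1 : ℝ), ((Int.fract u : ℝ) : ℂ) * (u : ℂ) ^ (-(s + 1)) := by
    rw [← integral_sub hint1 hint2]
    refine setIntegral_congr_fun measurableSet_Ioi fun t ht => ?_
    have ht0 : (0 : ℝ) < t := lt_trans one_pos ht
    have h1 : (t : ℂ) ^ (-s) = t * (t : ℂ) ^ (-(s + 1)) := by
      have : -s = 1 + -(s + 1) := by ring
      rw [this, Complex.cpow_add _ _ (by exact_mod_cast ht0.ne'), Complex.cpow_one]
    have h2 : (⌊t⌋₊ : ℂ) = (t : ℂ) - ((Int.fract t : ℝ) : ℂ) := by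
      have : (⌊t⌋₊ : ℝ) = t - Int.fract t := by
        rw [natCast_floor_eq_intCast_floor ht0.le]
        exact (Int.self_sub_fract t).symm
      exact_mod_cast this
    rw [h1, h2]
    ring
  rw [hζ, hL, hsub, mellin_fract_eq, integral_Ioi_cpow_of_lt (by simpa using hs) one_pos]
  have : -s + 1 ≠ 0 := by
    intro h; apply hs1'; linear_combination -h
  simp only [Complex.ofReal_one, Complex.one_cpow]
  have e1 : -1 / (-s + 1) = 1 / (s - 1) := by
    rw [div_eq_div_iff this hs1']; ring
  rw [e1]
  field_simp

lemma riemannZeta₁_eq (s : ℂ) (hs : 0 < s.re) :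
    riemannZeta₁ s = s - s * (s - 1) *
      mellin (Set.indicator (Set.Ioi 1) fun u : ℝ => ((Int.fract u : ℝ) : ℂ)) (-s) := by
  have hopen : IsOpen {s : ℂ | 0 < s.re} := isOpen_lt continuous_const Complex.continuous_re
  have hconn : IsPreconnected {s : ℂ | 0 < s.re} :=
    (convex_halfSpace_re_gt 0).isPreconnected
  have h1 : AnalyticOnNhd ℂ riemannZeta₁ {s : ℂ | 0 < s.re} :=
    differentiable_riemannZeta₁.differentiableOn.analyticOnNhd hopen
  have h2 : AnalyticOnNhd ℂ (fun s => s - s * (s - 1) *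
      mellin (Set.indicator (Set.Ioi 1) fun u : ℝ => ((Int.fract u : ℝ) : ℂ)) (-s))
      {s : ℂ | 0 < s.re} := by
    refine DifferentiableOn.analyticOnNhd (fun z hz => ?_) hopen
    have := (mellin_fract_facts z hz).2
    have h3 : DifferentiableAt ℂ (fun z : ℂ => mellin (Set.indicator (Set.Ioi 1)
      fun u : ℝ => ((Int.fract u : ℝ) : ℂ)) (-z)) z :=
      DifferentiableAt.comp (f := fun z : ℂ => -z) z this differentiableAt_id.neg
    exact ((differentiableAt_id).sub ((differentiableAt_id.mul (differentiableAt_id.sub_const 1)).mul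
      h3)).differentiableWithinAt
  refine h1.eqOn_of_preconnected_of_eventuallyEq h2 hconn (z₀ := 2) (by simp) ?_ hs
  have : {s : ℂ | 1 < s.re} ∈ nhds (2 : ℂ) :=
    (isOpen_lt continuous_const Complex.continuous_re).mem_nhds (by simp)
  filter_upwards [this] with z hz
  exact riemannZeta₁_eq_of_one_lt_re z hz

/-- Polynomial growth of `(s - 1) ζ(s)` to the right of the line `Re s = 1/2`. -/
lemma norm_riemannZeta₁_le (s : ℂ) (hs : 1 / 2 ≤ s.re) :
    ‖riemannZeta₁ s‖ ≤ 3 * (1 + ‖s‖) ^ 2 := by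
  have hs0 : 0 < s.re := by linarith
  rw [riemannZeta₁_eq s hs0]
  have h1 := norm_mellin_fract_le s hs0
  have h2 : 1 / s.re ≤ 2 := by
    rw [div_le_iff₀ hs0]; linarith
  have h3 : ‖s - 1‖ ≤ ‖s‖ + 1 := by simpa using norm_sub_le s 1
  calc _ ≤ ‖s‖ + ‖s * (s - 1) * mellin _ (-s)‖ := norm_sub_le _ _
    _ ≤ ‖s‖ + ‖s‖ * (‖s‖ + 1) * 2 := by
      rw [norm_mul, norm_mul]
      gcongr
      exact h1.trans h2
    _ ≤ _ := by nlinarith [norm_nonneg s]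

open Metric in
/-- Bound for the logarithmic derivative of a function without zeros in a disc. -/
lemma norm_deriv_div_le {f : ℂ → ℂ} {s₀ : ℂ} {r M : ℝ} (hr : 0 < r) (hM : 0 < M)
    (hf : DifferentiableOn ℂ f (ball s₀ r)) (hne : ∀ z ∈ ball s₀ r, f z ≠ 0)
    (hb : ∀ z ∈ ball s₀ r, ‖f z‖ ≤ Real.exp M * ‖f s₀‖) {s : ℂ} (hs : ‖s - s₀‖ ≤ 3 * r / 4) :
    ‖deriv f s / f s‖ ≤ 112 * M / r := by
  have hd : DifferentiableOn ℂ (fun z => deriv f z / f z) (ball s₀ r) :=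
    (hf.deriv isOpen_ball).div hf hne
  obtain ⟨g, hg0, hg⟩ := hd.isExactOn_ball.with_val_at s₀ 0
  have h0 : s₀ ∈ ball s₀ r := mem_ball_self hr
  have hconst : ∀ z ∈ ball s₀ r, f z * Complex.exp (-g z) = f s₀ := by
    intro z hz
    have hder : ∀ w ∈ ball s₀ r, HasDerivAt (fun w => f w * Complex.exp (-g w)) 0 w := by
      intro w hw
      have h1 : HasDerivAt f (deriv f w) w :=
        (hf.differentiableAt (isOpen_ball.mem_nhds hw)).hasDerivAt
      have h2 := h1.mul ((hg w hw).neg.cexp)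
      refine h2.congr_deriv ?_
      have h3 : f w * (deriv f w / f w) = deriv f w := mul_div_cancel₀ _ (hne w hw)
      linear_combination -Complex.exp (-g w) * h3
    have := isOpen_ball.is_const_of_deriv_eq_zero (𝕜 := ℂ) (convex_ball s₀ r).isPreconnected
      (fun w hw => (hder w hw).differentiableAt.differentiableWithinAt)
      (fun w hw => (hder w hw).deriv) hz h0
    simpa [hg0] using this
  have hre : ∀ z ∈ ball s₀ r, (g z).re ≤ M := by
    intro z hz
    have h1 := hconst z hz
    have h2 : f z = f s₀ * Complex.exp (g z) := by
      rw [← h1, mul_assoc, ← Complex.exp_add]; simp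
    have h3 := hb z hz
    rw [h2, norm_mul, Complex.norm_exp, mul_comm] at h3
    exact Real.exp_le_exp.mp (le_of_mul_le_mul_right h3 (norm_pos_iff.mpr (hne s₀ h0)))
  have hgd : DifferentiableOn ℂ g (ball s₀ r) :=
    fun w hw => (hg w hw).differentiableAt.differentiableWithinAt
  have hbc : ∀ z, ‖z - s₀‖ ≤ 7 * r / 8 → ‖g z‖ ≤ 14 * M := by
    intro z hz
    have hmaps : ∀ w ∈ ball (0 : ℂ) r, s₀ + w ∈ ball s₀ r := by
      intro w hw; simpa [mem_ball, dist_eq_norm] using hw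
    have h := Complex.borelCaratheodory_zero (f := fun w => g (s₀ + w)) (R := r) hM
      (hgd.comp (by fun_prop) hmaps) (fun w hw => hre _ (hmaps w hw)) hr
      (z := z - s₀) (by rw [mem_ball_zero_iff]; linarith) (by simpa using hg0)
    simp only [add_sub_cancel] at h
    refine h.trans ?_
    rw [div_le_iff₀ (by linarith)]
    nlinarith
  have hsr : ∀ z, ‖z - s‖ ≤ r / 8 → ‖z - s₀‖ ≤ 7 * r / 8 := by
    intro z hz
    have := norm_sub_le_norm_sub_add_norm_sub z s s₀
    linarith
  have hcl : closedBall s (r / 8) ⊆ ball s₀ r := by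
    intro z hz
    rw [mem_closedBall, dist_eq_norm] at hz
    rw [mem_ball, dist_eq_norm]
    have := hsr z hz
    linarith
  have hcau := Complex.norm_deriv_le_of_forall_mem_sphere_norm_le (f := g) (c := s)
    (R := r / 8) (C := 14 * M) (by positivity)
    ((hgd.mono hcl).diffContOnCl_ball le_rfl)
    (fun z hz => hbc z (hsr z (by rw [mem_sphere, dist_eq_norm] at hz; exact hz.le)))
  rw [(hg s (hcl (mem_closedBall_self (by positivity)))).deriv] at hcau
  refine hcau.trans (le_of_eq ?_)
  field_simp
  norm_num

open Metric in
/-- Removing a zero of an entire function. -/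
lemma exists_eq_sub_mul {f : ℂ → ℂ} {R B : ℝ} {ρ : ℂ} (hR : 0 < R) (hf : Differentiable ℂ f)
    (hb : ∀ z ∈ closedBall (0 : ℂ) R, ‖f z‖ ≤ B) (hρ : ‖ρ‖ < R / 3) (hfρ : f ρ = 0)
    (h0 : f 0 ≠ 0) :
    ∃ g : ℂ → ℂ, Differentiable ℂ g ∧ (∀ z, f z = (z - ρ) * g z) ∧
      (∀ z ∈ closedBall (0 : ℂ) R, ‖g z‖ ≤ B / (2 * R / 3)) ∧ ‖f 0‖ = ‖ρ‖ * ‖g 0‖ ∧ g 0 ≠ 0 ∧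
      deriv f 0 / f 0 = -1 / ρ + deriv g 0 / g 0 := by
  have hρ0 : ρ ≠ 0 := by rintro rfl; exact h0 hfρ
  have hg : Differentiable ℂ (dslope f ρ) := by
    rw [← differentiableOn_univ]
    exact (Complex.differentiableOn_dslope Filter.univ_mem).mpr hf.differentiableOn
  have hfg : ∀ z, f z = (z - ρ) * dslope f ρ z := by
    intro z
    have := sub_smul_dslope f ρ z
    rw [hfρ, sub_zero, smul_eq_mul] at this
    exact this.symm
  have hf0 : f 0 = -ρ * dslope f ρ 0 := by simpa using hfg 0
  have hg0 : dslope f ρ 0 ≠ 0 := by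
    intro h; rw [h, mul_zero] at hf0; exact h0 hf0
  refine ⟨dslope f ρ, hg, hfg, ?_, by rw [hf0, norm_mul, norm_neg], hg0, ?_⟩
  · intro z hz
    refine Complex.norm_le_of_forall_mem_frontier_norm_le (U := ball (0 : ℂ) R) isBounded_ball
      hg.diffContOnCl (fun w hw => ?_) (by rwa [closure_ball _ hR.ne'])
    rw [frontier_ball _ hR.ne'] at hw
    have hwR : ‖w‖ = R := by simpa using hw
    have h1 := hb w (by simpa using hwR.le)
    rw [hfg w, norm_mul] at h1
    have h2 : 2 * R / 3 ≤ ‖w - ρ‖ := by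
      have := norm_sub_norm_le w ρ
      linarith
    rw [le_div_iff₀ (by positivity), mul_comm]
    exact (mul_le_mul_of_nonneg_right h2 (norm_nonneg _)).trans h1
  · have hd : deriv f 0 = dslope f ρ 0 + (0 - ρ) * deriv (dslope f ρ) 0 := by
      have h1 : f = fun z => (z - ρ) * dslope f ρ z := funext hfg
      have h2 : HasDerivAt (fun z => (z - ρ) * dslope f ρ z)
          (1 * dslope f ρ 0 + (0 - ρ) * deriv (dslope f ρ) 0) 0 :=
        ((hasDerivAt_id (0 : ℂ)).sub_const ρ).mul (hg 0).hasDerivAt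
      rw [one_mul] at h2
      calc deriv f 0 = deriv (fun z => (z - ρ) * dslope f ρ z) 0 := by rw [← h1]
        _ = _ := h2.deriv
    rw [hd, hf0]
    field_simp
    ring

open Metric in
lemma neg_re_deriv_div_le_aux (n : ℕ) : ∀ {f : ℂ → ℂ} {R B M : ℝ} (_ : 0 < R) (_ : 0 < M)
    (_ : Differentiable ℂ f) (_ : ∀ z ∈ closedBall (0 : ℂ) R, ‖f z‖ ≤ B)
    (_ : f 0 ≠ 0) (_ : B ≤ 2 ^ n * ‖f 0‖) (_ : B ≤ Real.exp M * ‖f 0‖)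
    (_ : ∀ ρ ∈ ball (0 : ℂ) (R / 3), f ρ = 0 → ρ.re ≤ 0),
    -(deriv f 0 / f 0).re ≤ 336 * M / R := by
  induction n with
  | zero =>
    intro f R B M hR hM hf hb h0 hB hBM hz
    by_cases hne : ∀ z ∈ ball (0 : ℂ) (R / 3), f z ≠ 0
    · have := norm_deriv_div_le (s₀ := 0) (r := R / 3) (s := 0) (by positivity) hM
        hf.differentiableOn hne
        (fun z hz' => (hb z (ball_subset_closedBall (ball_subset_ball (by linarith) hz'))).trans hBM)
        (by simp; positivity)
      calc _ ≤ ‖deriv f 0 / f 0‖ := (neg_le_abs _).trans (Complex.abs_re_le_norm _)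
        _ ≤ _ := this
        _ = _ := by field_simp; norm_num
    · push Not at hne
      obtain ⟨ρ, hρ, hρ0⟩ := hne
      rw [mem_ball_zero_iff] at hρ
      obtain ⟨g, -, -, hgb, hg0, hg0', -⟩ := exists_eq_sub_mul hR hf hb hρ hρ0 h0
      exfalso
      have h1 := hgb 0 (mem_closedBall_self hR.le)
      rw [le_div_iff₀ (by positivity)] at h1
      have h2 := norm_pos_iff.mpr hg0'
      rw [hg0] at hB
      nlinarith
  | succ n ih =>
    intro f R B M hR hM hf hb h0 hB hBM hz
    by_cases hne : ∀ z ∈ ball (0 : ℂ) (R / 3), f z ≠ 0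
    · have := norm_deriv_div_le (s₀ := 0) (r := R / 3) (s := 0) (by positivity) hM
        hf.differentiableOn hne
        (fun z hz' => (hb z (ball_subset_closedBall (ball_subset_ball (by linarith) hz'))).trans hBM)
        (by simp; positivity)
      calc _ ≤ ‖deriv f 0 / f 0‖ := (neg_le_abs _).trans (Complex.abs_re_le_norm _)
        _ ≤ _ := this
        _ = _ := by field_simp; norm_num
    · push Not at hne
      obtain ⟨ρ, hρ, hρ0⟩ := hne
      have hρre := hz ρ hρ hρ0
      rw [mem_ball_zero_iff] at hρ
      obtain ⟨g, hg, hfg, hgb, hg0, hg0', hdg⟩ := exists_eq_sub_mul hR hf hb hρ hρ0 h0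
      have h2 := norm_pos_iff.mpr hg0'
      have hle : ∀ K : ℝ, 0 < K → B ≤ 2 * K * ‖f 0‖ → B / (2 * R / 3) ≤ K * ‖g 0‖ := by
        intro K hK hBK
        rw [div_le_iff₀ (by positivity)]
        refine hBK.trans ?_
        rw [hg0]
        have : ‖ρ‖ * ‖g 0‖ ≤ R / 3 * ‖g 0‖ := by gcongr
        nlinarith
      have := ih (f := g) (R := R) (B := B / (2 * R / 3)) (M := M) hR hM hg hgb hg0'
        (hle _ (by positivity) (by rw [pow_succ] at hB; linarith))
        (hle _ (by positivity) (hBM.trans (by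
          have := mul_pos (Real.exp_pos M) (norm_pos_iff.mpr h0); linarith)))
        (fun τ hτ h => hz τ hτ (by rw [hfg, h, mul_zero]))
      rw [hdg, Complex.add_re]
      have h3 : 0 ≤ (-1 / ρ).re := by
        rw [neg_div, Complex.neg_re, one_div, Complex.inv_re]
        have := div_nonpos_of_nonpos_of_nonneg hρre (Complex.normSq_nonneg ρ)
        linarith
      linarith

open Metric in
/-- Landau's lemma: zeros to the left of `0` only help. -/
lemma neg_re_deriv_div_le {f : ℂ → ℂ} {R B M : ℝ} (hR : 0 < R) (hM : 0 < M)
    (hf : Differentiable ℂ f) (hb : ∀ z ∈ closedBall (0 : ℂ) R, ‖f z‖ ≤ B)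
    (h0 : f 0 ≠ 0) (hBM : B ≤ Real.exp M * ‖f 0‖)
    (hz : ∀ ρ ∈ ball (0 : ℂ) (R / 3), f ρ = 0 → ρ.re ≤ 0) :
    -(deriv f 0 / f 0).re ≤ 336 * M / R := by
  have h2 := norm_pos_iff.mpr h0
  obtain ⟨n, hn⟩ := pow_unbounded_of_one_lt (B / ‖f 0‖) one_lt_two
  exact neg_re_deriv_div_le_aux n hR hM hf hb h0 ((div_lt_iff₀ h2).mp hn).le hBM hz

open Metric in
/-- Landau's lemma with one zero `-b` taken into account. -/
lemma neg_re_deriv_div_le_sub {f : ℂ → ℂ} {R B M b : ℝ} (hR : 0 < R) (hM : 0 < M)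
    (hf : Differentiable ℂ f) (hb : ∀ z ∈ closedBall (0 : ℂ) R, ‖f z‖ ≤ B)
    (h0 : f 0 ≠ 0) (hBM : B ≤ Real.exp M * ‖f 0‖)
    (hz : ∀ ρ ∈ ball (0 : ℂ) (R / 3), f ρ = 0 → ρ.re ≤ 0)
    (hb0 : 0 < b) (hbR : b < R / 3) (hfb : f (-(b : ℂ)) = 0) :
    -(deriv f 0 / f 0).re ≤ 336 * M / R - 1 / b := by
  obtain ⟨g, hg, hfg, hgb, hg0, hg0', hdg⟩ := exists_eq_sub_mul (ρ := -(b : ℂ)) hR hf hb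
    (by simpa [abs_of_pos hb0] using hbR) hfb h0
  have hnb : ‖(-(b : ℂ))‖ = b := by simp [abs_of_pos hb0]
  have hle : B / (2 * R / 3) ≤ Real.exp M * ‖g 0‖ := by
    rw [div_le_iff₀ (by positivity)]
    refine hBM.trans ?_
    rw [hg0, hnb, mul_assoc, mul_comm b]
    gcongr
    linarith
  have := neg_re_deriv_div_le hR hM hg hgb hg0' hle
    (fun τ hτ h => hz τ hτ (by rw [hfg, h, mul_zero]))
  rw [hdg, Complex.add_re]
  have h3 : (-1 / (-(b : ℂ))).re = 1 / b := by
    rw [neg_div_neg_eq]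
    norm_cast
  rw [h3]
  linarith

open ArithmeticFunction in
/-- The Dirichlet series `∑ Λ(n) n^{-s}`. -/
noncomputable def mangoldtSeries (s : ℂ) : ℂ := LSeries (fun n => (vonMangoldt n : ℂ)) s

/-- The logarithmic derivative of `(s - 1) ζ(s)`. -/
noncomputable def logDerivZeta₁ (s : ℂ) : ℂ := deriv riemannZeta₁ s / riemannZeta₁ s

lemma riemannZeta₁_eq_mul {s : ℂ} (hs : s ≠ 1) : riemannZeta₁ s = (s - 1) * riemannZeta s := by
  have hs1' : s - 1 ≠ 0 := sub_ne_zero.mpr hs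
  rw [riemannZeta_eq_inv_sub_mul hs]; field_simp

lemma riemannZeta₁_ne_zero {s : ℂ} (hs : 1 ≤ s.re) : riemannZeta₁ s ≠ 0 := by
  by_cases h : s = 1
  · rw [h, riemannZeta₁_one]; exact one_ne_zero
  · rw [riemannZeta₁_eq_mul h]
    exact mul_ne_zero (sub_ne_zero.mpr h) (riemannZeta_ne_zero_of_one_le_re hs)

lemma mangoldtSeries_eq {s : ℂ} (hs : 1 < s.re) :
    mangoldtSeries s = 1 / (s - 1) - logDerivZeta₁ s := by
  have hs1 : s ≠ 1 := by rintro rfl; simp at hs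
  have hs1' : s - 1 ≠ 0 := sub_ne_zero.mpr hs1
  have hζ := riemannZeta_ne_zero_of_one_lt_re hs
  rw [mangoldtSeries, ArithmeticFunction.LSeries_vonMangoldt_eq_deriv_riemannZeta_div hs,
    logDerivZeta₁, riemannZeta₁_eq_mul hs1]
  have hev : riemannZeta₁ =ᶠ[nhds s] fun z => (z - 1) * riemannZeta z := by
    filter_upwards [isOpen_ne.mem_nhds hs1] with z hz using riemannZeta₁_eq_mul hz
  have hd : HasDerivAt (fun z => (z - 1) * riemannZeta z)
      (1 * riemannZeta s + (s - 1) * deriv riemannZeta s) s :=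
    ((hasDerivAt_id s).sub_const 1).mul (differentiableAt_riemannZeta hs1).hasDerivAt
  rw [hev.deriv_eq, hd.deriv]
  field_simp
  ring

open ArithmeticFunction LSeries in
lemma term_mangoldt (s : ℂ) (n : ℕ) :
    term (fun n => (vonMangoldt n : ℂ)) s n = vonMangoldt n * (n : ℂ) ^ (-s) := by
  rcases eq_or_ne n 0 with rfl | hn
  · simp
  · rw [term_of_ne_zero hn, Complex.cpow_neg, div_eq_mul_inv]

open ArithmeticFunction LSeries in
lemma hasSum_mangoldtSeries {s : ℂ} (hs : 1 < s.re) :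
    HasSum (fun n : ℕ => (vonMangoldt n : ℂ) * (n : ℂ) ^ (-s)) (mangoldtSeries s) := by
  have := (LSeriesSummable_vonMangoldt hs).hasSum
  simp_rw [← term_mangoldt]
  exact this

open ArithmeticFunction in
lemma re_mangoldt_term (σ t : ℝ) (n : ℕ) :
    ((vonMangoldt n : ℂ) * (n : ℂ) ^ (-((σ : ℂ) + t * Complex.I))).re =
      vonMangoldt n * (n : ℝ) ^ (-σ) * Real.cos (t * Real.log n) := by
  rcases eq_or_ne n 0 with rfl | hn
  · simp
  · have hn0 : (0 : ℝ) < n := by positivity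
    have h1 : (n : ℂ) ^ (-((σ : ℂ) + t * Complex.I)) =
        (((n : ℝ) ^ (-σ) : ℝ) : ℂ) * Complex.exp (((-(t * Real.log n) : ℝ) : ℂ) * Complex.I) := by
      rw [Complex.cpow_def_of_ne_zero (by exact_mod_cast hn), Real.rpow_def_of_pos hn0,
        Complex.ofReal_exp, ← Complex.exp_add]
      congr 1
      rw [← Complex.natCast_log]
      push_cast
      ring
    rw [h1, Complex.re_ofReal_mul, Complex.re_ofReal_mul, Complex.exp_ofReal_mul_I_re, Real.cos_neg]
    ring

/-- The classical `3 + 4 cos θ + cos 2θ ≥ 0` inequality. -/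
lemma three_four_one {σ : ℝ} (hσ : 1 < σ) (t : ℝ) :
    0 ≤ 3 * (mangoldtSeries σ).re + 4 * (mangoldtSeries (σ + t * Complex.I)).re
      + (mangoldtSeries (σ + ((2 * t : ℝ) : ℂ) * Complex.I)).re := by
  have h0 := Complex.hasSum_re (hasSum_mangoldtSeries (s := (σ : ℂ) + ((0 : ℝ) : ℂ) * Complex.I)
    (by simpa using hσ))
  have h1 := Complex.hasSum_re (hasSum_mangoldtSeries (s := (σ : ℂ) + (t : ℂ) * Complex.I)
    (by simpa using hσ))
  have h2 := Complex.hasSum_re (hasSum_mangoldtSeries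
    (s := (σ : ℂ) + ((2 * t : ℝ) : ℂ) * Complex.I) (by simpa using hσ))
  simp only [re_mangoldt_term] at h0 h1 h2
  have h := ((h0.mul_left 3).add (h1.mul_left 4)).add h2
  simp only [Complex.ofReal_zero, zero_mul, add_zero] at h
  refine h.nonneg fun n => ?_
  have hc : Real.cos (2 * t * Real.log n) = 2 * Real.cos (t * Real.log n) ^ 2 - 1 := by
    rw [mul_assoc, Real.cos_two_mul]
  rw [hc, Real.cos_zero]
  have := ArithmeticFunction.vonMangoldt_nonneg (n := n)
  have h3 : 0 ≤ (n : ℝ) ^ (-σ) := by positivity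
  have := mul_nonneg (mul_nonneg this h3) (sq_nonneg (1 + Real.cos (t * Real.log n)))
  nlinarith

lemma norm_mangoldtSeries_le {s : ℂ} (hs : 1 < s.re) :
    ‖mangoldtSeries s‖ ≤ (mangoldtSeries s.re).re := by
  have h0 := Complex.hasSum_re (hasSum_mangoldtSeries (s := (s.re : ℂ) + ((0 : ℝ) : ℂ) * Complex.I)
    (by simpa using hs))
  simp only [re_mangoldt_term] at h0
  simp only [Complex.ofReal_zero, zero_mul, add_zero, Real.cos_zero, mul_one] at h0
  have h1 := hasSum_mangoldtSeries hs
  rw [← h1.tsum_eq, ← h0.tsum_eq]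
  refine tsum_of_norm_bounded h0.summable.hasSum fun n => ?_
  rw [norm_mul]
  have h3 : ‖(ArithmeticFunction.vonMangoldt n : ℂ)‖ = ArithmeticFunction.vonMangoldt n := by
    simp [abs_of_nonneg]
  rw [h3]
  refine mul_le_mul_of_nonneg_left ?_ ArithmeticFunction.vonMangoldt_nonneg
  rcases eq_or_ne n 0 with rfl | hn
  · have : s ≠ 0 := by rintro rfl; simp at hs; linarith
    rw [Nat.cast_zero, Complex.zero_cpow (neg_ne_zero.mpr this), norm_zero]
    positivity
  · rw [Complex.norm_natCast_cpow_of_pos (Nat.pos_of_ne_zero hn)]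
    simp

lemma norm_inv_riemannZeta_le {s : ℂ} (hs : 1 < s.re) :
    1 ≤ ‖riemannZeta s‖ * ‖riemannZeta s.re‖ := by
  have hs' : 1 < (s.re : ℂ).re := by simpa using hs
  have h1 := LSeries_one_mul_Lseries_moebius hs
  rw [LSeries_one_eq_riemannZeta hs] at h1
  have h2 : ‖LSeries (fun n => ((ArithmeticFunction.moebius n : ℤ) : ℂ)) s‖
      ≤ ‖riemannZeta s.re‖ := by
    have h3 := Complex.hasSum_re (LSeriesHasSum_one hs')
    refine le_trans ?_ (Complex.re_le_norm _)
    refine tsum_of_norm_bounded h3 fun n => ?_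
    rcases eq_or_ne n 0 with rfl | hn
    · simp
    · have h4 : LSeries.term 1 (s.re : ℂ) n = (((n : ℝ) ^ (-s.re) : ℝ) : ℂ) := by
        rw [LSeries.term_of_ne_zero hn, Complex.ofReal_cpow (by positivity)]
        simp [Complex.cpow_neg]
      rw [h4, Complex.ofReal_re, LSeries.norm_term_eq, if_neg hn, Real.rpow_neg (by positivity),
        ← one_div]
      gcongr
      rw [Complex.norm_intCast]
      exact_mod_cast ArithmeticFunction.abs_moebius_le_one
  calc (1 : ℝ) = ‖riemannZeta s‖ * ‖LSeries (fun n => ((ArithmeticFunction.moebius n : ℤ) : ℂ)) s‖ := by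
        rw [← norm_mul, h1, norm_one]
    _ ≤ _ := by gcongr

lemma le_norm_riemannZeta₁ {s : ℂ} (hs : 1 < s.re) (hs2 : s.re ≤ 2) :
    (s.re - 1) ^ 2 / 27 ≤ ‖riemannZeta₁ s‖ := by
  have h1 := norm_inv_riemannZeta_le hs
  have hs1 : s ≠ 1 := by rintro rfl; simp at hs
  have hs1' : (s.re : ℂ) ≠ 1 := by
    intro h; rw [← Complex.ofReal_one, Complex.ofReal_inj] at h; linarith
  have h2 := norm_riemannZeta₁_le (s.re : ℂ) (by simp; linarith)
  rw [riemannZeta₁_eq_mul hs1', norm_mul] at h2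
  have h3 : ‖(s.re : ℂ) - 1‖ = s.re - 1 := by
    rw [← Complex.ofReal_one, ← Complex.ofReal_sub, Complex.norm_real, Real.norm_of_nonneg]
    linarith
  have h4 : ‖(s.re : ℂ)‖ = s.re := by
    rw [Complex.norm_real, Real.norm_of_nonneg]; linarith
  rw [h3, h4] at h2
  rw [riemannZeta₁_eq_mul hs1, norm_mul]
  have h5 : s.re - 1 ≤ ‖s - 1‖ := by
    have := Complex.re_le_norm (s - 1)
    simpa using this
  have h6 : (s.re - 1) * ‖riemannZeta s.re‖ ≤ 27 := by nlinarith
  have h7 : (s.re - 1) / 27 ≤ ‖riemannZeta s‖ := by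
    rw [div_le_iff₀ (by norm_num)]
    calc s.re - 1 ≤ (s.re - 1) * (‖riemannZeta s‖ * ‖riemannZeta s.re‖) := by
          nlinarith
      _ = ‖riemannZeta s‖ * ((s.re - 1) * ‖riemannZeta s.re‖) := by ring
      _ ≤ _ := by gcongr
  calc (s.re - 1) ^ 2 / 27 = (s.re - 1) * ((s.re - 1) / 27) := by ring
    _ ≤ _ := by
      have : 0 ≤ (s.re - 1) / 27 := by
        have : 0 ≤ s.re - 1 := by linarith
        positivity
      gcongr

lemma one_add_norm_le (s : ℂ) {σ t r : ℝ} (hσ : 0 ≤ σ) (h : ‖s - (σ + t * Complex.I)‖ ≤ r) :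
    1 + ‖s‖ ≤ 1 + σ + |t| + r := by
  have h1 : ‖(σ : ℂ) + t * Complex.I‖ ≤ σ + |t| := by
    refine (norm_add_le _ _).trans (le_of_eq ?_)
    simp [abs_of_nonneg hσ]
  have := norm_sub_norm_le s (σ + t * Complex.I)
  linarith

open Metric in
lemma zeta_shift_facts {σ : ℝ} (t : ℝ) (hσ : 1 < σ) (hσ2 : σ ≤ 2) :
    (∀ z ∈ closedBall (0 : ℂ) (1 / 2), ‖riemannZeta₁ (σ + t * Complex.I + z)‖
      ≤ 3 * (4 + |t|) ^ 2) ∧ riemannZeta₁ (σ + t * Complex.I + 0) ≠ 0 ∧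
    3 * (4 + |t|) ^ 2 ≤ Real.exp (Real.log (81 * (4 + |t|) ^ 2 / (σ - 1) ^ 2)) *
      ‖riemannZeta₁ (σ + t * Complex.I + 0)‖ ∧
    (∀ ρ ∈ ball (0 : ℂ) (1 / 2 / 3), riemannZeta₁ (σ + t * Complex.I + ρ) = 0 → ρ.re ≤ 0) ∧
    0 < Real.log (81 * (4 + |t|) ^ 2 / (σ - 1) ^ 2) := by
  have hσ0 : 0 < σ - 1 := by linarith
  have ht := abs_nonneg t
  have hre : ((σ : ℂ) + t * Complex.I).re = σ := by simp
  refine ⟨fun z hz => ?_, ?_, ?_, fun ρ hρ h => ?_, ?_⟩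
  · rw [mem_closedBall_zero_iff] at hz
    have h1 := abs_le.mp ((Complex.abs_re_le_norm z).trans hz)
    refine (norm_riemannZeta₁_le _ ?_).trans ?_
    · rw [Complex.add_re, hre]; linarith
    · have := one_add_norm_le (σ + t * Complex.I + z) (σ := σ) (t := t) (r := 1 / 2) (by linarith)
        (by simpa using hz)
      gcongr 3 * ?_ ^ 2
      linarith
  · exact riemannZeta₁_ne_zero (by rw [add_zero, hre]; linarith)
  · rw [Real.exp_log (by positivity), add_zero]
    have := le_norm_riemannZeta₁ (s := σ + t * Complex.I) (by rw [hre]; exact hσ)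
      (by rw [hre]; exact hσ2)
    rw [hre] at this
    calc 3 * (4 + |t|) ^ 2 = 81 * (4 + |t|) ^ 2 / (σ - 1) ^ 2 * ((σ - 1) ^ 2 / 27) := by
          field_simp
          norm_num
      _ ≤ _ := by gcongr
  · by_contra! hc
    refine riemannZeta₁_ne_zero ?_ h
    rw [Complex.add_re, hre]
    linarith
  · apply Real.log_pos
    rw [lt_div_iff₀ (by positivity)]
    nlinarith

lemma deriv_shift_div (s : ℂ) :
    deriv (fun z => riemannZeta₁ (s + z)) 0 / riemannZeta₁ (s + 0) = logDerivZeta₁ s := by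
  rw [deriv_comp_const_add, add_zero, logDerivZeta₁]

lemma neg_re_logDerivZeta₁_le {σ : ℝ} (t : ℝ) (hσ : 1 < σ) (hσ2 : σ ≤ 2) :
    -(logDerivZeta₁ (σ + t * Complex.I)).re ≤
      672 * Real.log (81 * (4 + |t|) ^ 2 / (σ - 1) ^ 2) := by
  obtain ⟨h1, h2, h3, h4, h5⟩ := zeta_shift_facts t hσ hσ2
  have := neg_re_deriv_div_le (f := fun z => riemannZeta₁ (σ + t * Complex.I + z)) (R := 1 / 2)
    (by norm_num) h5 (differentiable_riemannZeta₁.comp (by fun_prop)) h1 h2 h3 h4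
  rw [deriv_shift_div] at this
  linarith

lemma neg_re_logDerivZeta₁_le_sub {σ β : ℝ} (t : ℝ) (hσ : 1 < σ) (hσ2 : σ ≤ 2)
    (hβ : σ - β < 1 / 6) (h0 : riemannZeta₁ (β + t * Complex.I) = 0) :
    -(logDerivZeta₁ (σ + t * Complex.I)).re ≤
      672 * Real.log (81 * (4 + |t|) ^ 2 / (σ - 1) ^ 2) - 1 / (σ - β) := by
  obtain ⟨h1, h2, h3, h4, h5⟩ := zeta_shift_facts t hσ hσ2
  have hβ1 : β < 1 := by
    by_contra! hc
    exact riemannZeta₁_ne_zero (s := β + t * Complex.I) (by simpa using hc) h0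
  have := neg_re_deriv_div_le_sub (f := fun z => riemannZeta₁ (σ + t * Complex.I + z))
    (R := 1 / 2) (b := σ - β)
    (by norm_num) h5 (differentiable_riemannZeta₁.comp (by fun_prop)) h1 h2 h3 h4
    (by linarith) (by linarith) (by rw [← h0]; congr 1; push_cast; ring)
  rw [deriv_shift_div] at this
  linarith

lemma re_mangoldtSeries_le {σ t : ℝ} (hσ : 1 < σ) (ht : 1 ≤ |t|) :
    (mangoldtSeries (σ + t * Complex.I)).re ≤ 1 - (logDerivZeta₁ (σ + t * Complex.I)).re := by
  rw [mangoldtSeries_eq (by simpa using hσ), Complex.sub_re]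
  gcongr
  refine (Complex.re_le_norm _).trans ?_
  rw [norm_div, norm_one]
  apply div_le_one_of_le₀ _ (norm_nonneg _)
  refine ht.trans ?_
  have := Complex.abs_im_le_norm (σ + t * Complex.I - 1)
  simpa using this

lemma exists_mangoldtSeries_real_le : ∃ C : ℝ, 0 < C ∧ ∀ σ : ℝ, 1 < σ → σ ≤ 2 →
    (mangoldtSeries σ).re ≤ 1 / (σ - 1) + C := by
  have hc : ContinuousOn (fun σ : ℝ => logDerivZeta₁ σ) (Set.Icc 1 2) := by
    have h1 : Continuous (deriv riemannZeta₁) :=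
      (differentiable_riemannZeta₁.contDiff (n := 1)).continuous_deriv le_rfl
    refine ContinuousOn.div (by fun_prop) ?_ fun x hx => ?_
    · exact (differentiable_riemannZeta₁.continuous.comp Complex.continuous_ofReal).continuousOn
    · exact riemannZeta₁_ne_zero (by simpa using hx.1)
  obtain ⟨C, hC⟩ := isCompact_Icc.exists_bound_of_continuousOn hc
  refine ⟨max C 1, by positivity, fun σ h1 h2 => ?_⟩
  rw [mangoldtSeries_eq (by simpa using h1), Complex.sub_re]
  have h3 : (1 / ((σ : ℂ) - 1)).re = 1 / (σ - 1) := by norm_cast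
  rw [h3]
  have h4 := (Complex.abs_re_le_norm (logDerivZeta₁ σ)).trans (hC σ ⟨h1.le, h2⟩)
  have := (abs_le.mp h4).1
  linarith [le_max_left C 1]

lemma log_ratio_le {a u L : ℝ} (ha : 0 < a) (ha1 : a ≤ 1) (hu : 4 ≤ u) (hL : Real.log u ≤ L)
    (hL1 : 1 ≤ L) :
    Real.log (81 * u ^ 2 / (a / L) ^ 2) ≤ (9 + 2 * Real.log (1 / a)) * L := by
  have h81 : Real.log 81 ≤ 5 := by
    rw [Real.log_le_iff_le_exp (by norm_num)]
    have h := Real.exp_one_gt_d9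
    have : Real.exp 5 = Real.exp 1 ^ 5 := by rw [← Real.exp_nat_mul]; norm_num
    rw [this]
    calc (81 : ℝ) ≤ 2.7 ^ 5 := by norm_num
      _ ≤ _ := by gcongr; linarith
  have h1 : Real.log (81 * u ^ 2 / (a / L) ^ 2)
      = Real.log 81 + 2 * Real.log u + 2 * Real.log (1 / a) + 2 * Real.log L := by
    have hu0 : 0 < u := by linarith
    have hL0 : 0 < L := by linarith
    rw [Real.log_div (by positivity) (by positivity), Real.log_mul (by positivity) (by positivity),
      Real.log_pow, Real.log_pow, Real.log_div (by positivity) (by positivity),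
      Real.log_div (by positivity) (by positivity), Real.log_one]
    push_cast
    ring
  have h2 : Real.log L ≤ L := (Real.log_le_sub_one_of_pos (by linarith)).trans (by linarith)
  have h3 : 0 ≤ Real.log (1 / a) := Real.log_nonneg (by rw [le_div_iff₀ ha]; linarith)
  rw [h1]
  nlinarith

set_option maxHeartbeats 800000 in
lemma exists_zeroFree_of_one_le : ∃ b : ℝ, 0 < b ∧ ∀ β t : ℝ, 1 ≤ |t| →
    1 - b / Real.log (|t| + 4) < β → riemannZeta₁ (β + t * Complex.I) ≠ 0 := by
  obtain ⟨C, hC, hCle⟩ := exists_mangoldtSeries_real_le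
  set K : ℝ := 3 * C + 5 + 672 * 22 * 5 with hK
  have hK1 : 1 ≤ K := by linarith
  set a : ℝ := (1 / (4 * K)) ^ 2 with ha
  have hq0 : 0 < 1 / (4 * K) := by positivity
  have ha0 : 0 < a := by positivity
  have hq1 : 1 / (4 * K) ≤ 1 / 4 := by
    apply one_div_le_one_div_of_le <;> linarith
  have ha1 : a ≤ 1 / 16 := by rw [ha]; nlinarith
  have hlog : 1 + Real.log (1 / a) ≤ 8 * K := by
    have : 1 / a = (4 * K) ^ 2 := by rw [ha]; field_simp
    rw [this, Real.log_pow]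
    have := Real.log_le_sub_one_of_pos (x := 4 * K) (by positivity)
    push_cast
    linarith
  have hlog0 : 0 ≤ Real.log (1 / a) := Real.log_nonneg (by rw [le_div_iff₀ ha0]; linarith)
  have hKa : K * (1 + Real.log (1 / a)) ≤ 1 / 2 / a := by
    rw [le_div_iff₀ ha0]
    calc K * (1 + Real.log (1 / a)) * a ≤ K * (8 * K) * a := by gcongr
      _ = 1 / 2 := by rw [ha]; field_simp; norm_num
  refine ⟨a / 7, by positivity, fun β t ht hβ h0 => ?_⟩
  set L := Real.log (|t| + 4) with hL
  have hL1 : 1 ≤ L := by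
    rw [hL, Real.le_log_iff_exp_le (by positivity)]
    linarith [Real.exp_one_lt_d9]
  have hL0 : 0 < L := by linarith
  have haL : 0 < a / L := by positivity
  have haL1 : a / L ≤ 1 / 16 := (div_le_self ha0.le hL1).trans ha1
  set σ : ℝ := 1 + a / L with hσ
  have hσ1 : 1 < σ := by linarith
  have hσ2 : σ ≤ 2 := by linarith
  have hσa : σ - 1 = a / L := by rw [hσ]; ring
  have h7 : a / 7 / L = a / L / 7 := by ring
  have hβσ : σ - β < 8 / 7 * (a / L) := by
    rw [h7] at hβ; linarith
  have hβ1 : β < 1 := by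
    by_contra! hc
    exact riemannZeta₁_ne_zero (s := β + t * Complex.I) (by simpa using hc) h0
  have h341 := three_four_one hσ1 t
  have hm0 := hCle σ hσ1 hσ2
  have hm1 := re_mangoldtSeries_le hσ1 ht
  have h2t : |2 * t| = 2 * |t| := by rw [abs_mul, abs_two]
  have hm2 := re_mangoldtSeries_le (t := 2 * t) hσ1 (by rw [h2t]; linarith)
  have hd1 := neg_re_logDerivZeta₁_le_sub t hσ1 hσ2 (by linarith) h0
  have hd2 := neg_re_logDerivZeta₁_le (2 * t) hσ1 hσ2
  have hl1 := log_ratio_le (u := 4 + |t|) (L := L) ha0 (by linarith) (by linarith)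
    (by rw [hL, add_comm]) hL1
  have hl2 := log_ratio_le (u := 4 + |2 * t|) (L := 2 * L) (a := 2 * a) (by positivity)
    (by linarith) (by rw [h2t]; linarith) (by
      rw [hL, h2t, ← Real.log_rpow (by positivity)]
      apply Real.log_le_log (by positivity)
      norm_num
      nlinarith) (by linarith)
  have hl2a : Real.log (1 / (2 * a)) ≤ Real.log (1 / a) := by
    apply Real.log_le_log (by positivity)
    apply one_div_le_one_div_of_le ha0; linarith
  have hl2b : 2 * a / (2 * L) = a / L := by field_simp
  rw [hl2b] at hl2
  rw [hσa] at hd1 hd2 hm0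
  have hl2' : (9 + 2 * Real.log (1 / (2 * a))) * (2 * L) ≤ (22 + 22 * Real.log (1 / a)) * L := by
    rw [← mul_assoc]
    exact mul_le_mul_of_nonneg_right (by linarith) hL0.le
  have hl1' : (9 + 2 * Real.log (1 / a)) * L ≤ (22 + 22 * Real.log (1 / a)) * L :=
    mul_le_mul_of_nonneg_right (by linarith) hL0.le
  set P := (1 + Real.log (1 / a)) * L with hP
  have hP1 : 1 ≤ P := one_le_mul_of_one_le_of_one_le (by linarith) hL1
  have hfin : 4 * (1 / (σ - β)) ≤ 3 * (1 / (a / L)) + K * P := by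
    have e1 : (22 + 22 * Real.log (1 / a)) * L = 22 * P := by rw [hP]; ring
    rw [e1] at hl1' hl2'
    have h5 : (3 * C + 5) * 1 ≤ (3 * C + 5) * P := by gcongr
    rw [hK]
    linarith
  have h8 : K * P ≤ 1 / 2 * (1 / (a / L)) := by
    calc K * P = K * (1 + Real.log (1 / a)) * L := by rw [hP]; ring
      _ ≤ 1 / 2 / a * L := by gcongr
      _ = _ := by field_simp
  have h9 : 7 / (8 * (a / L)) < 1 / (σ - β) := by
    rw [div_lt_div_iff₀ (by positivity) (by linarith)]
    linarith
  have h10 : 7 / (8 * (a / L)) = 7 / 8 * (1 / (a / L)) := by field_simp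
  rw [h10] at h9
  linarith

open Metric in
lemma exists_zeroFree_of_le_one : ∃ ε : ℝ, 0 < ε ∧ ∀ s : ℂ, |s.im| ≤ 1 →
    1 - ε < s.re → riemannZeta₁ s ≠ 0 := by
  have hopen : IsOpen {s : ℂ | riemannZeta₁ s ≠ 0} :=
    isOpen_ne_fun differentiable_riemannZeta₁.continuous continuous_const
  have hcomp : IsCompact ({1} ×ℂ Set.Icc (-1 : ℝ) 1) :=
    isCompact_singleton.reProdIm isCompact_Icc
  have hsub : ({1} ×ℂ Set.Icc (-1 : ℝ) 1) ⊆ {s : ℂ | riemannZeta₁ s ≠ 0} := by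
    intro s hs
    rw [Complex.mem_reProdIm] at hs
    have : s.re = 1 := by simpa using hs.1
    exact riemannZeta₁_ne_zero this.ge
  obtain ⟨ε, hε, h⟩ := hcomp.exists_thickening_subset_open hopen hsub
  refine ⟨ε, hε, fun s hs1 hs2 => ?_⟩
  rcases le_or_gt 1 s.re with h1 | h1
  · exact riemannZeta₁_ne_zero h1
  · apply h
    rw [mem_thickening_iff]
    refine ⟨1 + s.im * Complex.I, ?_, ?_⟩
    · rw [Complex.mem_reProdIm]
      simpa using abs_le.mp hs1
    · rw [dist_eq_norm]
      have : s - (1 + s.im * Complex.I) = ((s.re - 1 : ℝ) : ℂ) := by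
        apply Complex.ext <;> simp
      rw [this, Complex.norm_real, Real.norm_eq_abs, abs_lt]
      constructor <;> linarith

/-- The classical zero-free region. -/
lemma exists_zeroFree : ∃ b : ℝ, 0 < b ∧ b ≤ 1 ∧ ∀ T : ℝ, 0 ≤ T → ∀ s : ℂ, |s.im| ≤ T →
    1 - b / Real.log (T + 4) < s.re → riemannZeta₁ s ≠ 0 := by
  obtain ⟨b, hb, h1⟩ := exists_zeroFree_of_one_le
  obtain ⟨ε, hε, h2⟩ := exists_zeroFree_of_le_one
  refine ⟨min (min b ε) 1, by positivity, min_le_right _ _, fun T hT s hs hre => ?_⟩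
  have hL1 : 1 ≤ Real.log (T + 4) := by
    rw [Real.le_log_iff_exp_le (by positivity)]
    linarith [Real.exp_one_lt_d9]
  rcases le_or_gt 1 |s.im| with h | h
  · have := h1 s.re s.im h (lt_of_le_of_lt ?_ hre)
    · rwa [Complex.re_add_im] at this
    · have hL2 : 0 < Real.log (|s.im| + 4) := Real.log_pos (by linarith [abs_nonneg s.im])
      have : min (min b ε) 1 ≤ b := (min_le_left _ _).trans (min_le_left _ _)
      gcongr
  · refine h2 s h.le (lt_of_le_of_lt ?_ hre)
    have : min (min b ε) 1 ≤ ε := (min_le_left _ _).trans (min_le_right _ _)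
    have h3 : min (min b ε) 1 / Real.log (T + 4) ≤ min (min b ε) 1 :=
      div_le_self (by positivity) hL1
    linarith

open Metric in
/-- Bound for the logarithmic derivative in the zero-free region. -/
lemma exists_norm_logDerivZeta₁_le : ∃ b C : ℝ, 0 < b ∧ b ≤ 1 / 2 ∧ 0 < C ∧ ∀ T : ℝ, 0 ≤ T →
    ∀ s : ℂ, |s.im| ≤ T → 1 - b / Real.log (T + 4) ≤ s.re → s.re ≤ 1 + b / Real.log (T + 4) →
    riemannZeta₁ s ≠ 0 ∧ ‖logDerivZeta₁ s‖ ≤ C * Real.log (T + 4) ^ 2 := by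
  obtain ⟨b, hb0, hb1, hz⟩ := exists_zeroFree
  refine ⟨b / 8, 112 * (9 + 2 * Real.log (4 / b)) * 4 / b, by positivity, by linarith, ?_, ?_⟩
  · have : 0 ≤ Real.log (4 / b) := Real.log_nonneg (by rw [le_div_iff₀ hb0]; linarith)
    positivity
  intro T hT s hs hs1 hs2
  set L := Real.log (T + 4) with hL
  have hL1 : 1 ≤ L := by
    rw [hL, Real.le_log_iff_exp_le (by positivity)]
    linarith [Real.exp_one_lt_d9]
  have hL0 : 0 < L := by linarith
  set η := b / L with hη
  have hη0 : 0 < η := by positivity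
  have hη1 : η ≤ 1 := (div_le_self hb0.le hL1).trans hb1
  have hbη : b / 8 / L = η / 8 := by rw [hη]; ring
  rw [hbη] at hs1 hs2
  set s₀ : ℂ := ((1 + η / 8 : ℝ) : ℂ) + s.im * Complex.I with hs₀
  have hs₀re : s₀.re = 1 + η / 8 := by simp [hs₀]
  have hs₀im : s₀.im = s.im := by simp [hs₀]
  have hLT : Real.log (T + 1 + 4) ≤ 2 * L := by
    have : 2 * L = Real.log ((T + 4) ^ 2) := by rw [Real.log_pow]; push_cast; rfl
    rw [this]
    apply Real.log_le_log (by linarith)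
    nlinarith
  have hball : ∀ z ∈ ball s₀ (η / 2), ‖z - s₀‖ < η / 2 := by
    intro z hz; rwa [mem_ball, dist_eq_norm] at hz
  have hne : ∀ z ∈ ball s₀ (η / 2), riemannZeta₁ z ≠ 0 := by
    intro z hzb
    have h1 := hball z hzb
    have hre := abs_lt.mp ((Complex.abs_re_le_norm _).trans_lt h1)
    have him := abs_lt.mp ((Complex.abs_im_le_norm _).trans_lt h1)
    rw [Complex.sub_re, hs₀re] at hre
    rw [Complex.sub_im, hs₀im] at him
    have hs' := abs_le.mp hs
    refine hz (T + 1) (by linarith) z (abs_le.mpr ⟨by linarith, by linarith⟩) ?_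
    have : η / 2 ≤ b / Real.log (T + 1 + 4) := by
      have hpos : 0 < Real.log (T + 1 + 4) := Real.log_pos (by linarith)
      rw [hη, div_div]
      apply div_le_div_of_nonneg_left hb0.le hpos
      linarith
    linarith
  have hmem : ‖s - s₀‖ ≤ η / 4 := by
    have : s - s₀ = ((s.re - (1 + η / 8) : ℝ) : ℂ) := by
      apply Complex.ext <;> simp [hs₀]
    rw [this, Complex.norm_real, Real.norm_eq_abs, abs_le]
    constructor <;> linarith
  set M := Real.log (81 * (T + 4) ^ 2 / (η / 8) ^ 2) with hM
  have hM0 : 0 < M := by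
    apply Real.log_pos
    rw [lt_div_iff₀ (by positivity)]
    nlinarith
  have hMle : M ≤ (9 + 2 * Real.log (4 / b)) * (2 * L) := by
    have := log_ratio_le (a := b / 4) (u := T + 4) (L := 2 * L) (by positivity) (by linarith)
      (by linarith) (by linarith) (by linarith)
    have e1 : b / 4 / (2 * L) = η / 8 := by rw [hη]; field_simp; norm_num
    rw [e1] at this
    simpa using this
  have hgrow : ∀ z ∈ ball s₀ (η / 2), ‖riemannZeta₁ z‖ ≤ Real.exp M * ‖riemannZeta₁ s₀‖ := by
    intro z hzb
    have h1 := hball z hzb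
    have hre := abs_lt.mp ((Complex.abs_re_le_norm _).trans_lt h1)
    rw [Complex.sub_re, hs₀re] at hre
    have h2 := norm_riemannZeta₁_le z (by linarith)
    have h3 := one_add_norm_le z (σ := 1 + η / 8) (t := s.im) (by linarith) h1.le
    have h4 := le_norm_riemannZeta₁ (s := s₀) (by rw [hs₀re]; linarith) (by rw [hs₀re]; linarith)
    rw [hs₀re] at h4
    rw [hM, Real.exp_log (by positivity)]
    calc ‖riemannZeta₁ z‖ ≤ 3 * (1 + ‖z‖) ^ 2 := h2
      _ ≤ 3 * (T + 4) ^ 2 := by gcongr 3 * ?_ ^ 2; linarith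
      _ = 81 * (T + 4) ^ 2 / (η / 8) ^ 2 * ((1 + η / 8 - 1) ^ 2 / 27) := by
        field_simp
        ring
      _ ≤ _ := by gcongr
  refine ⟨hne s (by rw [mem_ball, dist_eq_norm]; linarith), ?_⟩
  have := norm_deriv_div_le (s₀ := s₀) (r := η / 2) (s := s) (by positivity) hM0
    differentiable_riemannZeta₁.differentiableOn hne hgrow (by linarith)
  refine this.trans ?_
  calc 112 * M / (η / 2) ≤ 112 * ((9 + 2 * Real.log (4 / b)) * (2 * L)) / (η / 2) := by gcongr
    _ = _ := by rw [hη]; field_simp; norm_num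

open MeasureTheory in
lemma eq_integral_of_hasMellin {f : ℝ → ℂ} {F : ℂ → ℂ} {σ x : ℝ} (hx : 0 < x)
    (h : ∀ t : ℝ, HasMellin f (σ + t * Complex.I) (F (σ + t * Complex.I)))
    (hint : Integrable fun t : ℝ => F (σ + t * Complex.I)) (hc : ContinuousAt f x) :
    f x = (1 / (2 * Real.pi)) •
      ∫ t : ℝ, (x : ℂ) ^ (-(σ + t * Complex.I)) * F (σ + t * Complex.I) := by
  have h1 := mellinInv_mellin_eq σ f hx (by simpa using (h 0).1) (by
    rw [Complex.VerticalIntegrable]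
    exact hint.congr (Filter.Eventually.of_forall fun t => ((h t).2).symm)) hc
  rw [← h1, mellinInv]
  congr 2
  funext t
  rw [(h t).2, smul_eq_mul]

/-- The lower bound `|s (s + 1)| ≥ (1 + t²) / 4` to the right of `Re s = 1/2`. -/
lemma one_add_sq_le_norm_mul {σ : ℝ} (hσ : 1 / 2 ≤ σ) (t : ℝ) :
    (1 + t ^ 2) / 4 ≤ ‖((σ : ℂ) + t * Complex.I) * (σ + t * Complex.I + 1)‖ := by
  have h1 : ‖(σ : ℂ) + t * Complex.I‖ ^ 2 = σ ^ 2 + t ^ 2 := by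
    rw [← Complex.normSq_eq_norm_sq, Complex.normSq_add_mul_I]
  have h2 : ‖(σ : ℂ) + t * Complex.I + 1‖ ^ 2 = (σ + 1) ^ 2 + t ^ 2 := by
    rw [← Complex.normSq_eq_norm_sq, ← Complex.normSq_add_mul_I]
    congr 1
    push_cast
    ring
  rw [norm_mul]
  have h3 : ‖(σ : ℂ) + t * Complex.I‖ ≤ ‖(σ : ℂ) + t * Complex.I + 1‖ := by
    apply le_of_sq_le_sq _ (norm_nonneg _)
    rw [h1, h2]
    nlinarith
  calc (1 + t ^ 2) / 4 ≤ ‖(σ : ℂ) + t * Complex.I‖ ^ 2 := by rw [h1]; nlinarith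
    _ ≤ _ := by rw [sq]; gcongr

lemma norm_inv_mul_le {σ : ℝ} (hσ : 1 / 2 ≤ σ) (t : ℝ) :
    ‖1 / (((σ : ℂ) + t * Complex.I) * (σ + t * Complex.I + 1))‖ ≤ 4 * (1 + t ^ 2)⁻¹ := by
  rw [norm_div, norm_one, ← div_eq_mul_inv]
  have := one_add_sq_le_norm_mul hσ t
  have h : (0 : ℝ) < (1 + t ^ 2) / 4 := by positivity
  rw [div_le_div_iff₀ (by linarith) (by positivity)]
  linarith

lemma perronKernel_ne_zero {σ : ℝ} (hσ : 1 / 2 ≤ σ) (t : ℝ) :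
    ((σ : ℂ) + t * Complex.I) * (σ + t * Complex.I + 1) ≠ 0 := by
  have := one_add_sq_le_norm_mul hσ t
  have h : (0 : ℝ) < (1 + t ^ 2) / 4 := by positivity
  exact norm_pos_iff.mp (by linarith)

open MeasureTheory in
lemma integrable_inv_mul {σ : ℝ} (hσ : 1 / 2 ≤ σ) :
    Integrable fun t : ℝ => 1 / (((σ : ℂ) + t * Complex.I) * (σ + t * Complex.I + 1)) := by
  refine Integrable.mono' (integrable_inv_one_add_sq.const_mul 4) ?_
    (Filter.Eventually.of_forall fun t => norm_inv_mul_le hσ t)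
  refine Continuous.aestronglyMeasurable ?_
  refine continuous_const.div (by fun_prop) fun t => perronKernel_ne_zero hσ t

open MeasureTheory in
lemma perron_one {σ y : ℝ} (hσ : 1 ≤ σ) (hy : 0 < y) :
    ((max (1 - y) 0 : ℝ) : ℂ) = (1 / (2 * Real.pi)) •
      ∫ t : ℝ, (y : ℂ) ^ (-(σ + t * Complex.I)) *
        (1 / ((σ + t * Complex.I) * (σ + t * Complex.I + 1))) := by
  set f : ℝ → ℂ := fun u => Set.indicator (Set.Ioc 0 1) (fun _ => 1 : ℝ → ℂ) u -
    Set.indicator (Set.Ioc 0 1) (fun t => (t : ℂ) ^ (1 : ℂ) : ℝ → ℂ) u with hf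
  have hfK : ∀ u : ℝ, 0 < u → f u = ((max (1 - u) 0 : ℝ) : ℂ) := by
    intro u hu
    simp only [hf, Set.indicator, Set.mem_Ioc, hu, true_and, Complex.cpow_one]
    split_ifs with h
    · rw [max_eq_left (by linarith)]; push_cast; rfl
    · rw [max_eq_right (by linarith)]; simp
  have hc : ContinuousAt f y := by
    have h1 : ContinuousAt (fun u : ℝ => ((max (1 - u) 0 : ℝ) : ℂ)) y := by fun_prop
    refine h1.congr ?_
    filter_upwards [eventually_gt_nhds hy] with u hu using (hfK u hu).symm
  have h := eq_integral_of_hasMellin (f := f) (F := fun s => 1 / (s * (s + 1))) (σ := σ) hy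
    (fun t => ?_) (integrable_inv_mul (by linarith)) hc
  · rw [← hfK y hy, h]
  · have hre : ((σ : ℂ) + t * Complex.I).re = σ := by simp
    have h1 := hasMellin_one_Ioc (s := σ + t * Complex.I) (by rw [hre]; linarith)
    have h2 := hasMellin_cpow_Ioc 1 (s := σ + t * Complex.I) (by rw [hre, Complex.one_re]; linarith)
    have h3 := hasMellin_sub h1.1 h2.1
    rw [h1.2, h2.2] at h3
    refine ⟨h3.1, h3.2.trans ?_⟩
    have h0 := perronKernel_ne_zero (σ := σ) (by linarith) t
    have ha := left_ne_zero_of_mul h0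
    have hb := right_ne_zero_of_mul h0
    field_simp
    ring

open MeasureTheory in
lemma perron_two {σ y : ℝ} (hσ : 1 < σ) (hy : 0 < y) (hy1 : y ≤ 1) :
    ((1 / (2 * y) - 1 + y / 2 : ℝ) : ℂ) = (1 / (2 * Real.pi)) •
      ∫ t : ℝ, (y : ℂ) ^ (-(σ + t * Complex.I)) * (1 / (σ + t * Complex.I - 1) *
        (1 / ((σ + t * Complex.I) * (σ + t * Complex.I + 1)))) := by
  set f : ℝ → ℂ := fun u =>
    (1 / 2 : ℂ) • Set.indicator (Set.Ioc 0 1) (fun t => (t : ℂ) ^ (-1 : ℂ) : ℝ → ℂ) u -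
    Set.indicator (Set.Ioc 0 1) (fun _ => 1 : ℝ → ℂ) u +
    (1 / 2 : ℂ) • Set.indicator (Set.Ioc 0 1) (fun t => (t : ℂ) ^ (1 : ℂ) : ℝ → ℂ) u with hf
  have hfK : ∀ u : ℝ, 0 < u → f u = ((1 / (2 * min u 1) - 1 + min u 1 / 2 : ℝ) : ℂ) := by
    intro u hu
    simp only [hf, Set.indicator, Set.mem_Ioc, hu, true_and, Complex.cpow_one]
    split_ifs with h
    · rw [min_eq_left h, Complex.cpow_neg_one]
      push_cast
      simp only [smul_eq_mul]
      have : (u : ℂ) ≠ 0 := by exact_mod_cast hu.ne'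
      field_simp
    · rw [min_eq_right (by linarith)]; norm_num
  have hc : ContinuousAt f y := by
    have h1 : ContinuousAt (fun u : ℝ => ((1 / (2 * min u 1) - 1 + min u 1 / 2 : ℝ) : ℂ)) y := by
      have : 2 * min y 1 ≠ 0 := by
        have := lt_min hy one_pos
        positivity
      fun_prop (disch := assumption)
    refine h1.congr ?_
    filter_upwards [eventually_gt_nhds hy] with u hu using (hfK u hu).symm
  have hre : ∀ t : ℝ, ((σ : ℂ) + t * Complex.I).re = σ := by simp
  have hs1 : ∀ t : ℝ, (σ : ℂ) + t * Complex.I - 1 ≠ 0 := by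
    intro t h
    have := congrArg Complex.re h
    rw [Complex.sub_re, hre] at this
    simp at this
    linarith
  have hint : Integrable fun t : ℝ => 1 / ((σ : ℂ) + t * Complex.I - 1) *
        (1 / ((σ + t * Complex.I) * (σ + t * Complex.I + 1))) := by
    refine Integrable.bdd_mul (c := 1 / (σ - 1)) (integrable_inv_mul (by linarith)) ?_ ?_
    · refine Continuous.aestronglyMeasurable ?_
      exact continuous_const.div (by fun_prop) hs1
    · refine Filter.Eventually.of_forall fun t => ?_
      rw [norm_div, norm_one]
      apply one_div_le_one_div_of_le (by linarith)
      have := Complex.re_le_norm ((σ : ℂ) + t * Complex.I - 1)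
      rwa [Complex.sub_re, hre, Complex.one_re] at this
  have h := eq_integral_of_hasMellin (f := f)
    (F := fun s => 1 / (s - 1) * (1 / (s * (s + 1)))) (σ := σ) hy
    (fun t => ?_) hint hc
  · rw [← h, hfK y hy, min_eq_left hy1]
  · have h1 := hasMellin_one_Ioc (s := σ + t * Complex.I) (by rw [hre]; linarith)
    have h2 := hasMellin_cpow_Ioc 1 (s := σ + t * Complex.I) (by rw [hre, Complex.one_re]; linarith)
    have h3 := hasMellin_cpow_Ioc (-1) (s := σ + t * Complex.I)
      (by rw [hre, Complex.neg_re, Complex.one_re]; linarith)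
    have h2' := hasMellin_const_smul h2.1 (1 / 2 : ℂ)
    have h3' := hasMellin_const_smul h3.1 (1 / 2 : ℂ)
    have h4 := hasMellin_sub h3'.1 h1.1
    have h5 := hasMellin_add h4.1 h2'.1
    rw [h4.2, h3'.2, h2'.2, h1.2, h2.2, h3.2] at h5
    refine ⟨h5.1, h5.2.trans ?_⟩
    have h0 := perronKernel_ne_zero (σ := σ) (by linarith) t
    have ha := left_ne_zero_of_mul h0
    have hb := right_ne_zero_of_mul h0
    have hc := hs1 t
    simp only [smul_eq_mul, ← sub_eq_add_neg]
    field_simp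
    ring

open ArithmeticFunction in
/-- The smoothed Chebyshev function `∑_{n ≤ x} Λ(n) (x - n)`. -/
noncomputable def psiOne (x : ℝ) : ℝ := ∑ n ∈ Ioc 0 ⌊x⌋₊, vonMangoldt n * (x - n)

open MeasureTheory ArithmeticFunction in
lemma integrable_mangoldt_term {σ x : ℝ} (hσ : 1 < σ) (hx : 0 < x) (n : ℕ) :
    Integrable (fun t : ℝ => (vonMangoldt n : ℂ) * (((n / x : ℝ) : ℂ) ^ (-(σ + t * Complex.I)) *
        (1 / ((σ + t * Complex.I) * (σ + t * Complex.I + 1))))) ∧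
    ∫ t : ℝ, ‖(vonMangoldt n : ℂ) * (((n / x : ℝ) : ℂ) ^ (-(σ + t * Complex.I)) *
        (1 / ((σ + t * Complex.I) * (σ + t * Complex.I + 1))))‖ =
      vonMangoldt n * (n : ℝ) ^ (-σ) * (x ^ σ *
        ∫ t : ℝ, ‖1 / (((σ : ℂ) + t * Complex.I) * (σ + t * Complex.I + 1))‖) := by
  rcases eq_or_ne n 0 with rfl | hn
  · simp
  have hn0 : (0 : ℝ) < n := by positivity
  have hy : 0 < (n : ℝ) / x := by positivity
  have hnorm : ∀ t : ℝ, ‖((n / x : ℝ) : ℂ) ^ (-((σ : ℂ) + t * Complex.I))‖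
      = (n : ℝ) ^ (-σ) * x ^ σ := by
    intro t
    rw [Complex.norm_cpow_eq_rpow_re_of_pos hy]
    simp only [Complex.neg_re, Complex.add_re, Complex.ofReal_re, Complex.mul_re, Complex.I_re,
      mul_zero, Complex.ofReal_im, Complex.I_im, mul_one, sub_self, add_zero]
    rw [Real.div_rpow hn0.le hx.le, Real.rpow_neg hx.le]
    field_simp
  constructor
  · refine Integrable.const_mul ?_ _
    refine Integrable.bdd_mul (c := (n : ℝ) ^ (-σ) * x ^ σ) (integrable_inv_mul (by linarith)) ?_ ?_
    · refine Continuous.aestronglyMeasurable ?_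
      exact Continuous.const_cpow (by fun_prop) (Or.inl (by exact_mod_cast hy.ne'))
    · exact Filter.Eventually.of_forall fun t => (hnorm t).le
  · rw [← integral_const_mul, ← integral_const_mul]
    congr 1
    funext t
    rw [norm_mul, norm_mul, hnorm]
    have : ‖(vonMangoldt n : ℂ)‖ = vonMangoldt n := by simp [abs_of_nonneg]
    rw [this]
    ring

open MeasureTheory ArithmeticFunction in
lemma psiOne_eq {σ x : ℝ} (hσ : 1 < σ) (hx : 0 < x) :
    ((psiOne x / x : ℝ) : ℂ) = (1 / (2 * Real.pi)) • ∫ t : ℝ, (x : ℂ) ^ (σ + t * Complex.I) *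
      (mangoldtSeries (σ + t * Complex.I) *
        (1 / ((σ + t * Complex.I) * (σ + t * Complex.I + 1)))) := by
  have hsum := hasSum_integral_of_summable_integral_norm
    (fun n => (integrable_mangoldt_term hσ hx n).1) (by
      simp_rw [(integrable_mangoldt_term hσ hx _).2]
      refine Summable.mul_right _ ?_
      have h0 := Complex.hasSum_re (hasSum_mangoldtSeries
        (s := (σ : ℂ) + ((0 : ℝ) : ℂ) * Complex.I) (by simpa using hσ))
      simp only [re_mangoldt_term, zero_mul, Real.cos_zero, mul_one] at h0
      exact h0.summable)
  have hrhs : ∀ t : ℝ, ∑' n : ℕ, (vonMangoldt n : ℂ) *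
      (((n / x : ℝ) : ℂ) ^ (-((σ : ℂ) + t * Complex.I)) *
        (1 / ((σ + t * Complex.I) * (σ + t * Complex.I + 1)))) =
      (x : ℂ) ^ ((σ : ℂ) + t * Complex.I) * (mangoldtSeries (σ + t * Complex.I) *
        (1 / ((σ + t * Complex.I) * (σ + t * Complex.I + 1)))) := by
    intro t
    have h := (hasSum_mangoldtSeries (s := (σ : ℂ) + t * Complex.I) (by simpa using hσ)).mul_left
      ((x : ℂ) ^ ((σ : ℂ) + t * Complex.I) *
        (1 / ((σ + t * Complex.I) * (σ + t * Complex.I + 1))))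
    have h2 : ∀ n : ℕ, (vonMangoldt n : ℂ) *
      (((n / x : ℝ) : ℂ) ^ (-((σ : ℂ) + t * Complex.I)) *
        (1 / ((σ + t * Complex.I) * (σ + t * Complex.I + 1)))) =
        (x : ℂ) ^ ((σ : ℂ) + t * Complex.I) *
        (1 / ((σ + t * Complex.I) * (σ + t * Complex.I + 1))) *
        ((vonMangoldt n : ℂ) * (n : ℂ) ^ (-((σ : ℂ) + t * Complex.I))) := by
      intro n
      have : ((n / x : ℝ) : ℂ) ^ (-((σ : ℂ) + t * Complex.I)) =
          (n : ℂ) ^ (-((σ : ℂ) + t * Complex.I)) * (x : ℂ) ^ ((σ : ℂ) + t * Complex.I) := by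
        rw [div_eq_mul_inv, Complex.ofReal_mul, Complex.mul_cpow_ofReal_nonneg (by positivity)
          (by positivity), Complex.ofReal_inv, Complex.inv_cpow, Complex.cpow_neg (x : ℂ), inv_inv]
        · simp
        · rw [Complex.arg_ofReal_of_nonneg hx.le]; exact Real.pi_pos.ne
      rw [this]
      ring
    simp_rw [h2]
    rw [h.tsum_eq]
    ring
  simp_rw [hrhs] at hsum
  have hlhs := hsum.const_smul (1 / (2 * Real.pi) : ℝ)
  rw [← hlhs.tsum_eq]
  have hterm : ∀ n : ℕ, (1 / (2 * Real.pi) : ℝ) • ∫ t : ℝ, (vonMangoldt n : ℂ) *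
      (((n / x : ℝ) : ℂ) ^ (-((σ : ℂ) + t * Complex.I)) *
        (1 / ((σ + t * Complex.I) * (σ + t * Complex.I + 1)))) =
      ((vonMangoldt n * max (1 - n / x) 0 : ℝ) : ℂ) := by
    intro n
    rcases eq_or_ne n 0 with rfl | hn
    · simp
    · rw [integral_const_mul, Complex.ofReal_mul, perron_one (σ := σ) hσ.le (by positivity)]
      rw [mul_smul_comm]
  simp_rw [hterm]
  rw [tsum_eq_sum (s := Ioc 0 ⌊x⌋₊)]
  · rw [psiOne, ← Complex.ofReal_sum, sum_div]
    congr 1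
    refine sum_congr rfl fun n hn => ?_
    rw [mem_Ioc] at hn
    have : (n : ℝ) ≤ x := (Nat.le_floor_iff hx.le).mp hn.2
    rw [max_eq_left]
    · field_simp
    · rw [sub_nonneg, div_le_one hx]; exact this
  · intro n hn
    rcases eq_or_ne n 0 with rfl | h0
    · simp
    · have : x < n := by
        by_contra! hc
        exact hn (mem_Ioc.mpr ⟨Nat.pos_of_ne_zero h0, Nat.le_floor hc⟩)
      rw [max_eq_right]
      · simp
      · rw [sub_nonpos, one_le_div hx]; exact this.le

/-- The integrand in Perron's formula. -/
noncomputable def perronIntegrand (x : ℝ) (s : ℂ) : ℂ :=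
  (x : ℂ) ^ s * (logDerivZeta₁ s * (1 / (s * (s + 1))))

lemma norm_logDerivZeta₁_le_of_one_lt : ∃ C : ℝ, 0 < C ∧ ∀ s : ℂ, 1 < s.re → s.re ≤ 2 →
    ‖logDerivZeta₁ s‖ ≤ 2 / (s.re - 1) + C := by
  obtain ⟨C, hC, h⟩ := exists_mangoldtSeries_real_le
  refine ⟨C, hC, fun s h1 h2 => ?_⟩
  have h3 := mangoldtSeries_eq h1
  have h4 := norm_mangoldtSeries_le h1
  have h5 := h s.re h1 h2
  have h6 : ‖1 / (s - 1)‖ ≤ 1 / (s.re - 1) := by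
    rw [norm_div, norm_one]
    apply one_div_le_one_div_of_le (by linarith)
    simpa using Complex.re_le_norm (s - 1)
  have h7 : logDerivZeta₁ s = 1 / (s - 1) - mangoldtSeries s := by rw [h3]; ring
  have h8 : 2 / (s.re - 1) = 1 / (s.re - 1) + 1 / (s.re - 1) := by ring
  rw [h7, h8]
  refine (norm_sub_le _ _).trans ?_
  linarith

lemma norm_ofReal_cpow {x : ℝ} (hx : 0 < x) (σ t : ℝ) :
    ‖(x : ℂ) ^ ((σ : ℂ) + t * Complex.I)‖ = x ^ σ := by
  rw [Complex.norm_cpow_eq_rpow_re_of_pos hx]; simp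

lemma norm_perronIntegrand_le {x σ t A : ℝ} (hx : 0 < x) (hσ : 1 / 2 ≤ σ)
    (hA : ‖logDerivZeta₁ (σ + t * Complex.I)‖ ≤ A) :
    ‖perronIntegrand x (σ + t * Complex.I)‖ ≤ x ^ σ * A * 4 * (1 + t ^ 2)⁻¹ := by
  rw [perronIntegrand, norm_mul, norm_mul, norm_ofReal_cpow hx]
  have h1 := norm_inv_mul_le hσ t
  have hA0 : 0 ≤ A := (norm_nonneg _).trans hA
  calc _ ≤ x ^ σ * (A * (4 * (1 + t ^ 2)⁻¹)) := by gcongr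
    _ = _ := by ring

open MeasureTheory in
lemma integrable_perronIntegrand {x σ : ℝ} (hx : 0 < x) (hσ : 1 < σ) (hσ2 : σ ≤ 2) :
    Integrable fun t : ℝ => perronIntegrand x (σ + t * Complex.I) := by
  obtain ⟨C, hC, h⟩ := norm_logDerivZeta₁_le_of_one_lt
  have hre : ∀ t : ℝ, ((σ : ℂ) + t * Complex.I).re = σ := by simp
  refine Integrable.mono' (integrable_inv_one_add_sq.const_mul (x ^ σ * (2 / (σ - 1) + C) * 4)) ?_
    (Filter.Eventually.of_forall fun t => norm_perronIntegrand_le hx (by linarith) ?_)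
  · refine Continuous.aestronglyMeasurable ?_
    unfold perronIntegrand logDerivZeta₁
    refine Continuous.mul ?_ (Continuous.mul ?_ ?_)
    · exact Continuous.const_cpow (by fun_prop) (Or.inl (by exact_mod_cast hx.ne'))
    · have h1 : Continuous (deriv riemannZeta₁) :=
        (differentiable_riemannZeta₁.contDiff (n := 1)).continuous_deriv le_rfl
      have h2 : Continuous riemannZeta₁ := differentiable_riemannZeta₁.continuous
      refine Continuous.div (by fun_prop) (by fun_prop) fun t => ?_
      exact riemannZeta₁_ne_zero (by rw [hre]; linarith)
    · exact continuous_const.div (by fun_prop) fun t => perronKernel_ne_zero (by linarith) t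
  · have := h (σ + t * Complex.I) (by rw [hre]; exact hσ) (by rw [hre]; exact hσ2)
    rwa [hre] at this

open MeasureTheory in
lemma psiOne_sub_eq {x σ : ℝ} (hx : 1 ≤ x) (hσ : 1 < σ) (hσ2 : σ ≤ 2) :
    ((psiOne x / x - (x / 2 - 1 + 1 / (2 * x)) : ℝ) : ℂ) =
      -((1 / (2 * Real.pi)) • ∫ t : ℝ, perronIntegrand x (σ + t * Complex.I)) := by
  have hx0 : 0 < x := by linarith
  have hre : ∀ t : ℝ, ((σ : ℂ) + t * Complex.I).re = σ := by simp
  have h1 := psiOne_eq hσ hx0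
  have h2 := perron_two hσ (y := 1 / x) (by positivity) (by rw [div_le_one hx0]; exact hx)
  have hinv : ∀ t : ℝ, ((1 / x : ℝ) : ℂ) ^ (-((σ : ℂ) + t * Complex.I)) =
      (x : ℂ) ^ ((σ : ℂ) + t * Complex.I) := by
    intro t
    rw [one_div, Complex.ofReal_inv, Complex.inv_cpow, Complex.cpow_neg (x : ℂ), inv_inv]
    rw [Complex.arg_ofReal_of_nonneg hx0.le]; exact Real.pi_pos.ne
  simp_rw [hinv] at h2
  have e1 : 1 / (2 * (1 / x)) - 1 + 1 / x / 2 = x / 2 - 1 + 1 / (2 * x) := by field_simp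
  rw [e1] at h2
  rw [Complex.ofReal_sub, h1, h2, ← smul_sub, ← smul_neg]
  congr 1
  have hi := integrable_perronIntegrand hx0 hσ hσ2
  have e2 : ∀ t : ℝ, (x : ℂ) ^ ((σ : ℂ) + t * Complex.I) * (1 / (σ + t * Complex.I - 1) *
      (1 / ((σ + t * Complex.I) * (σ + t * Complex.I + 1)))) =
      (x : ℂ) ^ ((σ : ℂ) + t * Complex.I) * (mangoldtSeries (σ + t * Complex.I) *
      (1 / ((σ + t * Complex.I) * (σ + t * Complex.I + 1)))) +
      perronIntegrand x (σ + t * Complex.I) := by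
    intro t
    rw [mangoldtSeries_eq (by rw [hre]; exact hσ), perronIntegrand]
    ring
  have hs1 : ∀ t : ℝ, (σ : ℂ) + t * Complex.I - 1 ≠ 0 := by
    intro t h
    have := congrArg Complex.re h
    rw [Complex.sub_re, hre] at this
    simp at this
    linarith
  have hi2 : Integrable fun t : ℝ => (x : ℂ) ^ ((σ : ℂ) + t * Complex.I) *
      (1 / (σ + t * Complex.I - 1) * (1 / ((σ + t * Complex.I) * (σ + t * Complex.I + 1)))) := by
    refine Integrable.bdd_mul (c := x ^ σ) (Integrable.bdd_mul (c := 1 / (σ - 1))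
      (integrable_inv_mul (by linarith)) ?_ ?_) ?_
      (Filter.Eventually.of_forall fun t => (norm_ofReal_cpow hx0 σ t).le)
    · refine Continuous.aestronglyMeasurable ?_
      exact continuous_const.div (by fun_prop) hs1
    · refine Filter.Eventually.of_forall fun t => ?_
      rw [norm_div, norm_one]
      apply one_div_le_one_div_of_le (by linarith)
      have := Complex.re_le_norm ((σ : ℂ) + t * Complex.I - 1)
      rwa [Complex.sub_re, hre, Complex.one_re] at this
    · refine Continuous.aestronglyMeasurable ?_
      exact Continuous.const_cpow (by fun_prop) (Or.inl (by exact_mod_cast hx0.ne'))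
  have hi3 : Integrable fun t : ℝ => (x : ℂ) ^ ((σ : ℂ) + t * Complex.I) *
      (mangoldtSeries (σ + t * Complex.I) *
      (1 / ((σ + t * Complex.I) * (σ + t * Complex.I + 1)))) := by
    refine (hi2.sub hi).congr (Filter.Eventually.of_forall fun t => ?_)
    simp only [Pi.sub_apply, e2]
    ring
  rw [← integral_sub hi3 hi2, ← integral_neg]
  congr 1
  funext t
  rw [e2]
  ring

lemma norm_integral_rect_le {f : ℂ → ℂ} {σ₁ σ T H : ℝ} (hσ : σ₁ ≤ σ) (hT : 0 ≤ T)
    (hf : ∀ s : ℂ, σ₁ ≤ s.re → s.re ≤ σ → |s.im| ≤ T → DifferentiableAt ℂ f s)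
    (hH : ∀ u ∈ Set.Icc σ₁ σ, ‖f (u + ((T : ℝ) : ℂ) * Complex.I)‖ ≤ H ∧
      ‖f (u + ((-T : ℝ) : ℂ) * Complex.I)‖ ≤ H) :
    ‖∫ t in (-T)..T, f (σ + t * Complex.I)‖ ≤ ‖∫ t in (-T)..T, f (σ₁ + t * Complex.I)‖ +
      2 * H * (σ - σ₁) := by
  have h := Complex.integral_boundary_rect_eq_zero_of_differentiableOn f
    (σ₁ + ((-T : ℝ) : ℂ) * Complex.I) (σ + ((T : ℝ) : ℂ) * Complex.I) (by
      intro s hs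
      rw [Complex.mem_reProdIm] at hs
      simp only [Complex.add_re, Complex.ofReal_re, Complex.mul_re, Complex.I_re, mul_zero,
        Complex.ofReal_im, Complex.I_im, mul_one, sub_self, add_zero, Complex.add_im,
        Complex.mul_im, zero_add] at hs
      rw [Set.uIcc_of_le hσ, Set.uIcc_of_le (by linarith)] at hs
      exact (hf s hs.1.1 hs.1.2 (abs_le.mpr hs.2)).differentiableWithinAt)
  simp only [Complex.add_re, Complex.ofReal_re, Complex.mul_re, Complex.I_re, mul_zero,
        Complex.ofReal_im, Complex.I_im, mul_one, sub_self, add_zero, Complex.add_im,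
        Complex.mul_im, zero_add, smul_eq_mul] at h
  have b1 : ‖∫ u in σ₁..σ, f (u + ((-T : ℝ) : ℂ) * Complex.I)‖ ≤ H * |σ - σ₁| := by
    apply intervalIntegral.norm_integral_le_of_norm_le_const
    intro u hu
    rw [Set.uIoc_of_le hσ] at hu
    exact (hH u ⟨hu.1.le, hu.2⟩).2
  have b2 : ‖∫ u in σ₁..σ, f (u + ((T : ℝ) : ℂ) * Complex.I)‖ ≤ H * |σ - σ₁| := by
    apply intervalIntegral.norm_integral_le_of_norm_le_const
    intro u hu
    rw [Set.uIoc_of_le hσ] at hu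
    exact (hH u ⟨hu.1.le, hu.2⟩).1
  rw [abs_of_nonneg (by linarith)] at b1 b2
  set a := ∫ u in σ₁..σ, f (u + ((-T : ℝ) : ℂ) * Complex.I)
  set c := ∫ u in σ₁..σ, f (u + ((T : ℝ) : ℂ) * Complex.I)
  set p := ∫ t in (-T)..T, f (σ + t * Complex.I)
  set q := ∫ t in (-T)..T, f (σ₁ + t * Complex.I)
  have e : p = q + Complex.I * (a - c) := by
    linear_combination (-Complex.I) * h + (p - q) * Complex.I_mul_I
  rw [e]
  have e2 : ‖Complex.I * (a - c)‖ ≤ ‖a‖ + ‖c‖ := by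
    rw [norm_mul, Complex.norm_I, one_mul]; exact norm_sub_le _ _
  refine (norm_add_le _ _).trans ?_
  linarith

open MeasureTheory in
lemma norm_integral_tails_le {f : ℝ → ℂ} {T A : ℝ} (hT : 0 < T) (hf : Integrable f)
    (hA : ∀ t, ‖f t‖ ≤ A * (1 + t ^ 2)⁻¹) :
    ‖∫ t, f t‖ ≤ ‖∫ t in (-T)..T, f t‖ + 2 * A / T := by
  have h1 := integral_add_compl (s := Set.Ioc (-T) T) measurableSet_Ioc hf
  have h2 := integral_add_compl (s := Set.Ioc (-T) T) measurableSet_Ioc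
    (integrable_inv_one_add_sq.const_mul A)
  rw [intervalIntegral.integral_of_le (by linarith), ← h1]
  refine (norm_add_le _ _).trans ?_
  gcongr
  have h3 : ‖∫ t in (Set.Ioc (-T) T)ᶜ, f t‖ ≤ ∫ t in (Set.Ioc (-T) T)ᶜ, A * (1 + t ^ 2)⁻¹ :=
    norm_integral_le_of_norm_le (integrable_inv_one_add_sq.const_mul A).integrableOn
      (Filter.Eventually.of_forall hA)
  refine h3.trans ?_
  rw [integral_const_mul, integral_const_mul, integral_const_mul, integral_univ_inv_one_add_sq,
    ← intervalIntegral.integral_of_le (by linarith), integral_inv_one_add_sq, Real.arctan_neg]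
    at h2
  rw [integral_const_mul]
  have hA0 : 0 ≤ A := by simpa using (norm_nonneg _).trans (hA 0)
  have h5 := Real.arctan_inv_of_pos hT
  have h6 : Real.arctan T⁻¹ ≤ T⁻¹ := by
    have := Real.le_tan (Real.arctan_nonneg.mpr (inv_nonneg.mpr hT.le)) (Real.arctan_lt_pi_div_two _)
    rwa [Real.tan_arctan] at this
  have h7 : A * ∫ t in (Set.Ioc (-T) T)ᶜ, (1 + t ^ 2)⁻¹ = A * (2 * Real.arctan T⁻¹) := by
    rw [h5]; linarith
  rw [h7]
  calc A * (2 * Real.arctan T⁻¹) ≤ A * (2 * T⁻¹) := by gcongr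
    _ = _ := by ring

lemma differentiableAt_perronIntegrand {x : ℝ} (hx : 0 < x) {s : ℂ} (hs : 0 < s.re)
    (h0 : riemannZeta₁ s ≠ 0) : DifferentiableAt ℂ (perronIntegrand x) s := by
  have h1 : Differentiable ℂ riemannZeta₁ := differentiable_riemannZeta₁
  have h2 : Differentiable ℂ (deriv riemannZeta₁) := by
    have := h1.contDiff (n := 2)
    exact this.differentiable_deriv_two
  have hs0 : s ≠ 0 := by rintro rfl; simp at hs
  have hs1 : s + 1 ≠ 0 := by
    intro h
    have := congrArg Complex.re h
    simp at this
    linarith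
  unfold perronIntegrand logDerivZeta₁
  refine DifferentiableAt.mul ?_ (DifferentiableAt.mul ?_ ?_)
  · exact differentiableAt_id.const_cpow (Or.inl (by exact_mod_cast hx.ne'))
  · exact (h2 s).div (h1 s) h0
  · exact (differentiableAt_const _).div (by fun_prop) (mul_ne_zero hs0 hs1)

lemma norm_integral_inv_one_add_sq_le {f : ℝ → ℂ} {T A : ℝ} (hT : 0 ≤ T)
    (hA : ∀ t, |t| ≤ T → ‖f t‖ ≤ A * (1 + t ^ 2)⁻¹) :
    ‖∫ t in (-T)..T, f t‖ ≤ A * Real.pi := by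
  have hA0 : 0 ≤ A := by simpa using (norm_nonneg _).trans (hA 0 (by simpa using hT))
  have hi : IntervalIntegrable (fun t : ℝ => A * (1 + t ^ 2)⁻¹) MeasureTheory.volume (-T) T :=
    (integrable_inv_one_add_sq.const_mul A).intervalIntegrable
  refine (intervalIntegral.norm_integral_le_of_norm_le (by linarith)
    (MeasureTheory.ae_of_all _ fun t ht => hA t (abs_le.mpr ⟨ht.1.le, ht.2⟩)) hi).trans ?_
  rw [intervalIntegral.integral_const_mul, integral_inv_one_add_sq, Real.arctan_neg]
  have := (Real.arctan_lt_pi_div_two T).le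
  gcongr
  linarith

lemma sq_mul_exp_neg_le {b w : ℝ} (hb : 0 < b) (hw : 0 ≤ w) :
    w ^ 2 * Real.exp (-(b * w)) ≤ 8 / b ^ 2 * Real.exp (-(b / 2 * w)) := by
  have h := Real.pow_div_factorial_le_exp (b / 2 * w) (by positivity) 2
  have h1 : w ^ 2 ≤ 8 / b ^ 2 * Real.exp (b / 2 * w) := by
    have e : w ^ 2 = 8 / b ^ 2 * ((b / 2 * w) ^ 2 / (Nat.factorial 2 : ℝ)) := by
      simp only [Nat.factorial]
      push_cast
      field_simp
      norm_num
    rw [e]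
    gcongr
  calc w ^ 2 * Real.exp (-(b * w)) ≤ 8 / b ^ 2 * Real.exp (b / 2 * w) * Real.exp (-(b * w)) := by
        gcongr
    _ = _ := by
      rw [mul_assoc, ← Real.exp_add]
      ring_nf

set_option maxHeartbeats 1000000 in
lemma exists_abs_psiOne_sub_le : ∃ c C x₀ : ℝ, 0 < c ∧ 0 < C ∧ 1 ≤ x₀ ∧ ∀ x : ℝ, x₀ ≤ x →
    |psiOne x - x ^ 2 / 2| ≤ C * x ^ 2 * Real.exp (-(c * √(Real.log x))) := by
  obtain ⟨b, C₁, hb, hb2, hC₁, hD⟩ := exists_norm_logDerivZeta₁_le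
  obtain ⟨C₂, hC₂, hD2⟩ := norm_logDerivZeta₁_le_of_one_lt
  set K : ℝ := 36 * Real.pi * C₁ + 72 * Real.exp 1 * C₁ + 8 * Real.exp 1 * (2 + C₂) with hK
  have hK0 : 0 < K := by positivity
  refine ⟨b / 6, (K + 2) * (72 / b ^ 2), Real.exp ((3 / b) ^ 2), by positivity, by positivity,
    Real.one_le_exp (by positivity), fun x hx => ?_⟩
  have hx0 : 0 < x := (Real.exp_pos _).trans_le hx
  have hlogx : (3 / b) ^ 2 ≤ Real.log x := (Real.le_log_iff_exp_le hx0).mpr hx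
  set w := √(Real.log x) with hw
  have hw3 : 3 / b ≤ w := Real.le_sqrt_of_sq_le hlogx
  have hw0 : 6 ≤ w := by
    refine le_trans ?_ hw3
    rw [le_div_iff₀ hb]; linarith
  have hwb : 3 ≤ b * w := by rwa [div_le_iff₀ hb, mul_comm] at hw3
  have hw2 : w ^ 2 = Real.log x := Real.sq_sqrt (le_trans (by positivity) hlogx)
  have hxw : x = Real.exp (w ^ 2) := by rw [hw2, Real.exp_log hx0]
  have hx1 : 1 ≤ x := by rw [hxw]; exact Real.one_le_exp (by positivity)
  set σ : ℝ := 1 + 1 / w ^ 2 with hσ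
  have hw2i : 1 / w ^ 2 ≤ 1 := by
    rw [div_le_one (by positivity)]; nlinarith
  have hσ1 : 1 < σ := by
    have : 0 < 1 / w ^ 2 := by positivity
    linarith
  have hσ2 : σ ≤ 2 := by linarith
  have hxσ : x ^ σ = x * Real.exp 1 := by
    rw [hxw, ← Real.exp_mul, ← Real.exp_add, hσ]
    congr 1
    field_simp
  set T := Real.exp w with hT
  have hT1 : 1 ≤ T := Real.one_le_exp (by linarith)
  have hT0 : 0 < T := by linarith
  set L := Real.log (T + 4) with hL
  have hL1 : 1 ≤ L := by
    rw [hL, Real.le_log_iff_exp_le (by positivity)]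
    linarith [Real.exp_one_lt_d9]
  have hL3 : L ≤ 3 * w := by
    rw [hL, Real.log_le_iff_le_exp (by positivity)]
    have h1 : Real.exp (3 * w) = T * Real.exp (2 * w) := by
      rw [hT, ← Real.exp_add]; ring_nf
    have h2 : 5 ≤ Real.exp (2 * w) := by
      have := Real.add_one_le_exp (2 * w); linarith
    rw [h1]
    nlinarith
  have hL0 : 0 < L := by linarith
  have hbL : b / L ≤ 1 / 2 := (div_le_self hb.le hL1).trans hb2
  have hbL0 : 0 < b / L := by positivity
  set σ₁ : ℝ := 1 - b / L with hσ₁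
  have hσ₁2 : 1 / 2 ≤ σ₁ := by linarith
  have hwbL : 1 / w ^ 2 ≤ b / L := by
    rw [div_le_div_iff₀ (by positivity) hL0]
    nlinarith
  have hre : ∀ u t : ℝ, ((u : ℂ) + t * Complex.I).re = u := by simp
  have him : ∀ u t : ℝ, ((u : ℂ) + t * Complex.I).im = t := by simp
  have hDu : ∀ u t : ℝ, σ₁ ≤ u → u ≤ σ → |t| ≤ T →
      ‖logDerivZeta₁ (u + t * Complex.I)‖ ≤ C₁ * L ^ 2 := by
    intro u t h1 h2 h3
    exact (hD T hT0.le (u + t * Complex.I) (by rwa [him]) (by rwa [hre])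
      (by rw [hre]; linarith)).2
  have htail := norm_integral_tails_le (T := T) hT0 (integrable_perronIntegrand hx0 hσ1 hσ2)
    (A := x ^ σ * (2 / (1 / w ^ 2) + C₂) * 4) (fun t => norm_perronIntegrand_le hx0 (by linarith) (by
      have := hD2 (σ + t * Complex.I) (by rwa [hre]) (by rwa [hre])
      rwa [hre, hσ, add_sub_cancel_left, ← hσ] at this))
  have hrect := norm_integral_rect_le (f := perronIntegrand x) (σ₁ := σ₁) (σ := σ) (T := T)
    (H := x ^ σ * (C₁ * L ^ 2) * 4 * (1 + T ^ 2)⁻¹) (by linarith) hT0.le (by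
      intro s h1 h2 h3
      exact differentiableAt_perronIntegrand hx0 (by linarith)
        (hD T hT0.le s h3 h1 (by linarith)).1) (by
      intro u hu
      have hle : x ^ u ≤ x ^ σ := Real.rpow_le_rpow_of_exponent_le hx1 hu.2
      constructor
      · refine (norm_perronIntegrand_le hx0 (by linarith [hu.1])
          (hDu u T hu.1 hu.2 (abs_of_pos hT0).le)).trans ?_
        gcongr
      · refine (norm_perronIntegrand_le hx0 (by linarith [hu.1])
          (hDu u (-T) hu.1 hu.2 (by rw [abs_neg, abs_of_pos hT0]))).trans ?_
        rw [neg_sq]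
        gcongr)
  have hleft := norm_integral_inv_one_add_sq_le (T := T) hT0.le
    (f := fun t => perronIntegrand x (σ₁ + t * Complex.I)) (A := x ^ σ₁ * (C₁ * L ^ 2) * 4)
    (fun t ht => norm_perronIntegrand_le hx0 hσ₁2 (hDu σ₁ t le_rfl (by linarith) ht))
  have heq := psiOne_sub_eq hx1 hσ1 hσ2
  set I := ∫ t : ℝ, perronIntegrand x (σ + t * Complex.I) with hI
  set E := Real.exp (-(b / 3 * w)) with hE
  have hxσ₁ : x ^ σ₁ ≤ x * E := by
    rw [hσ₁, Real.rpow_sub hx0, Real.rpow_one, div_eq_mul_inv, ← Real.rpow_neg hx0.le]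
    gcongr
    rw [hxw, ← Real.exp_mul, hE]
    apply Real.exp_le_exp.mpr
    have : b / 3 * w ≤ w ^ 2 * (b / L) := by
      rw [mul_div_assoc', le_div_iff₀ hL0]
      calc b / 3 * w * L ≤ b / 3 * w * (3 * w) := by gcongr
        _ = _ := by ring
    linarith
  have hTE : T⁻¹ ≤ E := by
    rw [hT, ← Real.exp_neg, hE]
    apply Real.exp_le_exp.mpr
    have : b / 3 * w ≤ w := mul_le_of_le_one_left (by linarith) (by linarith)
    linarith
  have hT2E : (1 + T ^ 2)⁻¹ ≤ E := by
    refine le_trans ?_ hTE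
    apply inv_anti₀ hT0
    have : T * 1 ≤ T * T := by gcongr
    rw [sq]; linarith
  have hL2 : L ^ 2 ≤ 9 * w ^ 2 := by
    calc L ^ 2 ≤ (3 * w) ^ 2 := by gcongr
      _ = _ := by ring
  have hE0 : 0 < E := Real.exp_pos _
  have hw21 : 1 ≤ w ^ 2 := one_le_pow₀ (by linarith)
  have hInorm : ‖I‖ ≤ K * (x * (w ^ 2 * E)) := by
    have t1 : x ^ σ₁ * (C₁ * L ^ 2) * 4 * Real.pi ≤ 36 * Real.pi * C₁ * (x * (w ^ 2 * E)) := by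
      calc _ ≤ x * E * (C₁ * (9 * w ^ 2)) * 4 * Real.pi := by gcongr
        _ = _ := by ring
    have t2 : 2 * (x ^ σ * (C₁ * L ^ 2) * 4 * (1 + T ^ 2)⁻¹) * (σ - σ₁) ≤
        72 * Real.exp 1 * C₁ * (x * (w ^ 2 * E)) := by
      calc _ ≤ 2 * (x * Real.exp 1 * (C₁ * (9 * w ^ 2)) * 4 * E) * 1 := by
            rw [hxσ]
            have : 0 ≤ σ - σ₁ := by linarith
            have : σ - σ₁ ≤ 1 := by linarith
            gcongr
        _ = _ := by ring
    have t3 : 2 * (x ^ σ * (2 / (1 / w ^ 2) + C₂) * 4) / T ≤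
        8 * Real.exp 1 * (2 + C₂) * (x * (w ^ 2 * E)) := by
      have : 2 / (1 / w ^ 2) + C₂ ≤ (2 + C₂) * w ^ 2 := by
        rw [div_div_eq_mul_div, div_one]
        nlinarith
      rw [div_eq_mul_inv, hxσ]
      calc _ ≤ 2 * (x * Real.exp 1 * ((2 + C₂) * w ^ 2) * 4) * E := by gcongr
        _ = _ := by ring
    rw [hK]
    linarith
  have hpi : ‖(1 / (2 * Real.pi)) • I‖ ≤ ‖I‖ := by
    rw [norm_smul]
    apply mul_le_of_le_one_left (norm_nonneg _)
    rw [Real.norm_of_nonneg (by positivity), div_le_one (by positivity)]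
    linarith [Real.pi_gt_three]
  have hmain : |psiOne x / x - (x / 2 - 1 + 1 / (2 * x))| ≤ K * (x * (w ^ 2 * E)) := by
    rw [← Real.norm_eq_abs, ← Complex.norm_real, heq, norm_neg]
    exact hpi.trans hInorm
  have hxE : 1 ≤ x * (w ^ 2 * E) := by
    have h1 : 1 ≤ x * E := by
      rw [hxw, hE, ← Real.exp_add]
      apply Real.one_le_exp
      have : b / 3 * w ≤ w * w := by gcongr; linarith
      rw [sq]; linarith
    calc (1 : ℝ) ≤ x * E := h1
      _ = x * (1 * E) := by ring
      _ ≤ _ := by gcongr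
  have h2 : |psiOne x / x - x / 2| ≤ (K + 2) * (x * (w ^ 2 * E)) := by
    have hxi : 1 / (2 * x) ≤ 1 := by rw [div_le_one (by positivity)]; linarith
    have hxi0 : 0 < 1 / (2 * x) := by positivity
    have := abs_le.mp hmain
    rw [abs_le]
    constructor <;> linarith
  have h3 : |psiOne x - x ^ 2 / 2| = x * |psiOne x / x - x / 2| := by
    rw [← abs_of_pos hx0, ← abs_mul, abs_of_pos hx0]
    congr 1
    field_simp
  rw [h3]
  have h4 := sq_mul_exp_neg_le (b := b / 3) (w := w) (by positivity) (by linarith)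
  have e6 : b / 3 / 2 = b / 6 := by ring
  have e72 : 8 / (b / 3) ^ 2 = 72 / b ^ 2 := by field_simp; norm_num
  rw [e6, e72] at h4
  calc x * |psiOne x / x - x / 2| ≤ x * ((K + 2) * (x * (w ^ 2 * E))) := by gcongr
    _ ≤ x * ((K + 2) * (x * (72 / b ^ 2 * Real.exp (-(b / 6 * w))))) := by gcongr
    _ = _ := by ring

open ArithmeticFunction in
lemma psiOne_sub_bounds {x h : ℝ} (hx : 0 ≤ x) (hh : 0 ≤ h) :
    Chebyshev.psi x * h ≤ psiOne (x + h) - psiOne x ∧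
      psiOne (x + h) - psiOne x ≤ Chebyshev.psi (x + h) * h := by
  have hle : ⌊x⌋₊ ≤ ⌊x + h⌋₊ := Nat.floor_mono (by linarith)
  have hsplit : psiOne (x + h) - psiOne x = Chebyshev.psi x * h +
      ∑ n ∈ Ioc ⌊x⌋₊ ⌊x + h⌋₊, vonMangoldt n * (x + h - n) := by
    rw [psiOne, psiOne, Chebyshev.psi, ← sum_Ioc_consecutive _ (Nat.zero_le _) hle, sum_mul,
      add_sub_right_comm, ← sum_sub_distrib]
    congr 1
    refine sum_congr rfl fun n _ => by ring
  have hpsi : Chebyshev.psi (x + h) = Chebyshev.psi x +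
      ∑ n ∈ Ioc ⌊x⌋₊ ⌊x + h⌋₊, vonMangoldt n := by
    rw [Chebyshev.psi, Chebyshev.psi, ← sum_Ioc_consecutive _ (Nat.zero_le _) hle]
  have h0 : 0 ≤ ∑ n ∈ Ioc ⌊x⌋₊ ⌊x + h⌋₊, vonMangoldt n * (x + h - n) := by
    refine sum_nonneg fun n hn => mul_nonneg vonMangoldt_nonneg ?_
    rw [mem_Ioc] at hn
    have := (Nat.le_floor_iff (by linarith)).mp hn.2
    linarith
  have h1 : ∑ n ∈ Ioc ⌊x⌋₊ ⌊x + h⌋₊, vonMangoldt n * (x + h - n) ≤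
      ∑ n ∈ Ioc ⌊x⌋₊ ⌊x + h⌋₊, vonMangoldt n * h := by
    refine sum_le_sum fun n hn => mul_le_mul_of_nonneg_left ?_ vonMangoldt_nonneg
    rw [mem_Ioc] at hn
    have := (Nat.floor_lt hx).mp hn.1
    linarith
  rw [hsplit, hpsi, add_mul, sum_mul]
  constructor <;> linarith

/-- The prime number theorem with the classical error term. -/
theorem exists_abs_psi_sub_le : ∃ c C : ℝ, 0 < c ∧ 0 < C ∧ ∀ x : ℝ, 1 ≤ x →
    |Chebyshev.psi x - x| ≤ C * x * Real.exp (-(c * √(Real.log x))) := by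
  obtain ⟨c, C, x₀, hc, hC, hx₀, h⟩ := exists_abs_psiOne_sub_le
  set x₁ : ℝ := 2 * x₀ + 2 with hx₁
  set B : ℝ := (Chebyshev.psi x₁ + x₁) * Real.exp (c / 4 * √(Real.log x₁)) with hB
  have hBpos : 0 < B := by
    have := Chebyshev.psi_nonneg x₁
    have : 0 < x₁ := by linarith
    positivity
  refine ⟨c / 4, 1 + 10 * C + B, by positivity, by positivity, fun x hx => ?_⟩
  set δ := Real.exp (-(c / 4 * √(Real.log x))) with hδ
  have hδ0 : 0 < δ := Real.exp_pos _
  rcases le_or_gt x x₁ with hsmall | hlarge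
  · have h1 : |Chebyshev.psi x - x| ≤ Chebyshev.psi x₁ + x₁ := by
      have h2 := Chebyshev.psi_mono hsmall
      have h3 := Chebyshev.psi_nonneg x
      rw [abs_le]
      constructor <;> linarith
    have h4 : Chebyshev.psi x₁ + x₁ ≤ B * δ := by
      rw [hB, hδ, mul_assoc, ← Real.exp_add]
      have : 0 ≤ Chebyshev.psi x₁ + x₁ := (abs_nonneg _).trans h1
      apply le_mul_of_one_le_right this
      apply Real.one_le_exp
      have : √(Real.log x) ≤ √(Real.log x₁) := by gcongr
      nlinarith
    calc |Chebyshev.psi x - x| ≤ B * δ := h1.trans h4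
      _ = B * 1 * δ := by ring
      _ ≤ (1 + 10 * C + B) * x * δ := by
        gcongr
        linarith
  · have hx0 : 0 < x := by linarith
    have hδ1 : δ ≤ 1 := Real.exp_le_one_iff.mpr (by
      have : 0 ≤ c / 4 * √(Real.log x) := by positivity
      linarith)
    set η := x / 2 * δ with hη
    have hη0 : 0 < η := by positivity
    have hηx : η ≤ x / 2 := mul_le_of_le_one_right (by positivity) hδ1
    have hε : ∀ u, x / 2 ≤ u → Real.exp (-(c * √(Real.log u))) ≤ δ ^ 2 := by
      intro u hu
      have hu0 : 0 < u := by linarith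
      rw [hδ, ← Real.exp_nat_mul]
      apply Real.exp_le_exp.mpr
      have h4 : √(Real.log x) / 2 ≤ √(Real.log u) := by
        apply Real.le_sqrt_of_sq_le
        rw [div_pow, Real.sq_sqrt (Real.log_nonneg hx)]
        have h5 : Real.log (x / 2) ≤ Real.log u := Real.log_le_log (by positivity) hu
        rw [Real.log_div (by positivity) (by norm_num)] at h5
        have h6 : 2 * Real.log 2 ≤ Real.log x := by
          rw [← Real.log_rpow (by norm_num)]
          apply Real.log_le_log (by norm_num)
          norm_num
          linarith
        have : 0 ≤ Real.log x := Real.log_nonneg hx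
        linarith
      push_cast
      nlinarith
    have hb : ∀ u, x / 2 ≤ u → |psiOne u - u ^ 2 / 2| ≤ C * u ^ 2 * δ ^ 2 := by
      intro u hu
      refine (h u (by linarith)).trans ?_
      have := hε u hu
      gcongr
    have b1 := abs_le.mp (hb x (by linarith))
    have b2 := abs_le.mp (hb (x + η) (by linarith))
    have b3 := abs_le.mp (hb (x - η) (by linarith))
    have p1 := (psiOne_sub_bounds hx0.le hη0.le).1
    have p2 := (psiOne_sub_bounds (x := x - η) (by linarith) hη0.le).2
    rw [sub_add_cancel] at p2
    have q1 : C * (x + η) ^ 2 * δ ^ 2 ≤ C * (2 * x) ^ 2 * δ ^ 2 := by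
      gcongr; linarith
    have q2 : C * (x - η) ^ 2 * δ ^ 2 ≤ C * x ^ 2 * δ ^ 2 := by
      have : 0 ≤ x - η := by linarith
      gcongr; linarith
    have q3 : C * x ^ 2 * δ ^ 2 = 2 * C * x * δ * η := by rw [hη]; ring
    have q4 : C * (2 * x) ^ 2 * δ ^ 2 = 8 * C * x * δ * η := by rw [hη]; ring
    have r1 : (Chebyshev.psi x - x) * η ≤ (1 + 10 * C) * x * δ * η := by
      have : η * η ≤ x * δ * η := by rw [hη]; nlinarith [mul_pos hx0 hδ0]
      nlinarith
    have r2 : -((1 + 10 * C) * x * δ) * η ≤ (Chebyshev.psi x - x) * η := by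
      have : η * η ≤ x * δ * η := by rw [hη]; nlinarith [mul_pos hx0 hδ0]
      have : 0 ≤ C * x * δ * η := by positivity
      nlinarith
    have s1 := le_of_mul_le_mul_right r1 hη0
    have s2 := le_of_mul_le_mul_right r2 hη0
    have : 0 ≤ B * x * δ := by positivity
    rw [abs_le]
    constructor <;> linarith

lemma e_eq (x : ℝ) : e x = Complex.exp ((2 * Real.pi * x : ℝ) * Complex.I) := by
  rw [e]; push_cast; ring_nf

lemma norm_e (x : ℝ) : ‖e x‖ = 1 := by
  rw [e_eq, Complex.norm_exp_ofReal_mul_I]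

lemma e_add (x y : ℝ) : e (x + y) = e x * e y := by
  rw [e, e, e, ← Complex.exp_add]; push_cast; ring_nf

lemma e_neg (x : ℝ) : e (-x) = starRingEnd ℂ (e x) := by
  rw [e_eq, e_eq, ← Complex.exp_conj, map_mul, Complex.conj_ofReal, Complex.conj_I]
  push_cast
  ring_nf

lemma e_int (k : ℤ) : e k = 1 := by
  rw [e, ← Complex.exp_int_mul_two_pi_mul_I k]; push_cast; ring_nf

lemma e_add_int (x : ℝ) (k : ℤ) : e (x + k) = e x := by
  rw [e_add, e_int, mul_one]

lemma e_sub (x y : ℝ) : e (x - y) = e x * starRingEnd ℂ (e y) := by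
  rw [sub_eq_add_neg, e_add, e_neg]

lemma norm_sum_e_neg {ι : Type*} (s : Finset ι) (f : ι → ℝ) :
    ‖∑ i ∈ s, e (-f i)‖ = ‖∑ i ∈ s, e (f i)‖ := by
  simp_rw [e_neg]
  rw [← map_sum, RCLike.norm_conj]

lemma norm_sum_e_le_card {ι : Type*} (s : Finset ι) (f : ι → ℝ) :
    ‖∑ i ∈ s, e (f i)‖ ≤ s.card := by
  refine (norm_sum_le _ _).trans ?_
  simp [norm_e]

/-- Summation by parts against a monotone nonnegative weight. -/
lemma norm_sum_mul_le_of_monotone {w : ℕ → ℝ} {z : ℕ → ℂ} {a b : ℕ} {B : ℝ} (hab : a ≤ b)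
    (hw0 : 0 ≤ w a) (hw : ∀ n, a ≤ n → n < b → w n ≤ w (n + 1))
    (hB : ∀ k, a ≤ k → k ≤ b → ‖∑ n ∈ Ioc a k, z n‖ ≤ B) :
    ‖∑ n ∈ Ioc a b, (w n : ℂ) * z n‖ ≤ 2 * w b * B := by
  have hB0 : 0 ≤ B := (norm_nonneg _).trans (hB a le_rfl hab)
  have key : ∀ k, a ≤ k → k ≤ b →
      ‖∑ n ∈ Ioc a k, (w n : ℂ) * z n - w k * ∑ n ∈ Ioc a k, z n‖ ≤ (w k - w a) * B := by
    intro k hk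
    induction k, hk using Nat.le_induction with
    | base => simp
    | succ k hk ih =>
      intro hkb
      have h1 := ih (by omega)
      have h2 := hw k hk (by omega)
      rw [Finset.sum_Ioc_succ_top (by omega), Finset.sum_Ioc_succ_top (by omega)]
      have h3 : ∑ n ∈ Ioc a k, (w n : ℂ) * z n + w (k + 1) * z (k + 1)
          - w (k + 1) * (∑ n ∈ Ioc a k, z n + z (k + 1)) =
          (∑ n ∈ Ioc a k, (w n : ℂ) * z n - w k * ∑ n ∈ Ioc a k, z n)
          - ((w (k + 1) - w k : ℝ) : ℂ) * ∑ n ∈ Ioc a k, z n := by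
        push_cast; ring
      rw [h3]
      refine (norm_sub_le _ _).trans ?_
      rw [norm_mul, Complex.norm_real, Real.norm_of_nonneg (by linarith)]
      have h4 := hB k hk (by omega)
      have : (w (k + 1) - w k) * ‖∑ n ∈ Ioc a k, z n‖ ≤ (w (k + 1) - w k) * B := by
        apply mul_le_mul_of_nonneg_left h4; linarith
      linarith
  have hwb : w a ≤ w b := by
    have : ∀ k, a ≤ k → k ≤ b → w a ≤ w k := by
      intro k hk
      induction k, hk using Nat.le_induction with
      | base => intro _; exact le_rfl
      | succ k hk ih => intro hkb; exact (ih (by omega)).trans (hw k hk (by omega))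
    exact this b hab le_rfl
  have h1 := key b hab le_rfl
  have h2 : ‖(w b : ℂ) * ∑ n ∈ Ioc a b, z n‖ ≤ w b * B := by
    rw [norm_mul, Complex.norm_real, Real.norm_of_nonneg (by linarith)]
    exact mul_le_mul_of_nonneg_left (hB b hab le_rfl) (by linarith)
  have h3 := norm_add_le (∑ n ∈ Ioc a b, (w n : ℂ) * z n - w b * ∑ n ∈ Ioc a b, z n)
    ((w b : ℂ) * ∑ n ∈ Ioc a b, z n)
  rw [sub_add_cancel] at h3
  nlinarith

/-- The function `x ↦ 1 / (1 - e x)`, written through the cotangent. -/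
noncomputable def kusminWeight (x : ℝ) : ℂ := 1 / 2 + Complex.I / 2 * (Real.cos (Real.pi * x) / Real.sin (Real.pi * x) : ℝ)

lemma kusminWeight_mul {x : ℝ} (hx : Real.sin (Real.pi * x) ≠ 0) :
    kusminWeight x * (1 - e x) = 1 := by
  have h : e x = (Real.cos (Real.pi * x) + Real.sin (Real.pi * x) * Complex.I) ^ 2 := by
    rw [e, Complex.ofReal_cos, Complex.ofReal_sin, ← Complex.exp_mul_I, ← Complex.exp_nat_mul]
    push_cast; ring_nf
  have hs : (Real.sin (Real.pi * x) : ℂ) ≠ 0 := by exact_mod_cast hx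
  have hcs : (Real.cos (Real.pi * x) : ℂ) ^ 2 = 1 - (Real.sin (Real.pi * x) : ℂ) ^ 2 := by
    have := Real.cos_sq' (Real.pi * x)
    exact_mod_cast this
  have hI := Complex.I_sq
  rw [h, kusminWeight, Complex.ofReal_div]
  generalize (Real.cos (Real.pi * x) : ℂ) = C at *
  generalize (Real.sin (Real.pi * x) : ℂ) = S at *
  field_simp
  ring_nf
  have hI3 : Complex.I ^ 3 = - Complex.I := by rw [pow_succ, hI]; ring
  rw [hI3, hI]
  have hC3 : C ^ 3 = C * (1 - S ^ 2) := by rw [pow_succ, hcs]; ring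
  rw [hC3, hcs]
  ring

lemma two_mul_le_sin {θ x : ℝ} (h0 : 0 ≤ θ) (h1 : θ ≤ x) (h2 : x ≤ 1 - θ) :
    2 * θ ≤ Real.sin (Real.pi * x) := by
  have hpi := Real.pi_pos
  rcases le_total x (1 / 2) with hx | hx
  · have := Real.mul_le_sin (x := Real.pi * x) (by nlinarith) (by nlinarith)
    have h3 : 2 / Real.pi * (Real.pi * x) = 2 * x := by field_simp
    linarith
  · have := Real.mul_le_sin (x := Real.pi * (1 - x)) (by nlinarith) (by nlinarith)
    have h3 : 2 / Real.pi * (Real.pi * (1 - x)) = 2 * (1 - x) := by field_simp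
    have h4 : Real.sin (Real.pi * (1 - x)) = Real.sin (Real.pi * x) := by
      rw [mul_sub, mul_one, Real.sin_pi_sub]
    linarith

lemma abs_cot_le {θ x : ℝ} (h0 : 0 < θ) (h1 : θ ≤ x) (h2 : x ≤ 1 - θ) :
    |Real.cos (Real.pi * x) / Real.sin (Real.pi * x)| ≤ 1 / (2 * θ) := by
  have hs := two_mul_le_sin h0.le h1 h2
  rw [abs_div, abs_of_pos (a := Real.sin _) (by linarith)]
  apply div_le_div₀ (by norm_num) (Real.abs_cos_le_one _) (by linarith) hs

lemma cot_antitone {x y : ℝ} (h0 : 0 < x) (hxy : x ≤ y) (h1 : y < 1) :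
    Real.cos (Real.pi * y) / Real.sin (Real.pi * y) ≤
      Real.cos (Real.pi * x) / Real.sin (Real.pi * x) := by
  have hpi := Real.pi_pos
  have hy : 0 < Real.sin (Real.pi * y) :=
    Real.sin_pos_of_pos_of_lt_pi (by nlinarith) (by nlinarith)
  have hx : 0 < Real.sin (Real.pi * x) :=
    Real.sin_pos_of_pos_of_lt_pi (by nlinarith) (by nlinarith)
  rw [div_le_div_iff₀ hy hx]
  have : 0 ≤ Real.sin (Real.pi * y - Real.pi * x) :=
    Real.sin_nonneg_of_nonneg_of_le_pi (by nlinarith) (by nlinarith)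
  rw [Real.sin_sub] at this
  linarith

/-- The Kusmin–Landau inequality, for phases with increments in `[θ, 1 - θ]`. -/
lemma norm_sum_e_le_of_increments_aux {f : ℕ → ℝ} {a b : ℕ} {θ : ℝ} (hθ : 0 < θ)
    (h1 : ∀ n, a ≤ n → n < b → θ ≤ f (n + 1) - f n)
    (h2 : ∀ n, a ≤ n → n < b → f (n + 1) - f n ≤ 1 - θ)
    (h3 : ∀ n, a ≤ n → n + 1 < b → f (n + 1) - f n ≤ f (n + 2) - f (n + 1)) :
    ‖∑ n ∈ Ico a b, e (f n)‖ ≤ 2 / θ := by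
  rcases le_or_gt b a with hab | hab
  · rw [Ico_eq_empty_of_le hab]; simp; positivity
  set c : ℕ → ℂ := fun n => kusminWeight (f (n + 1) - f n) with hc
  set ct : ℕ → ℝ := fun n => Real.cos (Real.pi * (f (n + 1) - f n)) /
    Real.sin (Real.pi * (f (n + 1) - f n)) with hct
  have hcm : ∀ n, a ≤ n → n < b → c n * (e (f n) - e (f (n + 1))) = e (f n) := by
    intro n hn hnb
    have hs : Real.sin (Real.pi * (f (n + 1) - f n)) ≠ 0 := by
      have := two_mul_le_sin hθ.le (h1 n hn hnb) (h2 n hn hnb)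
      linarith
    have h4 := kusminWeight_mul hs
    have h5 : e (f (n + 1)) = e (f n) * e (f (n + 1) - f n) := by
      rw [← e_add]; ring_nf
    calc _ = e (f n) * (kusminWeight (f (n + 1) - f n) * (1 - e (f (n + 1) - f n))) := by
          rw [h5, hc]; ring
      _ = _ := by rw [h4, mul_one]
  have hctb : ∀ n, a ≤ n → n < b → |ct n| ≤ 1 / (2 * θ) := fun n hn hnb =>
    abs_cot_le hθ (h1 n hn hnb) (h2 n hn hnb)
  have hθ2 : 1 ≤ 1 / (2 * θ) := by
    rw [le_div_iff₀ (by positivity)]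
    linarith [h1 a le_rfl hab, h2 a le_rfl hab]
  have hcb : ∀ n, a ≤ n → n < b → ‖c n‖ ≤ 1 / (2 * θ) := by
    intro n hn hnb
    have h4 := hctb n hn hnb
    have h5 : ‖c n‖ ≤ ‖(1 / 2 : ℂ)‖ + ‖Complex.I / 2 * (ct n : ℝ)‖ := norm_add_le _ _
    rw [norm_mul, norm_div, norm_div, Complex.norm_I, Complex.norm_real, Real.norm_eq_abs] at h5
    norm_num at h5
    simp only [one_div, mul_inv] at *
    linarith
  have key : ∀ k, a + 1 ≤ k → k ≤ b →
      ‖∑ n ∈ Ico a k, e (f n) + c (k - 1) * e (f k)‖ ≤ ‖c a‖ + (ct a - ct (k - 1)) / 2 := by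
    intro k hk
    induction k, hk using Nat.le_induction with
    | base =>
      intro _
      have := hcm a le_rfl hab
      simp only [Nat.Ico_succ_singleton, sum_singleton, Nat.add_sub_cancel, sub_self, zero_div,
        add_zero]
      have h5 : e (f a) + c a * e (f (a + 1)) = c a * e (f a) := by
        nth_rw 1 [← this]; ring
      rw [h5, norm_mul, norm_e, mul_one]
    | succ k hk ih =>
      intro hkb
      have h4 := ih (by omega)
      have h5 := hcm k (by omega) (by omega)
      rw [Finset.sum_Ico_succ_top (by omega), Nat.add_sub_cancel]
      obtain ⟨j, rfl⟩ : ∃ j, k = j + 1 := ⟨k - 1, by omega⟩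
      simp only [Nat.add_sub_cancel] at h4
      have h6 : ∑ n ∈ Ico a (j + 1), e (f n) + e (f (j + 1)) + c (j + 1) * e (f (j + 1 + 1)) =
          (∑ n ∈ Ico a (j + 1), e (f n) + c j * e (f (j + 1)))
            + (c (j + 1) - c j) * e (f (j + 1)) := by
        linear_combination -h5
      rw [h6]
      refine (norm_add_le _ _).trans ?_
      rw [norm_mul, norm_e, mul_one]
      have h7 : c (j + 1) - c j = Complex.I / 2 * ((ct (j + 1) - ct j : ℝ) : ℂ) := by
        simp only [hc, hct, kusminWeight]; push_cast; ring
      have h8 : ct (j + 1) ≤ ct j := by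
        refine cot_antitone ?_ (h3 j (by omega) (by omega)) ?_
        · linarith [h1 j (by omega) (by omega)]
        · have := h2 (j + 1) (by omega) (by omega)
          linarith
      rw [h7, norm_mul, norm_div, Complex.norm_I, Complex.norm_real, Real.norm_eq_abs,
        abs_of_nonpos (by linarith)]
      norm_num
      linarith
  have h4 := key b (by omega) le_rfl
  have h5 := hcb a le_rfl hab
  have h6 := hcb (b - 1) (by omega) (by omega)
  have h7 := abs_le.mp (hctb a le_rfl hab)
  have h8 := abs_le.mp (hctb (b - 1) (by omega) (by omega))
  have h9 := norm_sub_le (∑ n ∈ Ico a b, e (f n) + c (b - 1) * e (f b)) (c (b - 1) * e (f b))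
  rw [add_sub_cancel_right, norm_mul, norm_e, mul_one] at h9
  have h10 : 2 / θ = 4 * (1 / (2 * θ)) := by field_simp; norm_num
  rw [h10]
  linarith

/-- The Kusmin–Landau inequality. -/
lemma norm_sum_e_le_of_increments {f : ℕ → ℝ} {a b : ℕ} {θ : ℝ} (k : ℤ) (hθ : 0 < θ)
    (h1 : ∀ n, a ≤ n → n < b → k + θ ≤ f (n + 1) - f n)
    (h2 : ∀ n, a ≤ n → n < b → f (n + 1) - f n ≤ k + 1 - θ)
    (h3 : ∀ n, a ≤ n → n + 1 < b → f (n + 1) - f n ≤ f (n + 2) - f (n + 1)) :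
    ‖∑ n ∈ Ico a b, e (f n)‖ ≤ 2 / θ := by
  have h : ∀ n, e (f n) = e (f n - k * n) := by
    intro n
    have : f n = (f n - k * n) + ((k * n : ℤ) : ℝ) := by push_cast; ring
    nth_rw 1 [this]
    rw [e_add_int]
  simp_rw [h]
  apply norm_sum_e_le_of_increments_aux hθ
  · intro n hn hnb; have := h1 n hn hnb; push_cast; linarith
  · intro n hn hnb; have := h2 n hn hnb; push_cast; linarith
  · intro n hn hnb; have := h3 n hn hnb; push_cast; linarith

lemma exists_eq_Ico_of_ordConnected {s : Finset ℕ}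
    (hs : ∀ x ∈ s, ∀ y ∈ s, ∀ z, x ≤ z → z ≤ y → z ∈ s) : ∃ p q : ℕ, s = Ico p q := by
  rcases s.eq_empty_or_nonempty with rfl | h
  · exact ⟨0, 0, by simp⟩
  · refine ⟨s.min' h, s.max' h + 1, ?_⟩
    ext x
    simp only [mem_Ico, Nat.lt_succ_iff]
    exact ⟨fun hx => ⟨s.min'_le x hx, s.le_max' x hx⟩,
      fun hx => hs _ (s.min'_mem h) _ (s.max'_mem h) x hx.1 hx.2⟩

lemma card_Ico_le_of_spaced {g : ℕ → ℝ} {p q : ℕ} {lam u θ : ℝ} (hlam : 0 < lam) (hθ : 0 ≤ θ)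
    (hg : ∀ n m, p ≤ n → n ≤ m → m < q → lam * (m - n) ≤ g m - g n)
    (h : ∀ n, p ≤ n → n < q → u ≤ g n ∧ g n ≤ u + θ) :
    ((Ico p q).card : ℝ) ≤ θ / lam + 1 := by
  rcases le_or_gt q p with hpq | hpq
  · rw [Ico_eq_empty_of_le hpq]; simp; positivity
  · have h1 := hg p (q - 1) le_rfl (by omega) (by omega)
    have h2 := h p le_rfl hpq
    have h3 := h (q - 1) (by omega) (by omega)
    rw [Nat.card_Ico, Nat.cast_sub hpq.le]
    rw [Nat.cast_sub (by omega)] at h1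
    have : (q : ℝ) - p - 1 ≤ θ / lam := by
      rw [le_div_iff₀ hlam]
      push_cast at h1
      linarith
    linarith

/-- Van der Corput's second derivative test, in terms of second differences. -/
lemma norm_sum_Ico_e_le_of_second_differences {f : ℕ → ℝ} {a b : ℕ} {lam A : ℝ} (hab : a ≤ b)
    (hlam : 0 < lam) (hA : 1 ≤ A)
    (h1 : ∀ n, a ≤ n → n + 2 < b → lam ≤ f (n + 2) - 2 * f (n + 1) + f n)
    (h2 : ∀ n, a ≤ n → n + 2 < b → f (n + 2) - 2 * f (n + 1) + f n ≤ A * lam) :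
    ‖∑ n ∈ Ico a b, e (f n)‖ ≤ 13 * A * ((b - a) * √lam + 1 / √lam) := by
  have hs : 0 < √lam := Real.sqrt_pos.mpr hlam
  have hab' : (0 : ℝ) ≤ b - a := by
    have : (a : ℝ) ≤ b := by exact_mod_cast hab
    linarith
  have hcard : ‖∑ n ∈ Ico a b, e (f n)‖ ≤ b - a := by
    refine (norm_sum_e_le_card _ _).trans ?_
    rw [Nat.card_Ico, Nat.cast_sub hab]
  set θ := √lam with hθ
  have hlamθ : lam = θ * θ := (Real.mul_self_sqrt hlam.le).symm
  rcases le_or_gt (1 / 4) θ with hbig | hsmall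
  · refine hcard.trans ?_
    have h3 : (b - a : ℝ) ≤ 4 * ((b - a) * θ) := by nlinarith
    have h4 : 0 ≤ (b - a : ℝ) * θ := by positivity
    have h5 : 0 < 1 / θ := by positivity
    nlinarith
  have hθ1 : 4 ≤ 1 / θ := by rw [le_div_iff₀ hs]; linarith
  rcases le_or_gt b (a + 1) with hb1 | hb1
  · refine hcard.trans ?_
    have h3 : (b : ℝ) ≤ a + 1 := by exact_mod_cast hb1
    have h4 : 0 ≤ (b - a : ℝ) * θ := by positivity
    nlinarith
  obtain ⟨B, rfl⟩ : ∃ B, b = B + 1 := ⟨b - 1, by omega⟩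
  set g : ℕ → ℝ := fun n => f (n + 1) - f n with hg
  have hg1 : ∀ n m, a ≤ n → n ≤ m → m < B →
      lam * (m - n) ≤ g m - g n ∧ g m - g n ≤ A * lam * (m - n) := by
    intro n m hn hnm
    induction m, hnm using Nat.le_induction with
    | base => intro _; simp
    | succ m hnm ih =>
      intro hm
      have h3 := ih (by omega)
      have h4 := h1 m (by omega) (by omega)
      have h5 := h2 m (by omega) (by omega)
      have h6 : g (m + 1) - g m = f (m + 2) - 2 * f (m + 1) + f m := by
        simp only [hg]; ring_nf
      push_cast
      constructor <;> linarith
  have hmono : ∀ n m, a ≤ n → n ≤ m → m < B → g n ≤ g m := by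
    intro n m hn hnm hm
    have h3 := (hg1 n m hn hnm hm).1
    have h4 : (n : ℝ) ≤ m := by exact_mod_cast hnm
    nlinarith
  have hconn : ∀ u v : ℝ, ∃ p q : ℕ,
      (Ico a B).filter (fun n => u ≤ g n ∧ g n ≤ v) = Ico p q := by
    intro u v
    apply exists_eq_Ico_of_ordConnected
    intro x hx y hy z hxz hzy
    simp only [mem_filter, mem_Ico] at *
    exact ⟨by omega, hx.2.1.trans (hmono x z hx.1.1 hxz (by omega)),
      (hmono z y (by omega) hzy hy.1.2).trans hy.2.2⟩
  have hmem : ∀ {p q : ℕ} {P : ℕ → Prop} [DecidablePred P], (Ico a B).filter P = Ico p q →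
      ∀ n, p ≤ n → n < q → (a ≤ n ∧ n < B) ∧ P n := by
    intro p q P _ h n hp hq
    have : n ∈ (Ico a B).filter P := by rw [h]; exact mem_Ico.mpr ⟨hp, hq⟩
    simpa using this
  have hshort : ∀ u : ℝ,
      (((Ico a B).filter (fun n => u ≤ g n ∧ g n ≤ u + θ)).card : ℝ) ≤ 1 / θ + 1 := by
    intro u
    obtain ⟨p, q, hpq⟩ := hconn u (u + θ)
    rw [hpq]
    have hm := hmem hpq
    have := card_Ico_le_of_spaced (g := g) (p := p) (q := q) hlam hs.le (u := u)
      (fun n m hn hnm hmq => (hg1 n m (hm n hn (by omega)).1.1 hnm (hm m (by omega) hmq).1.2).1)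
      (fun n hn hnq => (hm n hn hnq).2)
    have h4 : θ / lam = 1 / θ := by rw [hlamθ]; field_simp
    rwa [h4] at this
  have hmid : ∀ k : ℤ, ‖∑ n ∈ (Ico a B).filter (fun n => k + θ ≤ g n ∧ g n ≤ k + 1 - θ),
      e (f n)‖ ≤ 2 / θ := by
    intro k
    obtain ⟨p, q, hpq⟩ := hconn (k + θ) (k + 1 - θ)
    rw [hpq]
    have hm := hmem hpq
    apply norm_sum_e_le_of_increments k hs
    · intro n hn hnq; exact (hm n hn hnq).2.1
    · intro n hn hnq; exact (hm n hn hnq).2.2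
    · intro n hn hnq
      exact hmono n (n + 1) (hm n hn (by omega)).1.1 (by omega) (hm (n + 1) (by omega) hnq).1.2
  have hfib : ∀ k : ℤ, ‖∑ n ∈ (Ico a B).filter (fun n => ⌊g n⌋ = k), e (f n)‖ ≤ 5 / θ := by
    intro k
    set s := (Ico a B).filter (fun n => ⌊g n⌋ = k) with hsdef
    set M := (Ico a B).filter (fun n => k + θ ≤ g n ∧ g n ≤ k + 1 - θ) with hM
    set P := (Ico a B).filter (fun n => (k : ℝ) ≤ g n ∧ g n ≤ k + θ) with hP
    set R := (Ico a B).filter (fun n => (k + 1 - θ : ℝ) ≤ g n ∧ g n ≤ k + 1 - θ + θ) with hR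
    have hMs : M ⊆ s := by
      intro n hn
      simp only [hM, hsdef, mem_filter] at *
      refine ⟨hn.1, ?_⟩
      rw [Int.floor_eq_iff]
      constructor <;> linarith [hn.2.1, hn.2.2]
    have hsub : s \ M ⊆ P ∪ R := by
      intro n hn
      simp only [hM, hsdef, hP, hR, mem_filter, mem_sdiff, mem_union] at *
      obtain ⟨⟨h3, h4⟩, h5⟩ := hn
      rw [Int.floor_eq_iff] at h4
      rcases lt_or_ge (g n) (k + θ) with h6 | h6
      · exact Or.inl ⟨h3, h4.1, h6.le⟩
      · refine Or.inr ⟨h3, ?_, by linarith⟩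
        by_contra h7
        exact h5 ⟨h3, h6, by linarith⟩
    rw [← sum_sdiff hMs]
    refine (norm_add_le _ _).trans ?_
    have h3 := hmid k
    have h4 : ‖∑ n ∈ s \ M, e (f n)‖ ≤ (1 / θ + 1) + (1 / θ + 1) := by
      refine (norm_sum_e_le_card _ _).trans ?_
      have h5 : ((s \ M).card : ℝ) ≤ P.card + R.card := by
        exact_mod_cast (card_le_card hsub).trans (card_union_le _ _)
      have h6 := hshort k
      have h7 := hshort (k + 1 - θ)
      linarith
    have h5 : 5 / θ = 2 / θ + 2 * (1 / θ) + 1 / θ := by ring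
    rw [h5]
    linarith
  have hsplit : ∑ n ∈ Ico a B, e (f n) =
      ∑ k ∈ Icc ⌊g a⌋ ⌊g (B - 1)⌋, ∑ n ∈ (Ico a B).filter (fun n => ⌊g n⌋ = k), e (f n) := by
    rw [sum_fiberwise_of_maps_to]
    intro n hn
    rw [mem_Ico] at hn
    rw [mem_Icc]
    exact ⟨Int.floor_le_floor (hmono a n le_rfl hn.1 hn.2),
      Int.floor_le_floor (hmono n (B - 1) hn.1 (by omega) (by omega))⟩
  have hnum : ((Icc ⌊g a⌋ ⌊g (B - 1)⌋).card : ℝ) ≤ A * lam * (((B + 1 : ℕ) : ℝ) - a) + 2 := by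
    have h3 := hg1 a (B - 1) le_rfl (by omega) (by omega)
    have h4 : ⌊g a⌋ ≤ ⌊g (B - 1)⌋ :=
      Int.floor_le_floor (hmono a (B - 1) le_rfl (by omega) (by omega))
    rw [Int.card_Icc]
    have h5 : (((⌊g (B - 1)⌋ + 1 - ⌊g a⌋).toNat : ℤ) : ℝ) = ((⌊g (B - 1)⌋ + 1 - ⌊g a⌋ : ℤ) : ℝ) := by
      rw [Int.toNat_of_nonneg (by omega)]
    rw [Int.cast_natCast] at h5
    rw [h5]
    push_cast
    have h6 := Int.floor_le (g (B - 1))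
    have h7 := Int.lt_floor_add_one (g a)
    have h8 : (((B - 1 : ℕ) : ℝ)) ≤ B + 1 := by exact_mod_cast (by omega : B - 1 ≤ B + 1)
    have h9 : A * lam * (((B - 1 : ℕ) : ℝ) - a) ≤ A * lam * (B + 1 - a) := by
      gcongr
    linarith [h3.2]
  rw [Finset.sum_Ico_succ_top (by omega)]
  refine (norm_add_le _ _).trans ?_
  rw [norm_e, hsplit]
  have h3 : ‖∑ k ∈ Icc ⌊g a⌋ ⌊g (B - 1)⌋, ∑ n ∈ (Ico a B).filter (fun n => ⌊g n⌋ = k), e (f n)‖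
      ≤ (A * lam * (((B + 1 : ℕ) : ℝ) - a) + 2) * (5 / θ) := by
    refine (norm_sum_le _ _).trans ?_
    refine (sum_le_card_nsmul _ _ _ (fun k _ => hfib k)).trans ?_
    rw [nsmul_eq_mul]
    gcongr
  refine (add_le_add h3 le_rfl).trans ?_
  have h4 : (A * lam * (((B + 1 : ℕ) : ℝ) - a) + 2) * (5 / θ) =
      5 * (A * ((((B + 1 : ℕ) : ℝ) - a) * θ)) + 10 * (1 / θ) := by
    rw [hlamθ]; field_simp; ring
  rw [h4]
  have h5 : 0 ≤ A * ((((B + 1 : ℕ) : ℝ) - a) * θ) := by positivity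
  have h6 : 1 / θ ≤ A * (1 / θ) := le_mul_of_one_le_left (by positivity) hA
  linarith

/-- Van der Corput's second derivative test, for a phase of either concavity. -/
lemma norm_sum_Ioc_e_le_of_second_differences {f : ℕ → ℝ} {a b : ℕ} {lam A : ℝ} (hab : a ≤ b)
    (hlam : 0 < lam) (hA : 1 ≤ A)
    (h : (∀ n, a < n → n + 2 ≤ b → lam ≤ f (n + 2) - 2 * f (n + 1) + f n ∧
        f (n + 2) - 2 * f (n + 1) + f n ≤ A * lam) ∨
      (∀ n, a < n → n + 2 ≤ b → lam ≤ -(f (n + 2) - 2 * f (n + 1) + f n) ∧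
        -(f (n + 2) - 2 * f (n + 1) + f n) ≤ A * lam)) :
    ‖∑ n ∈ Ioc a b, e (f n)‖ ≤ 13 * A * ((b - a) * √lam + 1 / √lam) := by
  have hI : Ioc a b = Ico (a + 1) (b + 1) := by ext; simp
  have hc : ((b + 1 : ℕ) : ℝ) - (a + 1 : ℕ) = b - a := by push_cast; ring
  rw [hI, ← hc]
  rcases h with h | h
  · exact norm_sum_Ico_e_le_of_second_differences (by omega) hlam hA
      (fun n hn hn2 => (h n (by omega) (by omega)).1)
      (fun n hn hn2 => (h n (by omega) (by omega)).2)
  · rw [← norm_sum_e_neg]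
    apply norm_sum_Ico_e_le_of_second_differences (by omega) hlam hA
    · intro n hn hn2; have := (h n (by omega) (by omega)).1; linarith
    · intro n hn hn2; have := (h n (by omega) (by omega)).2; linarith

section

open ArithmeticFunction

lemma sum_Ioc_divisorsAntidiagonal {M : Type*} [AddCommMonoid M] (F : ℕ → ℕ → M) (a b : ℕ) :
    ∑ n ∈ Ioc a b, ∑ x ∈ n.divisorsAntidiagonal, F x.1 x.2 =
      ∑ m ∈ Ioc 0 b, ∑ l ∈ Ioc (a / m) (b / m), F m l := by
  have h1 : ∀ n ∈ Ioc a b, ∑ x ∈ n.divisorsAntidiagonal, F x.1 x.2 =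
      ∑ x ∈ Ioc 0 b ×ˢ Ioc 0 b, if x.1 * x.2 = n then F x.1 x.2 else 0 := by
    intro n hn
    rw [mem_Ioc] at hn
    rw [Nat.divisorsAntidiagonal_eq_prod_filter_of_le (by omega) hn.2, sum_filter]
  rw [sum_congr rfl h1, sum_comm, sum_product]
  refine sum_congr rfl fun m hm => ?_
  rw [mem_Ioc] at hm
  have h2 : Ioc (a / m) (b / m) = (Ioc 0 b).filter (fun l => m * l ∈ Ioc a b) := by
    ext l
    simp only [mem_Ioc, mem_filter, Nat.div_lt_iff_lt_mul hm.1, Nat.le_div_iff_mul_le hm.1,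
      mul_comm l m]
    constructor
    · rintro ⟨h3, h4⟩
      have : 0 < l := by
        rcases Nat.eq_zero_or_pos l with rfl | h
        · omega
        · exact h
      exact ⟨⟨this, le_trans (Nat.le_mul_of_pos_left _ hm.1) h4⟩, h3, h4⟩
    · rintro ⟨_, h⟩; exact h
  rw [h2, sum_filter]
  refine sum_congr rfl fun l _ => ?_
  rw [sum_ite_eq]

lemma sum_Ioc_mul_apply (α β : ArithmeticFunction ℝ) (φ : ℕ → ℂ) (a b : ℕ) :
    ∑ n ∈ Ioc a b, ((α * β) n : ℂ) * φ n =
      ∑ m ∈ Ioc 0 b, (α m : ℂ) * ∑ l ∈ Ioc (a / m) (b / m), (β l : ℂ) * φ (m * l) := by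
  have h := sum_Ioc_divisorsAntidiagonal (fun m l => (α m : ℂ) * ((β l : ℂ) * φ (m * l))) a b
  simp_rw [← mul_sum] at h
  rw [← h]
  refine sum_congr rfl fun n _ => ?_
  rw [mul_apply, Complex.ofReal_sum, sum_mul]
  refine sum_congr rfl fun x hx => ?_
  rw [(Nat.mem_divisorsAntidiagonal.mp hx).1]
  push_cast; ring

lemma sum_inv_le (N : ℕ) : ∑ k ∈ Ioc 0 N, ((k : ℝ))⁻¹ ≤ 1 + Real.log N := by
  have h := harmonic_le_one_add_log N
  rw [harmonic_eq_sum_Icc] at h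
  push_cast at h
  exact h

lemma sum_card_divisors_le (N : ℕ) :
    ∑ n ∈ Ioc 0 N, (n.divisors.card : ℝ) ≤ N * (1 + Real.log N) := by
  have h := sum_Ioc_sigma0_eq_sum_div N
  simp only [sigma_zero_apply] at h
  have h2 : ∑ n ∈ Ioc 0 N, (n.divisors.card : ℝ) = ∑ n ∈ Ioc 0 N, ((N / n : ℕ) : ℝ) := by
    exact_mod_cast h
  rw [h2]
  calc _ ≤ ∑ n ∈ Ioc 0 N, (N : ℝ) * (n : ℝ)⁻¹ := by
        apply sum_le_sum; intro n _
        rw [← div_eq_mul_inv]; exact Nat.cast_div_le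
    _ = N * ∑ n ∈ Ioc 0 N, (n : ℝ)⁻¹ := by rw [mul_sum]
    _ ≤ _ := by gcongr; exact sum_inv_le N

lemma sum_card_divisors_div_le (N : ℕ) :
    ∑ n ∈ Ioc 0 N, (n.divisors.card : ℝ) * (n : ℝ)⁻¹ ≤ (1 + Real.log N) ^ 2 := by
  have h := sum_Ioc_divisorsAntidiagonal (fun m l => (m : ℝ)⁻¹ * (l : ℝ)⁻¹) 0 N
  have h1 : ∑ n ∈ Ioc 0 N, (n.divisors.card : ℝ) * (n : ℝ)⁻¹ =
      ∑ n ∈ Ioc 0 N, ∑ x ∈ n.divisorsAntidiagonal, (x.1 : ℝ)⁻¹ * (x.2 : ℝ)⁻¹ := by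
    refine sum_congr rfl fun n _ => ?_
    rw [sum_congr rfl (g := fun _ => (n : ℝ)⁻¹)]
    · rw [sum_const, nsmul_eq_mul, ← Nat.map_div_right_divisors, card_map]
    · intro x hx
      rw [← mul_inv, ← Nat.cast_mul, (Nat.mem_divisorsAntidiagonal.mp hx).1]
  rw [h1, h, sq]
  have hlog : 0 ≤ 1 + Real.log N := by
    have := Real.log_natCast_nonneg N; linarith
  calc _ ≤ ∑ m ∈ Ioc 0 N, (m : ℝ)⁻¹ * (1 + Real.log N) := by
        apply sum_le_sum; intro m _
        rw [← mul_sum]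
        gcongr
        refine le_trans ?_ (sum_inv_le N)
        apply sum_le_sum_of_subset_of_nonneg
        · intro x hx; simp only [mem_Ioc] at *
          exact ⟨Nat.pos_of_ne_zero fun h0 => by simp [h0] at hx, hx.2.trans (Nat.div_le_self _ _)⟩
        · intros; positivity
    _ = (∑ m ∈ Ioc 0 N, (m : ℝ)⁻¹) * (1 + Real.log N) := by rw [sum_mul]
    _ ≤ _ := by gcongr; exact sum_inv_le N

lemma card_divisors_mul_le (m n : ℕ) :
    (m * n).divisors.card ≤ m.divisors.card * n.divisors.card := by
  rw [Nat.divisors_mul]; exact Finset.card_mul_le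

lemma sum_card_divisors_sq_le (N : ℕ) :
    ∑ n ∈ Ioc 0 N, (n.divisors.card : ℝ) ^ 2 ≤ N * (1 + Real.log N) ^ 3 := by
  have hlog : 0 ≤ 1 + Real.log N := by
    have := Real.log_natCast_nonneg N; linarith
  have h := sum_Ioc_divisorsAntidiagonal
    (fun m l => (m.divisors.card : ℝ) * (l.divisors.card : ℝ)) 0 N
  calc _ ≤ ∑ n ∈ Ioc 0 N, ∑ x ∈ n.divisorsAntidiagonal,
        (x.1.divisors.card : ℝ) * (x.2.divisors.card : ℝ) := by
        apply sum_le_sum; intro n _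
        have h1 : (n.divisors.card : ℝ) ^ 2 =
            ∑ x ∈ n.divisorsAntidiagonal, (n.divisors.card : ℝ) := by
          rw [sum_const, nsmul_eq_mul, ← Nat.map_div_right_divisors, card_map, sq]
        rw [h1]
        apply sum_le_sum; intro x hx
        rw [← (Nat.mem_divisorsAntidiagonal.mp hx).1]
        exact_mod_cast card_divisors_mul_le _ _
    _ = ∑ m ∈ Ioc 0 N, ∑ l ∈ Ioc (0 / m) (N / m),
        (m.divisors.card : ℝ) * (l.divisors.card : ℝ) := h
    _ ≤ ∑ m ∈ Ioc 0 N, (m.divisors.card : ℝ) * (N * (m : ℝ)⁻¹ * (1 + Real.log N)) := by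
        apply sum_le_sum; intro m hm
        rw [mem_Ioc] at hm
        rw [← mul_sum, Nat.zero_div]
        gcongr
        refine (sum_card_divisors_le _).trans ?_
        have h2 : ((N / m : ℕ) : ℝ) ≤ N * (m : ℝ)⁻¹ := by
          rw [← div_eq_mul_inv]; exact Nat.cast_div_le
        have h4 : Real.log ((N / m : ℕ) : ℝ) ≤ Real.log N := by
          rcases Nat.eq_zero_or_pos (N / m) with h0 | h0
          · rw [h0]; simp; exact Real.log_natCast_nonneg N
          · apply Real.log_le_log (by exact_mod_cast h0)
            exact_mod_cast Nat.div_le_self _ _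
        gcongr
    _ = (N * (1 + Real.log N)) * ∑ m ∈ Ioc 0 N, (m.divisors.card : ℝ) * (m : ℝ)⁻¹ := by
        rw [mul_sum]; refine sum_congr rfl fun m _ => by ring
    _ ≤ (N * (1 + Real.log N)) * (1 + Real.log N) ^ 2 := by
        gcongr; exact sum_card_divisors_div_le N
    _ = _ := by ring

/-- Truncation of an arithmetic function to `[1, U]`. -/
noncomputable def truncate (f : ArithmeticFunction ℝ) (U : ℕ) : ArithmeticFunction ℝ :=
  ⟨fun n => if n ≤ U then f n else 0, by simp⟩

lemma truncate_apply (f : ArithmeticFunction ℝ) (U n : ℕ) :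
    truncate f U n = if n ≤ U then f n else 0 := rfl

lemma sub_truncate_apply (f : ArithmeticFunction ℝ) (U n : ℕ) :
    (f - truncate f U) n = if n ≤ U then 0 else f n := by
  have h : (f - truncate f U) n = f n - truncate f U n := by
    rw [sub_eq_add_neg, ArithmeticFunction.add_apply, sub_eq_add_neg]; rfl
  rw [h, truncate_apply]; split_ifs <;> simp

/-- Vaughan's identity. -/
lemma vaughan (U : ℕ) : vonMangoldt = truncate vonMangoldt U
    + truncate (moebius : ArithmeticFunction ℝ) U * log
    - truncate (moebius : ArithmeticFunction ℝ) U * truncate vonMangoldt U * (zeta : ArithmeticFunction ℝ)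
    + (((moebius : ArithmeticFunction ℝ) - truncate (moebius : ArithmeticFunction ℝ) U) *
      (zeta : ArithmeticFunction ℝ)) * (vonMangoldt - truncate vonMangoldt U) := by
  have h1 : (moebius : ArithmeticFunction ℝ) * (zeta : ArithmeticFunction ℝ) = 1 :=
    coe_moebius_mul_coe_zeta
  rw [← vonMangoldt_mul_zeta]
  linear_combination (truncate vonMangoldt U - vonMangoldt) * h1

lemma abs_moebius_le (n : ℕ) : |(moebius : ArithmeticFunction ℝ) n| ≤ 1 := by
  rw [intCoe_apply]
  exact_mod_cast abs_moebius_le_one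

lemma abs_truncate_moebius_le (U n : ℕ) :
    |truncate (moebius : ArithmeticFunction ℝ) U n| ≤ 1 := by
  rw [truncate_apply]; split_ifs
  · exact abs_moebius_le n
  · simp

lemma abs_truncate_mul_truncate_le (U n : ℕ) :
    |(truncate (moebius : ArithmeticFunction ℝ) U * truncate vonMangoldt U) n| ≤ Real.log n := by
  rw [← log_apply, ← vonMangoldt_mul_zeta, mul_comm vonMangoldt, mul_apply, mul_apply]
  refine (abs_sum_le_sum_abs _ _).trans (sum_le_sum fun x hx => ?_)
  rw [abs_mul]
  have h1 : x.1 ≠ 0 := (Nat.ne_zero_of_mem_divisorsAntidiagonal hx).1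
  have h2 : |truncate vonMangoldt U x.2| ≤ vonMangoldt x.2 := by
    rw [truncate_apply]; split_ifs
    · rw [abs_of_nonneg vonMangoldt_nonneg]
    · simp [vonMangoldt_nonneg]
  rw [natCoe_apply, zeta_apply_ne h1, Nat.cast_one]
  exact mul_le_mul (abs_truncate_moebius_le _ _) h2 (abs_nonneg _) zero_le_one

lemma truncate_mul_truncate_eq_zero (f g : ArithmeticFunction ℝ) {U n : ℕ} (hn : U * U < n) :
    (truncate f U * truncate g U) n = 0 := by
  rw [mul_apply]
  refine sum_eq_zero fun x hx => ?_
  rw [truncate_apply, truncate_apply]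
  have h := (Nat.mem_divisorsAntidiagonal.mp hx).1
  split_ifs with h1 h2
  · exfalso
    have := Nat.mul_le_mul h1 h2
    omega
  all_goals simp

lemma abs_sub_truncate_mul_zeta_le (U n : ℕ) :
    |(((moebius : ArithmeticFunction ℝ) - truncate (moebius : ArithmeticFunction ℝ) U) *
      (zeta : ArithmeticFunction ℝ)) n| ≤ n.divisors.card := by
  rw [mul_apply]
  refine (abs_sum_le_sum_abs _ _).trans ?_
  refine (sum_le_card_nsmul _ _ 1 fun x hx => ?_).trans ?_
  · have h1 : x.2 ≠ 0 := (Nat.ne_zero_of_mem_divisorsAntidiagonal hx).2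
    rw [natCoe_apply, zeta_apply_ne h1, Nat.cast_one, mul_one, sub_truncate_apply]
    split_ifs
    · simp
    · exact abs_moebius_le _
  · rw [← Nat.map_div_right_divisors, card_map]; simp

lemma sub_truncate_mul_zeta_eq_zero {U n : ℕ} (hn : n ≤ U) :
    (((moebius : ArithmeticFunction ℝ) - truncate (moebius : ArithmeticFunction ℝ) U) *
      (zeta : ArithmeticFunction ℝ)) n = 0 := by
  rw [mul_apply]
  refine sum_eq_zero fun x hx => ?_
  have h := Nat.mem_divisorsAntidiagonal.mp hx
  have h1 : x.1 ≤ n := Nat.le_of_dvd (by omega) ⟨x.2, h.1.symm⟩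
  rw [sub_truncate_apply, if_pos (h1.trans hn), zero_mul]

end

lemma sum_block_dist_le {t : Finset ℕ} {Q l : ℕ} (hQ : 0 < Q) {W : ℕ → ℝ} (hW : ∀ q, 0 ≤ W q) :
    ∑ l' ∈ t.filter (fun l' => l' / Q = l / Q), W ((l - l') + (l' - l)) ≤
      W 0 + 2 * ∑ q ∈ Ico 1 Q, W q := by
  set B := t.filter (fun l' => l' / Q = l / Q) with hB
  have hdist : ∀ l' ∈ B, (l - l') + (l' - l) < Q := by
    intro l' hl'
    have h := (mem_filter.mp hl').2
    have h1 := Nat.div_add_mod l Q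
    have h2 := Nat.div_add_mod l' Q
    have h3 := Nat.mod_lt l hQ
    have h4 := Nat.mod_lt l' hQ
    rw [h] at h2
    omega
  have h1 : ∑ l' ∈ B.filter (fun l' => l < l'), W ((l - l') + (l' - l)) ≤ ∑ q ∈ Ico 1 Q, W q := by
    rw [← sum_image (s := B.filter (fun l' => l < l')) (g := fun l' => (l - l') + (l' - l))
      (f := W)]
    · apply sum_le_sum_of_subset_of_nonneg
      · intro q hq
        simp only [mem_image, mem_filter, mem_Ico] at *
        obtain ⟨l', ⟨h3, h4⟩, rfl⟩ := hq
        have := hdist l' h3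
        omega
      · intros; exact hW _
    · intro x hx y hy hxy
      simp only [mem_coe, mem_filter] at hx hy hxy
      omega
  have h2 : ∑ l' ∈ B.filter (fun l' => l' < l), W ((l - l') + (l' - l)) ≤ ∑ q ∈ Ico 1 Q, W q := by
    rw [← sum_image (s := B.filter (fun l' => l' < l)) (g := fun l' => (l - l') + (l' - l))
      (f := W)]
    · apply sum_le_sum_of_subset_of_nonneg
      · intro q hq
        simp only [mem_image, mem_filter, mem_Ico] at *
        obtain ⟨l', ⟨h3, h4⟩, rfl⟩ := hq
        have := hdist l' h3
        omega
      · intros; exact hW _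
    · intro x hx y hy hxy
      simp only [mem_coe, mem_filter] at hx hy hxy
      omega
  have h3 : ∑ l' ∈ B, W ((l - l') + (l' - l)) ≤
      ∑ l' ∈ {l}, W ((l - l') + (l' - l)) +
      (∑ l' ∈ B.filter (fun l' => l < l'), W ((l - l') + (l' - l)) +
      ∑ l' ∈ B.filter (fun l' => l' < l), W ((l - l') + (l' - l))) := by
    have hsub : B ⊆ {l} ∪ (B.filter (fun l' => l < l') ∪ B.filter (fun l' => l' < l)) := by
      intro x hx
      simp only [mem_union, mem_singleton, mem_filter]
      rcases lt_trichotomy x l with h | h | h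
      · exact Or.inr (Or.inr ⟨hx, h⟩)
      · exact Or.inl h
      · exact Or.inr (Or.inl ⟨hx, h⟩)
    have hun : ∀ s s' : Finset ℕ, ∑ l' ∈ s ∪ s', W ((l - l') + (l' - l)) ≤
        ∑ l' ∈ s, W ((l - l') + (l' - l)) + ∑ l' ∈ s', W ((l - l') + (l' - l)) := by
      intro s s'
      rw [← sum_union_inter]
      have : 0 ≤ ∑ l' ∈ s ∩ s', W ((l - l') + (l' - l)) := sum_nonneg fun _ _ => hW _
      linarith
    refine (sum_le_sum_of_subset_of_nonneg hsub fun _ _ _ => hW _).trans ?_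
    refine (hun _ _).trans ?_
    have := hun (B.filter (fun l' => l < l')) (B.filter (fun l' => l' < l))
    linarith
  simp only [sum_singleton, Nat.sub_self, add_zero] at h3
  linarith

lemma norm_sum_sq_le_card_mul {ι : Type*} (s : Finset ι) (z : ι → ℂ) :
    ‖∑ i ∈ s, z i‖ ^ 2 ≤ s.card * ∑ i ∈ s, ‖z i‖ ^ 2 :=
  (pow_le_pow_left₀ (norm_nonneg _) (norm_sum_le _ _) 2).trans sq_sum_le_card_mul_sum_sq

lemma norm_sum_mul_sq_le {ι : Type*} (s : Finset ι) (α : ι → ℝ) (z : ι → ℂ) :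
    ‖∑ i ∈ s, (α i : ℂ) * z i‖ ^ 2 ≤ (∑ i ∈ s, α i ^ 2) * ∑ i ∈ s, ‖z i‖ ^ 2 := by
  have h1 : ‖∑ i ∈ s, (α i : ℂ) * z i‖ ≤ ∑ i ∈ s, |α i| * ‖z i‖ := by
    refine (norm_sum_le _ _).trans_eq (sum_congr rfl fun i _ => ?_)
    rw [norm_mul, Complex.norm_real, Real.norm_eq_abs]
  refine (pow_le_pow_left₀ (norm_nonneg _) h1 2).trans ?_
  refine (sum_mul_sq_le_sq_mul_sq _ _ _).trans_eq ?_
  simp_rw [sq_abs]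

/-- Cauchy–Schwarz for a bilinear form, after cutting the inner variable into blocks of
length `Q`. -/
lemma norm_bilinear_sq_le (s t : Finset ℕ) (α β : ℕ → ℝ) (E : ℕ → ℕ → ℂ) {Q : ℕ} (hQ : 0 < Q)
    {W : ℕ → ℝ} (hW : ∀ q, 0 ≤ W q) {J : ℝ} (hJ : ((t.image (· / Q)).card : ℝ) ≤ J)
    (hV : ∀ l ∈ t, ∀ l' ∈ t, l / Q = l' / Q →
      ‖∑ m ∈ s, E m l * starRingEnd ℂ (E m l')‖ ≤ W ((l - l') + (l' - l))) :
    ‖∑ l ∈ t, (β l : ℂ) * ∑ m ∈ s, (α m : ℂ) * E m l‖ ^ 2 ≤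
      (∑ m ∈ s, α m ^ 2) * (J * ((∑ l ∈ t, β l ^ 2) * (W 0 + 2 * ∑ q ∈ Ico 1 Q, W q))) := by
  have h0 : ∑ l ∈ t, (β l : ℂ) * ∑ m ∈ s, (α m : ℂ) * E m l =
      ∑ m ∈ s, (α m : ℂ) * ∑ l ∈ t, (β l : ℂ) * E m l := by
    simp_rw [mul_sum]
    rw [sum_comm]
    refine sum_congr rfl fun m _ => sum_congr rfl fun l _ => by ring
  rw [h0]
  refine (norm_sum_mul_sq_le _ _ _).trans ?_
  have hα : 0 ≤ ∑ m ∈ s, α m ^ 2 := sum_nonneg fun _ _ => sq_nonneg _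
  apply mul_le_mul_of_nonneg_left _ hα
  have hJ0 : 0 ≤ J := le_trans (by positivity) hJ
  set I := t.image (· / Q) with hI
  have h1 : ∀ m ∈ s, ‖∑ l ∈ t, (β l : ℂ) * E m l‖ ^ 2 ≤
      J * ∑ j ∈ I, ‖∑ l ∈ t.filter (fun l => l / Q = j), (β l : ℂ) * E m l‖ ^ 2 := by
    intro m _
    rw [← sum_fiberwise_of_maps_to (s := t) (t := I) (g := (· / Q))
      (fun l hl => mem_image_of_mem _ hl)]
    refine (norm_sum_sq_le_card_mul _ _).trans ?_
    gcongr
  refine (sum_le_sum h1).trans ?_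
  rw [← mul_sum]
  apply mul_le_mul_of_nonneg_left _ hJ0
  rw [sum_comm]
  have h2 : ∀ j ∈ I, ∑ m ∈ s, ‖∑ l ∈ t.filter (fun l => l / Q = j), (β l : ℂ) * E m l‖ ^ 2 ≤
      ∑ l ∈ t.filter (fun l => l / Q = j), ∑ l' ∈ t.filter (fun l => l / Q = j),
        |β l| * |β l'| * W ((l - l') + (l' - l)) := by
    intro j _
    set B := t.filter (fun l => l / Q = j) with hB
    have h3 : ((∑ m ∈ s, ‖∑ l ∈ B, (β l : ℂ) * E m l‖ ^ 2 : ℝ) : ℂ) =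
        ∑ l ∈ B, ∑ l' ∈ B, (β l : ℂ) * β l' * ∑ m ∈ s, E m l * starRingEnd ℂ (E m l') := by
      push_cast
      have h4 : ∀ m, ((‖∑ l ∈ B, (β l : ℂ) * E m l‖ : ℂ)) ^ 2 =
          ∑ l ∈ B, ∑ l' ∈ B, (β l : ℂ) * β l' * (E m l * starRingEnd ℂ (E m l')) := by
        intro m
        rw [← Complex.mul_conj', map_sum, sum_mul_sum]
        refine sum_congr rfl fun l _ => sum_congr rfl fun l' _ => ?_
        rw [map_mul, Complex.conj_ofReal]; ring
      simp_rw [h4, mul_sum]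
      rw [sum_comm]
      refine sum_congr rfl fun l _ => ?_
      rw [sum_comm]
    have h5 : ∑ m ∈ s, ‖∑ l ∈ B, (β l : ℂ) * E m l‖ ^ 2 =
        ‖((∑ m ∈ s, ‖∑ l ∈ B, (β l : ℂ) * E m l‖ ^ 2 : ℝ) : ℂ)‖ := by
      rw [Complex.norm_real, Real.norm_of_nonneg (sum_nonneg fun _ _ => sq_nonneg _)]
    rw [h5, h3]
    refine (norm_sum_le _ _).trans (sum_le_sum fun l hl => ?_)
    refine (norm_sum_le _ _).trans (sum_le_sum fun l' hl' => ?_)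
    rw [norm_mul, norm_mul, Complex.norm_real, Complex.norm_real, Real.norm_eq_abs,
      Real.norm_eq_abs]
    have hl2 := mem_filter.mp hl
    have hl2' := mem_filter.mp hl'
    gcongr
    exact hV l hl2.1 l' hl2'.1 (hl2.2.trans hl2'.2.symm)
  refine (sum_le_sum h2).trans ?_
  have h6 : ∀ j ∈ I, ∑ l ∈ t.filter (fun l => l / Q = j), ∑ l' ∈ t.filter (fun l => l / Q = j),
        |β l| * |β l'| * W ((l - l') + (l' - l)) ≤
      ∑ l ∈ t.filter (fun l => l / Q = j), β l ^ 2 * (W 0 + 2 * ∑ q ∈ Ico 1 Q, W q) := by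
    intro j _
    set B := t.filter (fun l => l / Q = j) with hB
    have h7 : ∑ l ∈ B, ∑ l' ∈ B, |β l| * |β l'| * W ((l - l') + (l' - l)) ≤
        ∑ l ∈ B, ∑ l' ∈ B, (β l ^ 2 / 2 * W ((l - l') + (l' - l)) +
          β l' ^ 2 / 2 * W ((l - l') + (l' - l))) := by
      refine sum_le_sum fun l _ => sum_le_sum fun l' _ => ?_
      rw [← add_mul]
      apply mul_le_mul_of_nonneg_right _ (hW _)
      have := two_mul_le_add_sq |β l| |β l'|
      rw [sq_abs, sq_abs] at this
      linarith
    refine h7.trans ?_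
    simp_rw [sum_add_distrib]
    rw [sum_comm (f := fun l l' => β l' ^ 2 / 2 * W ((l - l') + (l' - l))), ← sum_add_distrib]
    refine sum_le_sum fun l hl => ?_
    have h8 : ∑ l' ∈ B, β l ^ 2 / 2 * W ((l' - l) + (l - l')) =
        ∑ l' ∈ B, β l ^ 2 / 2 * W ((l - l') + (l' - l)) :=
      sum_congr rfl fun l' _ => by rw [add_comm]
    rw [h8, ← mul_sum, ← add_mul, add_halves]
    apply mul_le_mul_of_nonneg_left _ (sq_nonneg _)
    have hBl : B = t.filter (fun l' => l' / Q = l / Q) := by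
      rw [hB, (mem_filter.mp hl).2]
    rw [hBl]
    exact sum_block_dist_le hQ hW
  refine (sum_le_sum h6).trans_eq ?_
  rw [sum_fiberwise_of_maps_to (fun l hl => mem_image_of_mem _ hl), ← sum_mul]

lemma card_image_div_le {L Q : ℕ} (hQ : 0 < Q) (hQL : Q ≤ L) :
    ((((Ico L (2 * L)).image (· / Q)).card : ℕ) : ℝ) ≤ 3 * (L / Q) := by
  have h1 : (Ico L (2 * L)).image (· / Q) ⊆ Icc (L / Q) (2 * L / Q) := by
    intro j hj
    simp only [mem_image, mem_Ico, mem_Icc] at *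
    obtain ⟨l, h, rfl⟩ := hj
    exact ⟨Nat.div_le_div_right h.1, Nat.div_le_div_right h.2.le⟩
  have h2 := card_le_card h1
  rw [Nat.card_Icc] at h2
  have hQ' : (0 : ℝ) < Q := by exact_mod_cast hQ
  have h3 : (1 : ℝ) ≤ L / Q := by
    rw [le_div_iff₀ hQ', one_mul]; exact_mod_cast hQL
  have h4 : ((2 * L / Q : ℕ) : ℝ) ≤ 2 * (L / Q) := by
    refine Nat.cast_div_le.trans_eq ?_
    push_cast; ring
  have h5 : (L / Q : ℝ) < (L / Q : ℕ) + 1 := by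
    rw [div_lt_iff₀ hQ']
    have h := Nat.lt_mul_of_div_lt (Nat.lt_succ_self (L / Q)) hQ
    exact_mod_cast h
  have h6 : ((((Ico L (2 * L)).image (· / Q)).card : ℕ) : ℝ) + (L / Q : ℕ) ≤ (2 * L / Q : ℕ) + 1 := by
    have : L / Q ≤ 2 * L / Q := Nat.div_le_div_right (by omega)
    exact_mod_cast (by omega)
  linarith

lemma sum_inv_sqrt_le (Q : ℕ) : ∑ q ∈ Ico 1 Q, 1 / √(q : ℝ) ≤ 2 * √Q := by
  have key : ∀ n : ℕ, ∑ q ∈ Ico 1 (n + 1), 1 / √(q : ℝ) ≤ 2 * √n := by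
    intro n
    induction n with
    | zero => simp
    | succ n ih =>
      rw [sum_Ico_succ_top (by omega)]
      have h1 : 0 < √((n + 1 : ℕ) : ℝ) := Real.sqrt_pos.mpr (by positivity)
      have h2 : √((n + 1 : ℕ) : ℝ) ^ 2 = n + 1 := by
        rw [Real.sq_sqrt (by positivity)]; push_cast; ring
      have h3 : √(n : ℝ) ^ 2 = n := Real.sq_sqrt (by positivity)
      have h4 : 1 / √((n + 1 : ℕ) : ℝ) ≤ 2 * (√((n + 1 : ℕ) : ℝ) - √(n : ℝ)) := by
        rw [div_le_iff₀ h1]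
        nlinarith [sq_nonneg (√((n + 1 : ℕ) : ℝ) - √(n : ℝ))]
      linarith
  refine le_trans ?_ (key Q)
  apply sum_le_sum_of_subset_of_nonneg
  · exact Ico_subset_Ico_right (by omega)
  · intros; positivity

lemma exists_second_difference_eq {G G1 G2 : ℝ → ℝ} {x : ℝ}
    (h1 : ∀ y ∈ Set.Icc x (x + 2), HasDerivAt G (G1 y) y)
    (h2 : ∀ y ∈ Set.Icc x (x + 2), HasDerivAt G1 (G2 y) y) :
    ∃ ξ ∈ Set.Icc x (x + 2), G (x + 2) - 2 * G (x + 1) + G x = G2 ξ := by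
  have hd : ∀ y ∈ Set.Icc x (x + 1), HasDerivAt (fun y => G (y + 1) - G y) (G1 (y + 1) - G1 y) y := by
    intro y hy
    exact ((h1 (y + 1) ⟨by linarith [hy.1], by linarith [hy.2]⟩).comp_add_const y 1).sub
      (h1 y ⟨hy.1, by linarith [hy.2]⟩)
  obtain ⟨y, hy, hy2⟩ := exists_hasDerivAt_eq_slope (fun y => G (y + 1) - G y)
    (fun y => G1 (y + 1) - G1 y) (by linarith : x < x + 1)
    (fun y hy => (hd y hy).continuousAt.continuousWithinAt)
    (fun y hy => hd y ⟨hy.1.le, hy.2.le⟩)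
  obtain ⟨ξ, hξ, hξ2⟩ := exists_hasDerivAt_eq_slope G1 G2 (by linarith : y < y + 1)
    (fun z hz => (h2 z ⟨by linarith [hz.1, hy.1], by linarith [hz.2, hy.2]⟩).continuousAt.continuousWithinAt)
    (fun z hz => h2 z ⟨by linarith [hz.1, hy.1], by linarith [hz.2, hy.2]⟩)
  refine ⟨ξ, ⟨by linarith [hξ.1, hy.1], by linarith [hξ.2, hy.2]⟩, ?_⟩
  rw [hξ2, add_sub_cancel_left, div_one, hy2, add_sub_cancel_left, div_one]
  have : x + 1 + 1 = x + 2 := by ring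
  rw [this]; ring

/-- A phase `f` on `[a, b]` of size `F` at scale `X`: both `f''` and `(u² f'')'` have constant
sign and the expected order of magnitude. -/
structure IsPhase (f : ℝ → ℝ) (A F X a b : ℝ) : Prop where
  exists_deriv : ∃ f1 f2 k1 : ℝ → ℝ, ∃ s s' : ℝ, (s = 1 ∨ s = -1) ∧ (s' = 1 ∨ s' = -1) ∧
    ∀ x ∈ Set.Icc a b, HasDerivAt f (f1 x) x ∧ HasDerivAt f1 (f2 x) x ∧
      HasDerivAt (fun u => u ^ 2 * f2 u) (k1 x) x ∧
      (F / X ^ 2 ≤ s * f2 x ∧ s * f2 x ≤ A * (F / X ^ 2)) ∧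
      (F / X ≤ s' * k1 x ∧ s' * k1 x ≤ A * (F / X))

lemma hasDerivAt_comp_mul_left {f : ℝ → ℝ} {f' x m : ℝ} (h : HasDerivAt f f' (m * x)) :
    HasDerivAt (fun y => f (m * y)) (m * f') x := by
  have := h.comp x ((hasDerivAt_id x).const_mul m)
  simpa [mul_comm, Function.comp_def] using this

lemma norm_sum_phase_le {f : ℝ → ℝ} {A F X a b : ℝ} (hA : 1 ≤ A) (hF : 0 < F) (hX : 0 < X)
    (hf : IsPhase f A F X a b) (hbX : b ≤ X) {m p q : ℕ} (hm : 0 < m)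
    (hpq : ∀ n : ℕ, p < n → n ≤ q → a ≤ (m * n : ℝ) ∧ (m * n : ℝ) ≤ b) :
    ‖∑ n ∈ Ioc p q, e (f (m * n))‖ ≤ 13 * A * (√F + X / √F * (m : ℝ)⁻¹) := by
  rcases le_or_gt q p with h0 | h0
  · rw [Ioc_eq_empty_of_le h0]; simp; positivity
  obtain ⟨f1, f2, k1, s, s', hs, -, h⟩ := hf.exists_deriv
  have hm' : (0 : ℝ) < m := by exact_mod_cast hm
  set lam : ℝ := m ^ 2 * (F / X ^ 2) with hlam
  have hlam0 : 0 < lam := by positivity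
  have hsq : √lam = m * √F / X := by
    rw [hlam, Real.sqrt_eq_iff_mul_self_eq (by positivity) (by positivity)]
    field_simp
    rw [Real.sq_sqrt hF.le]
  have hdiff : ∀ n : ℕ, p < n → n + 2 ≤ q →
      lam ≤ s * (f (m * (n + 2 : ℕ)) - 2 * f (m * (n + 1 : ℕ)) + f (m * n)) ∧
      s * (f (m * (n + 2 : ℕ)) - 2 * f (m * (n + 1 : ℕ)) + f (m * n)) ≤ A * lam := by
    intro n hn hn2
    have hmem : ∀ y ∈ Set.Icc (n : ℝ) (n + 2), (m : ℝ) * y ∈ Set.Icc a b := by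
      intro y hy
      have e1 := hpq n hn (by omega)
      have e2 := hpq (n + 2) (by omega) hn2
      push_cast at e2
      constructor
      · exact e1.1.trans (by gcongr; exact hy.1)
      · exact le_trans (by gcongr; exact hy.2) e2.2
    obtain ⟨ξ, hξ, hξ2⟩ := exists_second_difference_eq (x := (n : ℝ)) (G := fun y => f (m * y))
      (G1 := fun y => m * f1 (m * y)) (G2 := fun y => m * (m * f2 (m * y)))
      (fun y hy => hasDerivAt_comp_mul_left (h _ (hmem y hy)).1)
      (fun y hy => (hasDerivAt_comp_mul_left (h _ (hmem y hy)).2.1).const_mul _)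
    push_cast
    rw [hξ2]
    have h4 := (h _ (hmem ξ hξ)).2.2.2.1
    have h5 : s * (m * (m * f2 (m * ξ))) = m ^ 2 * (s * f2 (m * ξ)) := by ring
    rw [h5, hlam]
    constructor
    · gcongr; exact h4.1
    · calc _ ≤ (m : ℝ) ^ 2 * (A * (F / X ^ 2)) :=
          mul_le_mul_of_nonneg_left h4.2 (by positivity)
        _ = _ := by ring
  have hv := norm_sum_Ioc_e_le_of_second_differences (f := fun n : ℕ => f (m * n)) h0.le hlam0 hA (by
    rcases hs with rfl | rfl
    · left; intro n hn hn2; have := hdiff n hn hn2; rwa [one_mul] at this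
    · right; intro n hn hn2; have := hdiff n hn hn2; rwa [neg_one_mul] at this)
  refine hv.trans ?_
  rw [hsq]
  have hq := (hpq q h0 le_rfl).2
  have hsF : 0 < √F := Real.sqrt_pos.mpr hF
  have hle : ((q : ℝ) - p) * m ≤ X := by
    have : (0 : ℝ) ≤ p := by positivity
    nlinarith
  gcongr 13 * A * ?_
  apply add_le_add
  · calc ((q : ℝ) - p) * (m * √F / X) = (((q : ℝ) - p) * m) * √F / X := by ring
      _ ≤ X * √F / X := by gcongr
      _ = √F := by field_simp
  · apply le_of_eq; field_simp

lemma norm_sum_phase_diff_le {f : ℝ → ℝ} {A F X a b μ : ℝ} (hA : 1 ≤ A) (hF : 0 < F) (hX : 0 < X)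
    (hμ : 0 < μ) (hμ1 : μ ≤ 1) (hf : IsPhase f A F X a b) (haX : μ * X ≤ a) (hbX : b ≤ X)
    {L l l' p q : ℕ} (hL : 0 < L) (hl : L ≤ l) (hl2 : l < 2 * L) (hl' : L ≤ l')
    (hne : l' < l)
    (hpq : ∀ n : ℕ, p < n → n ≤ q → (a ≤ (l * n : ℝ) ∧ (l * n : ℝ) ≤ b) ∧
      (a ≤ (l' * n : ℝ) ∧ (l' * n : ℝ) ≤ b)) :
    ‖∑ n ∈ Ioc p q, e (f (l * n) - f (l' * n))‖ ≤
      26 * A / μ * (√(F * (l - l' : ℕ) / L) + X / √(F * L * (l - l' : ℕ))) := by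
  rcases le_or_gt q p with h0 | h0
  · rw [Ioc_eq_empty_of_le h0]; simp; positivity
  obtain ⟨f1, f2, k1, s, s', -, hs, h⟩ := hf.exists_deriv
  have hL' : (0 : ℝ) < L := by exact_mod_cast hL
  have hlR : (L : ℝ) ≤ l := by exact_mod_cast hl
  have hlR' : (L : ℝ) ≤ l' := by exact_mod_cast hl'
  have hlR2 : (l : ℝ) ≤ 2 * L := by exact_mod_cast hl2.le
  have hneR : (l' : ℝ) < l := by exact_mod_cast hne
  rw [Nat.cast_sub hne.le]
  set d : ℝ := (l : ℝ) - l' with hd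
  have hd0 : 0 < d := by rw [hd]; linarith
  set lam : ℝ := F / X * d * (L / X) with hlam
  have hlam0 : 0 < lam := by positivity
  have hsq : √lam = √(F * L * d) / X := by
    rw [hlam, ← Real.sqrt_sq hX.le, ← Real.sqrt_div' _ (by positivity), Real.sqrt_sq hX.le]
    congr 1; field_simp
  have hdiff : ∀ n : ℕ, p < n → n + 2 ≤ q →
      lam ≤ s' * ((f (l * (n + 2 : ℕ)) - f (l' * (n + 2 : ℕ))) -
        2 * (f (l * (n + 1 : ℕ)) - f (l' * (n + 1 : ℕ))) + (f (l * n) - f (l' * n))) ∧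
      s' * ((f (l * (n + 2 : ℕ)) - f (l' * (n + 2 : ℕ))) -
        2 * (f (l * (n + 1 : ℕ)) - f (l' * (n + 1 : ℕ))) + (f (l * n) - f (l' * n))) ≤
        2 * A / μ * lam := by
    intro n hn hn2
    have hn0 : (0 : ℝ) < n := by exact_mod_cast (by omega : 0 < n)
    have hmem : ∀ r : ℝ, (l' : ℝ) ≤ r → r ≤ l → ∀ y ∈ Set.Icc (n : ℝ) (n + 2),
        r * y ∈ Set.Icc a b := by
      intro r hr1 hr2 y hy
      have e1 := hpq n hn (by omega)
      have e2 := hpq (n + 2) (by omega) hn2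
      push_cast at e2
      have : 0 < y := hn0.trans_le hy.1
      have hr0 : 0 ≤ r := le_trans (by positivity) hr1
      constructor
      · exact e1.2.1.trans (by gcongr; exact hy.1)
      · refine le_trans ?_ e2.1.2
        gcongr
        exact hy.2
    obtain ⟨ξ, hξ, hξ2⟩ := exists_second_difference_eq (x := (n : ℝ))
      (G := fun y => f (l * y) - f (l' * y))
      (G1 := fun y => l * f1 (l * y) - l' * f1 (l' * y))
      (G2 := fun y => l * (l * f2 (l * y)) - l' * (l' * f2 (l' * y)))
      (fun y hy => (hasDerivAt_comp_mul_left (h _ (hmem l hneR.le le_rfl y hy)).1).sub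
        (hasDerivAt_comp_mul_left (h _ (hmem l' le_rfl hneR.le y hy)).1))
      (fun y hy => ((hasDerivAt_comp_mul_left (h _ (hmem l hneR.le le_rfl y hy)).2.1).const_mul _).sub
        ((hasDerivAt_comp_mul_left (h _ (hmem l' le_rfl hneR.le y hy)).2.1).const_mul _))
    push_cast
    rw [hξ2]
    have hξ0 : 0 < ξ := hn0.trans_le hξ.1
    have hin : ∀ z ∈ Set.Icc (l' * ξ) (l * ξ), z ∈ Set.Icc a b := fun z hz =>
      ⟨(hmem l' le_rfl hneR.le ξ hξ).1.trans hz.1, hz.2.trans (hmem l hneR.le le_rfl ξ hξ).2⟩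
    obtain ⟨η, hη, hη2⟩ := exists_hasDerivAt_eq_slope (fun u => u ^ 2 * f2 u) k1
      (by gcongr : l' * ξ < l * ξ)
      (fun z hz => (h z (hin z hz)).2.2.1.continuousAt.continuousWithinAt)
      (fun z hz => (h z (hin z ⟨hz.1.le, hz.2.le⟩)).2.2.1)
    have hη3 := (h η (hin η ⟨hη.1.le, hη.2.le⟩)).2.2.2.2
    have hval : s' * (l * (l * f2 (l * ξ)) - l' * (l' * f2 (l' * ξ))) = s' * k1 η * d / ξ := by
      have hdne : (l : ℝ) * ξ - l' * ξ ≠ 0 := by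
        have : 0 < (l : ℝ) * ξ - l' * ξ := by rw [← sub_mul]; positivity
        exact this.ne'
      rw [eq_div_iff hdne] at hη2
      rw [eq_div_iff hξ0.ne', hd]
      have h9 : ξ * (s' * k1 η * ((l : ℝ) - l')) = ξ * (s' * (l * (l * f2 (l * ξ)) - l' * (l' * f2 (l' * ξ))) * ξ) := by
        linear_combination s' * hη2
      exact (mul_left_cancel₀ hξ0.ne' h9).symm
    rw [hval]
    have hξ1 : ξ * L ≤ X := by
      have := (hmem l hneR.le le_rfl ξ hξ).2
      nlinarith
    have hξ4 : μ * X ≤ 2 * L * ξ := by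
      have := (hmem l hneR.le le_rfl ξ hξ).1
      nlinarith
    have hinv1 : L / X ≤ 1 / ξ := by
      rw [div_le_div_iff₀ hX hξ0]; linarith
    have hinv2 : 1 / ξ ≤ 2 / μ * (L / X) := by
      rw [div_mul_div_comm, div_le_div_iff₀ hξ0 (by positivity)]; linarith
    have hFX : 0 < F / X := by positivity
    rw [hlam, mul_div_assoc, mul_assoc (F / X)]
    constructor
    · calc F / X * (d * (L / X)) ≤ s' * k1 η * (d * (1 / ξ)) := by
            gcongr
            · exact hFX.le.trans hη3.1
            · exact hη3.1
        _ = _ := by ring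
    · calc s' * k1 η * (d / ξ) = s' * k1 η * (d * (1 / ξ)) := by ring
        _ ≤ A * (F / X) * (d * (2 / μ * (L / X))) :=
            mul_le_mul hη3.2 (mul_le_mul_of_nonneg_left hinv2 hd0.le) (by positivity) (by positivity)
        _ = _ := by ring
  have hv := norm_sum_Ioc_e_le_of_second_differences
    (f := fun n : ℕ => f (l * n) - f (l' * n)) (A := 2 * A / μ) h0.le hlam0
    (by rw [le_div_iff₀ hμ]; linarith) (by
    rcases hs with rfl | rfl
    · left; intro n hn hn2; have := hdiff n hn hn2; rwa [one_mul] at this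
    · right; intro n hn hn2; have := hdiff n hn hn2; rwa [neg_one_mul] at this)
  refine hv.trans ?_
  rw [hsq]
  have hq := (hpq q h0 le_rfl).1.2
  have hle : ((q : ℝ) - p) ≤ X / L := by
    rw [le_div_iff₀ hL']
    have : (0 : ℝ) ≤ p := by positivity
    have : (0 : ℝ) ≤ q := by positivity
    nlinarith
  have hS : 0 < √(F * L * d) := Real.sqrt_pos.mpr (by positivity)
  have e1 : 13 * (2 * A / μ) = 26 * A / μ := by ring
  rw [e1]
  gcongr 26 * A / μ * ?_
  apply add_le_add
  · calc ((q : ℝ) - p) * (√(F * L * d) / X) ≤ X / L * (√(F * L * d) / X) := by gcongr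
      _ = √(F * L * d) / √(L ^ 2) := by rw [Real.sqrt_sq hL'.le]; field_simp
      _ = √(F * d / L) := by
        rw [← Real.sqrt_div' _ (by positivity)]; congr 1; field_simp
  · apply le_of_eq; rw [one_div_div]

lemma norm_bilinear_dyadic_sq_le {f : ℝ → ℝ} {A F X μ D : ℝ} (hA : 1 ≤ A) (hF : 0 < F)
    (hX : 0 < X) (hμ : 0 < μ) (hμ1 : μ ≤ 1) (hf : IsPhase f A F X (μ * X) X) {a b : ℕ}
    (ha : μ * X ≤ a + 1) (hb : (b : ℝ) ≤ X) (hD : 0 ≤ D) {α β : ℕ → ℝ}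
    (hα : ∀ N : ℕ, (N : ℝ) ≤ X → ∑ n ∈ Ioc 0 N, α n ^ 2 ≤ N * D)
    (hβ : ∀ N : ℕ, (N : ℝ) ≤ X → ∑ n ∈ Ioc 0 N, β n ^ 2 ≤ N * D)
    {L Q : ℕ} (hQ : 0 < Q) (hQL : Q ≤ L) (hLX : (2 * L : ℝ) ≤ X) :
    ‖∑ l ∈ Ico L (2 * L), (β l : ℂ) * ∑ m ∈ Ioc (a / l) (b / l), (α m : ℂ) * e (f (l * m))‖ ^ 2 ≤
      6 * X * D ^ 2 * (X / Q + 104 * A / μ * (√(F * Q * L) + X * √(L / (F * Q)))) := by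
  have hL : 0 < L := hQ.trans_le hQL
  have hL' : (0 : ℝ) < L := by exact_mod_cast hL
  have hQ' : (0 : ℝ) < Q := by exact_mod_cast hQ
  set E : ℕ → ℕ → ℂ := fun m l => if m ∈ Ioc (a / l) (b / l) then e (f (l * m)) else 0 with hE
  set W : ℕ → ℝ := fun q => if q = 0 then X / L else
    26 * A / μ * (√(F * Q / L) + X / √(F * L) * (1 / √q)) with hWdef
  have hW : ∀ q, 0 ≤ W q := by
    intro q; simp only [hWdef]; split_ifs <;> positivity
  have hrange : ∀ l : ℕ, 0 < l → ∀ n : ℕ, a / l < n → n ≤ b / l →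
      μ * X ≤ (l * n : ℝ) ∧ (l * n : ℝ) ≤ X := by
    intro l hl n h1 h2
    rw [Nat.div_lt_iff_lt_mul hl] at h1
    rw [Nat.le_div_iff_mul_le hl] at h2
    have h3 : (a : ℝ) + 1 ≤ n * l := by exact_mod_cast h1
    have h4 : (n : ℝ) * l ≤ b := by exact_mod_cast h2
    constructor <;> linarith
  have hV1 : ∀ l ∈ Ico L (2 * L), ∀ l' ∈ Ico L (2 * L), l / Q = l' / Q → l' < l →
      ‖∑ m ∈ Ioc 0 (b / L), E m l * starRingEnd ℂ (E m l')‖ ≤ W (l - l') := by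
    intro l hl l' hl' hj hlt
    rw [mem_Ico] at hl hl'
    have h1 : ∑ m ∈ Ioc 0 (b / L), E m l * starRingEnd ℂ (E m l') =
        ∑ m ∈ Ioc (max (a / l) (a / l')) (min (b / l) (b / l')), e (f (l * m) - f (l' * m)) := by
      have h2 : Ioc (max (a / l) (a / l')) (min (b / l) (b / l')) =
          (Ioc 0 (b / L)).filter
            (fun m => m ∈ Ioc (a / l) (b / l) ∧ m ∈ Ioc (a / l') (b / l')) := by
        ext m
        simp only [mem_Ioc, mem_filter, max_lt_iff, le_min_iff]
        have h3 : b / l ≤ b / L := Nat.div_le_div_left hl.1 hL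
        constructor
        · rintro ⟨⟨h4, h5⟩, h6, h7⟩
          exact ⟨⟨(Nat.zero_le _).trans_lt h4, h6.trans h3⟩, ⟨h4, h6⟩, h5, h7⟩
        · rintro ⟨_, ⟨h4, h6⟩, h5, h7⟩
          exact ⟨⟨h4, h5⟩, h6, h7⟩
      rw [h2, sum_filter]
      refine sum_congr rfl fun m _ => ?_
      simp only [hE]
      by_cases h4 : m ∈ Ioc (a / l) (b / l) <;> by_cases h5 : m ∈ Ioc (a / l') (b / l') <;>
        simp [h4, h5, e_sub]
    rw [h1]
    have hd0 : l - l' ≠ 0 := by omega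
    have hdQ : l - l' < Q := by
      have h2 := Nat.div_add_mod l Q
      have h3 := Nat.div_add_mod l' Q
      have h4 := Nat.mod_lt l hQ
      rw [hj] at h2
      omega
    refine (norm_sum_phase_diff_le hA hF hX hμ hμ1 hf le_rfl le_rfl hL hl.1 hl.2 hl'.1
      hlt ?_).trans ?_
    · intro n h2 h3
      rw [max_lt_iff] at h2
      rw [le_min_iff] at h3
      exact ⟨hrange l (by omega) n h2.1 h3.1, hrange l' (by omega) n h2.2 h3.2⟩
    · simp only [hWdef, if_neg hd0]
      have hd : ((l - l' : ℕ) : ℝ) ≤ Q := by exact_mod_cast hdQ.le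
      have hd1 : (0 : ℝ) < (l - l' : ℕ) := by exact_mod_cast Nat.pos_of_ne_zero hd0
      gcongr
      apply le_of_eq
      rw [Real.sqrt_mul (by positivity)]
      field_simp
  have hV : ∀ l ∈ Ico L (2 * L), ∀ l' ∈ Ico L (2 * L), l / Q = l' / Q →
      ‖∑ m ∈ Ioc 0 (b / L), E m l * starRingEnd ℂ (E m l')‖ ≤ W ((l - l') + (l' - l)) := by
    intro l hl l' hl' hj
    rcases lt_trichotomy l' l with h | rfl | h
    · have h1 : l' - l = 0 := by omega
      rw [h1, add_zero]
      exact hV1 l hl l' hl' hj h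
    · simp only [Nat.sub_self, add_zero, hWdef, if_true]
      refine (norm_sum_le _ _).trans ?_
      have h1 : ∀ m ∈ Ioc 0 (b / L), ‖E m l' * starRingEnd ℂ (E m l')‖ ≤ 1 := by
        intro m _
        rw [norm_mul, RCLike.norm_conj]
        simp only [hE]; split_ifs <;> simp [norm_e]
      refine (sum_le_card_nsmul _ _ _ h1).trans ?_
      rw [Nat.card_Ioc, Nat.sub_zero, nsmul_eq_mul, mul_one]
      refine Nat.cast_div_le.trans ?_
      gcongr
    · have h1 : l - l' = 0 := by omega
      have h2 : ∑ m ∈ Ioc 0 (b / L), E m l * starRingEnd ℂ (E m l') =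
          starRingEnd ℂ (∑ m ∈ Ioc 0 (b / L), E m l' * starRingEnd ℂ (E m l)) := by
        rw [map_sum]
        refine sum_congr rfl fun m _ => ?_
        rw [map_mul, Complex.conj_conj, mul_comm]
      rw [h1, zero_add, h2, RCLike.norm_conj]
      exact hV1 l' hl' l hl hj.symm h
  have hmain := norm_bilinear_sq_le (Ioc 0 (b / L)) (Ico L (2 * L)) α β E hQ hW
    (card_image_div_le hQ hQL) hV
  have hlhs : ∑ l ∈ Ico L (2 * L), (β l : ℂ) * ∑ m ∈ Ioc (a / l) (b / l), (α m : ℂ) * e (f (l * m))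
      = ∑ l ∈ Ico L (2 * L), (β l : ℂ) * ∑ m ∈ Ioc 0 (b / L), (α m : ℂ) * E m l := by
    refine sum_congr rfl fun l hl => ?_
    rw [mem_Ico] at hl
    have h2 : Ioc (a / l) (b / l) = (Ioc 0 (b / L)).filter (fun m => m ∈ Ioc (a / l) (b / l)) := by
      ext m
      simp only [mem_Ioc, mem_filter]
      have h3 : b / l ≤ b / L := Nat.div_le_div_left hl.1 hL
      constructor
      · rintro ⟨h4, h5⟩
        exact ⟨⟨(Nat.zero_le _).trans_lt h4, h5.trans h3⟩, h4, h5⟩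
      · rintro ⟨_, h⟩; exact h
    rw [h2, sum_filter]
    congr 1
    refine sum_congr rfl fun m _ => ?_
    simp only [hE, mul_ite, mul_zero]
  rw [hlhs]
  refine hmain.trans ?_
  have hα2 : ∑ m ∈ Ioc 0 (b / L), α m ^ 2 ≤ X / L * D := by
    have h1 : ((b / L : ℕ) : ℝ) ≤ X / L := Nat.cast_div_le.trans (by gcongr)
    refine (hα (b / L) (h1.trans (div_le_self hX.le (by exact_mod_cast hL)))).trans ?_
    gcongr
  have hβ2 : ∑ l ∈ Ico L (2 * L), β l ^ 2 ≤ 2 * L * D := by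
    have h1 := hβ (2 * L) (by push_cast; exact hLX)
    push_cast at h1
    refine le_trans ?_ h1
    apply sum_le_sum_of_subset_of_nonneg
    · intro l hl; simp only [mem_Ico, mem_Ioc] at *; omega
    · intros; positivity
  have hsumW : ∑ q ∈ Ico 1 Q, W q ≤
      26 * A / μ * (Q * √(F * Q / L) + X / √(F * L) * (2 * √Q)) := by
    have h1 : ∑ q ∈ Ico 1 Q, W q = ∑ q ∈ Ico 1 Q,
        26 * A / μ * (√(F * Q / L) + X / √(F * L) * (1 / √q)) := by
      refine sum_congr rfl fun q hq => ?_
      rw [mem_Ico] at hq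
      simp only [hWdef, if_neg (by omega : q ≠ 0)]
    rw [h1, ← mul_sum, sum_add_distrib, sum_const, nsmul_eq_mul, ← mul_sum, Nat.card_Ico]
    gcongr
    · omega
    · exact sum_inv_sqrt_le Q
  have hW0 : W 0 = X / L := by simp [hWdef]
  have hWn : 0 ≤ ∑ q ∈ Ico 1 Q, W q := sum_nonneg fun _ _ => hW _
  calc _ ≤ (X / L * D) * (3 * (L / Q) * ((2 * L * D) * (X / L + 2 *
        (26 * A / μ * (Q * √(F * Q / L) + X / √(F * L) * (2 * √Q)))))) := by
        rw [hW0]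
        gcongr
    _ = 6 * X * D ^ 2 * (X / Q + 52 * A / μ * ((L / Q * Q) * √(F * Q / L) +
        2 * X * (L / Q * (√Q / √(F * L))))) := by
        field_simp
        ring
    _ ≤ _ := by
        have e1 : (L / Q * Q : ℝ) * √(F * Q / L) = √(F * Q * L) := by
          rw [div_mul_cancel₀ _ hQ'.ne']
          nth_rw 1 [← Real.sqrt_sq hL'.le]
          rw [← Real.sqrt_mul (by positivity)]
          congr 1; field_simp
        have e2 : (L / Q * (√Q / √(F * L)) : ℝ) = √(L / (F * Q)) := by
          have : (L / Q : ℝ) = √((L / Q) ^ 2) := (Real.sqrt_sq (by positivity)).symm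
          rw [this, ← Real.sqrt_div' _ (by positivity), ← Real.sqrt_mul (by positivity)]
          congr 1; field_simp
        rw [e1, e2]
        have h3 : 0 ≤ A / μ * √(F * Q * L) := by positivity
        gcongr 6 * X * D ^ 2 * (X / Q + ?_)
        have h4 : 104 * A / μ * (√(F * Q * L) + X * √(L / (F * Q))) =
          52 * A / μ * (√(F * Q * L) + 2 * X * √(L / (F * Q))) + 52 * (A / μ * √(F * Q * L)) := by
          ring
        rw [h4]
        linarith

/-- The quantity controlling bilinear sums with variables of size at least `U`. -/
noncomputable def bilinearBound (A F X μ U Q : ℝ) : ℝ :=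
  X / U + X / Q + 104 * A / μ * (√(F * Q * √X) + X / √F + X * √(√X / (F * Q)))

lemma sum_Ico_two_pow_mul {M : Type*} [AddCommMonoid M] (g : ℕ → M) (V J : ℕ) :
    ∑ l ∈ Ico V (2 ^ J * V), g l =
      ∑ j ∈ range J, ∑ l ∈ Ico (2 ^ j * V) (2 * (2 ^ j * V)), g l := by
  induction J with
  | zero => simp
  | succ J ih =>
    rw [sum_range_succ, ← ih, sum_Ico_consecutive _ (Nat.le_mul_of_pos_left _ (by positivity))
      (by omega)]
    congr 2; ring

lemma log_two_add_one_le {R : ℕ} {X : ℝ} (hX : 1 ≤ X) (hR : (R : ℝ) ≤ √X) :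
    ((Nat.log 2 R + 1 : ℕ) : ℝ) ≤ 1 + Real.log X := by
  have h0 : 0 ≤ Real.log X := Real.log_nonneg hX
  rcases Nat.eq_zero_or_pos R with rfl | hR0
  · simp [h0]
  have h1 : ((2 : ℝ)) ^ (Nat.log 2 R) ≤ R := by exact_mod_cast Nat.pow_log_le_self 2 hR0.ne'
  have h2 := Real.log_le_log (by positivity) (h1.trans hR)
  rw [Real.log_pow, Real.log_sqrt (by positivity)] at h2
  have h3 := Real.log_two_gt_d9
  push_cast
  have h4 : (0 : ℝ) ≤ Nat.log 2 R := by positivity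
  nlinarith

lemma norm_bilinear_le_of_support {f : ℝ → ℝ} {A F X μ D : ℝ} (hA : 1 ≤ A) (hF : 0 < F)
    (hX : 4 ≤ X) (hμ : 0 < μ) (hμ1 : μ ≤ 1) (hf : IsPhase f A F X (μ * X) X) {a b : ℕ}
    (ha : μ * X ≤ a + 1) (hb : (b : ℝ) ≤ X) (hD : 0 ≤ D) {α β : ℕ → ℝ}
    (hα : ∀ N : ℕ, (N : ℝ) ≤ X → ∑ n ∈ Ioc 0 N, α n ^ 2 ≤ N * D)
    (hβ : ∀ N : ℕ, (N : ℝ) ≤ X → ∑ n ∈ Ioc 0 N, β n ^ 2 ≤ N * D)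
    {U Q R : ℕ} (hU : 0 < U) (hQ : 0 < Q) (hR : (R : ℝ) ≤ √X) (hRb : R ≤ b)
    (hβ1 : ∀ l ≤ U, β l = 0) (hβ2 : ∀ l, R < l → β l = 0) :
    ‖∑ l ∈ Ioc 0 b, (β l : ℂ) * ∑ m ∈ Ioc (a / l) (b / l), (α m : ℂ) * e (f (l * m))‖ ≤
      (1 + Real.log X) * √(6 * X * D ^ 2 * bilinearBound A F X μ U Q) := by
  have hX0 : 0 < X := by linarith
  set G : ℕ → ℂ := fun l => (β l : ℂ) * ∑ m ∈ Ioc (a / l) (b / l), (α m : ℂ) * e (f (l * m))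
    with hG
  set J := Nat.log 2 R + 1 with hJ
  have hG0 : ∀ l, l ≤ U ∨ R < l → G l = 0 := by
    rintro l (h | h)
    · simp [hG, hβ1 l h]
    · simp [hG, hβ2 l h]
  have hRJ : R < 2 ^ J := Nat.lt_pow_succ_log_self (by norm_num) R
  have h1 : ∑ l ∈ Ioc 0 b, G l = ∑ l ∈ Ico (U + 1) (2 ^ J * (U + 1)), G l := by
    have h2 : ∀ s : Finset ℕ, Ioc U R ⊆ s → ∑ l ∈ s, G l = ∑ l ∈ Ioc U R, G l := by
      intro s hs
      symm
      refine sum_subset hs fun l _ hl => hG0 l ?_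
      rw [mem_Ioc] at hl; omega
    rw [h2, h2 (Ico _ _)]
    · intro l hl
      rw [mem_Ioc] at hl
      rw [mem_Ico]
      have : 2 ^ J ≤ 2 ^ J * (U + 1) := Nat.le_mul_of_pos_right _ (by omega)
      omega
    · intro l hl
      rw [mem_Ioc] at *; omega
  rw [h1, sum_Ico_two_pow_mul]
  set B := √(6 * X * D ^ 2 * bilinearBound A F X μ U Q) with hB
  have hblock : ∀ j ∈ range J, ‖∑ l ∈ Ico (2 ^ j * (U + 1)) (2 * (2 ^ j * (U + 1))), G l‖ ≤ B := by
    intro j _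
    set L := 2 ^ j * (U + 1) with hL
    have hUL : U + 1 ≤ L := Nat.le_mul_of_pos_left _ (by positivity)
    by_cases hLR : R < L
    · rw [sum_eq_zero]
      · simp [hB]
      · intro l hl
        rw [mem_Ico] at hl
        exact hG0 l (Or.inr (by omega))
    · push Not at hLR
      have hLR' : (L : ℝ) ≤ √X := le_trans (by exact_mod_cast hLR) hR
      have hsq : √X * √X = X := Real.mul_self_sqrt hX0.le
      have h2s : 2 ≤ √X := Real.le_sqrt_of_sq_le (by linarith)
      have hLX : (2 * L : ℝ) ≤ X := by nlinarith
      have hL0 : (0 : ℝ) < L := by exact_mod_cast (by omega : 0 < L)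
      have hQ0 : (0 : ℝ) < Q := by exact_mod_cast hQ
      have hU0 : (0 : ℝ) < U := by exact_mod_cast hU
      have hm : 0 < min L Q := lt_min (by omega) hQ
      have key := norm_bilinear_dyadic_sq_le hA hF hX0 hμ hμ1 hf ha hb hD hα hβ hm
        (min_le_left L Q) hLX
      rw [hB]
      apply Real.le_sqrt_of_sq_le
      refine key.trans ?_
      gcongr
      rw [bilinearBound]
      have hm1 : ((min L Q : ℕ) : ℝ) ≤ Q := by exact_mod_cast min_le_right L Q
      have t1 : X / ((min L Q : ℕ) : ℝ) ≤ X / U + X / Q := by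
        rcases min_choice L Q with h | h <;> rw [h]
        · have : X / L ≤ X / U := by
            gcongr; exact (by omega : U ≤ L)
          have : 0 < X / Q := by positivity
          linarith
        · have : 0 < X / U := by positivity
          linarith
      have t2 : √(F * ((min L Q : ℕ) : ℝ) * L) ≤ √(F * Q * √X) := by gcongr
      have t3 : X * √(L / (F * ((min L Q : ℕ) : ℝ))) ≤ X / √F + X * √(√X / (F * Q)) := by
        rcases min_choice L Q with h | h <;> rw [h]
        · have : X * √(L / (F * L)) = X / √F := by
            rw [div_mul_cancel_right₀ hL0.ne', Real.sqrt_inv]; rfl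
          rw [this]
          have : 0 ≤ X * √(√X / (F * Q)) := by positivity
          linarith
        · have h1 : 0 ≤ X / √F := by positivity
          have : X * √(L / (F * Q)) ≤ X * √(√X / (F * Q)) := by gcongr
          linarith
      have t4 : 0 ≤ 104 * A / μ := by positivity
      have t5 := mul_le_mul_of_nonneg_left (add_le_add t2 t3) t4
      rw [← add_assoc] at t5
      linarith
  refine (norm_sum_le_of_le _ hblock).trans ?_
  rw [sum_const, card_range, nsmul_eq_mul]
  have hB0 : 0 ≤ B := Real.sqrt_nonneg _
  have := log_two_add_one_le (by linarith : 1 ≤ X) hR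
  gcongr

/-- Sums of `α * β` against a phase, for `α` and `β` supported beyond `U`. -/
lemma norm_sum_mul_phase_le {f : ℝ → ℝ} {A F X μ D : ℝ} (hA : 1 ≤ A) (hF : 0 < F)
    (hX : 4 ≤ X) (hμ : 0 < μ) (hμ1 : μ ≤ 1) (hf : IsPhase f A F X (μ * X) X) {a b : ℕ}
    (ha : μ * X ≤ a + 1) (hb : (b : ℝ) ≤ X) (hD : 0 ≤ D) {α β : ArithmeticFunction ℝ}
    (hα : ∀ N : ℕ, (N : ℝ) ≤ X → ∑ n ∈ Ioc 0 N, α n ^ 2 ≤ N * D)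
    (hβ : ∀ N : ℕ, (N : ℝ) ≤ X → ∑ n ∈ Ioc 0 N, β n ^ 2 ≤ N * D)
    {U Q : ℕ} (hU : 0 < U) (hQ : 0 < Q)
    (hα1 : ∀ l ≤ U, α l = 0) (hβ1 : ∀ l ≤ U, β l = 0) :
    ‖∑ n ∈ Ioc a b, ((α * β) n : ℂ) * e (f n)‖ ≤
      2 * ((1 + Real.log X) * √(6 * X * D ^ 2 * bilinearBound A F X μ U Q)) := by
  set R := Nat.sqrt b with hR
  have hRX : (R : ℝ) ≤ √X := by
    apply Real.le_sqrt_of_sq_le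
    refine le_trans ?_ hb
    exact_mod_cast Nat.sqrt_le' b
  have hRb : R ≤ b := Nat.sqrt_le_self b
  have hsplit : α * β = truncate β R * α + α * (β - truncate β R) := by ring
  have hle : ∀ n, truncate β R n ^ 2 ≤ β n ^ 2 := by
    intro n; rw [truncate_apply]; split_ifs <;> simp [sq_nonneg]
  have hle' : ∀ n, (β - truncate β R) n ^ 2 ≤ β n ^ 2 := by
    intro n; rw [sub_truncate_apply]; split_ifs <;> simp [sq_nonneg]
  have hleα : ∀ n, truncate α R n ^ 2 ≤ α n ^ 2 := by
    intro n; rw [truncate_apply]; split_ifs <;> simp [sq_nonneg]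
  have h1 : ‖∑ n ∈ Ioc a b, ((truncate β R * α) n : ℂ) * e (f n)‖ ≤
      (1 + Real.log X) * √(6 * X * D ^ 2 * bilinearBound A F X μ U Q) := by
    rw [sum_Ioc_mul_apply _ _ (fun n => e (f n))]
    have := norm_bilinear_le_of_support hA hF hX hμ hμ1 hf ha hb hD (α := α) (β := truncate β R)
      hα (fun N hN => (sum_le_sum fun n _ => hle n).trans (hβ N hN)) hU hQ hRX hRb
      (fun l hl => by simp [truncate_apply, hβ1 l hl])
      (fun l hl => by rw [truncate_apply, if_neg (by omega)])
    push_cast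
    exact this
  have h2 : ‖∑ n ∈ Ioc a b, ((α * (β - truncate β R)) n : ℂ) * e (f n)‖ ≤
      (1 + Real.log X) * √(6 * X * D ^ 2 * bilinearBound A F X μ U Q) := by
    rw [sum_Ioc_mul_apply _ _ (fun n => e (f n))]
    have := norm_bilinear_le_of_support hA hF hX hμ hμ1 hf ha hb hD (α := (β - truncate β R))
      (β := truncate α R) (fun N hN => (sum_le_sum fun n _ => hle' n).trans (hβ N hN))
      (fun N hN => (sum_le_sum fun n _ => hleα n).trans (hα N hN)) hU hQ hRX hRb
      (fun l hl => by simp [truncate_apply, hα1 l hl])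
      (fun l hl => by rw [truncate_apply, if_neg (by omega)])
    refine le_trans (le_of_eq ?_) this
    congr 1
    refine sum_congr rfl fun m hm => ?_
    rw [mem_Ioc] at hm
    by_cases hmR : m ≤ R
    · rw [truncate_apply, if_pos hmR]; push_cast; rfl
    · have hz : ∀ l ∈ Ioc (a / m) (b / m), (β - truncate β R) l = 0 := by
        intro l hl
        rw [mem_Ioc, Nat.le_div_iff_mul_le hm.1] at hl
        rw [sub_truncate_apply, if_pos]
        by_contra h
        push Not at h hmR
        have := Nat.lt_succ_sqrt b
        have h3 : (R + 1) * (R + 1) ≤ l * m := Nat.mul_le_mul h hmR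
        simp only [← hR, Nat.succ_eq_add_one] at this
        omega
      rw [truncate_apply, if_neg hmR, sum_eq_zero]
      · simp
      · intro l hl; simp [hz l hl]
  have h3 : ∑ n ∈ Ioc a b, ((α * β) n : ℂ) * e (f n) =
      ∑ n ∈ Ioc a b, ((truncate β R * α) n : ℂ) * e (f n) +
      ∑ n ∈ Ioc a b, ((α * (β - truncate β R)) n : ℂ) * e (f n) := by
    rw [← sum_add_distrib]
    refine sum_congr rfl fun n _ => ?_
    conv_lhs => rw [hsplit]
    rw [ArithmeticFunction.add_apply]; push_cast; ring
  rw [h3, two_mul]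
  exact (norm_add_le _ _).trans (add_le_add h1 h2)

lemma norm_sum_typeI_le {f : ℝ → ℝ} {A F X μ K W : ℝ} (hA : 1 ≤ A) (hF : 0 < F)
    (hX : 1 ≤ X) (hf : IsPhase f A F X (μ * X) X) {a b V : ℕ} (hab : a ≤ b)
    (ha : μ * X ≤ a + 1) (hb : (b : ℝ) ≤ X) {c w : ℕ → ℝ} (hK : 0 ≤ K)
    (hc : ∀ m, 0 < m → m ≤ b → |c m| ≤ K) (hcV : ∀ m, V < m → c m = 0) (hw : Monotone w)
    (hw0 : ∀ n, 0 ≤ w n) (hW : w b ≤ W) :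
    ‖∑ m ∈ Ioc 0 b, (c m : ℂ) * ∑ l ∈ Ioc (a / m) (b / m), (w l : ℂ) * e (f (m * l))‖ ≤
      26 * A * (K * W) * (V * √F + (1 + Real.log X) * (X / √F)) := by
  have hX0 : 0 < X := by linarith
  have hW0 : 0 ≤ W := (hw0 b).trans hW
  have hlog : 0 ≤ Real.log X := Real.log_nonneg hX
  have hterm : ∀ m ∈ Ioc 0 b,
      ‖(c m : ℂ) * ∑ l ∈ Ioc (a / m) (b / m), (w l : ℂ) * e (f (m * l))‖ ≤
      26 * A * (K * W) * ((if m ≤ V then √F else 0) + X / √F * (m : ℝ)⁻¹) := by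
    intro m hm
    rw [mem_Ioc] at hm
    by_cases hV : m ≤ V
    · rw [if_pos hV, norm_mul, Complex.norm_real, Real.norm_eq_abs]
      have hin : ∀ k, a / m ≤ k → k ≤ b / m → ‖∑ n ∈ Ioc (a / m) k, e (f (m * n))‖ ≤
          13 * A * (√F + X / √F * (m : ℝ)⁻¹) := by
        intro k _ hk
        refine norm_sum_phase_le hA hF hX0 hf le_rfl hm.1 fun n h1 h2 => ?_
        replace h2 := h2.trans hk
        rw [Nat.div_lt_iff_lt_mul hm.1] at h1
        rw [Nat.le_div_iff_mul_le hm.1] at h2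
        have h3 : (a : ℝ) + 1 ≤ n * m := by exact_mod_cast h1
        have h4 : (n : ℝ) * m ≤ b := by exact_mod_cast h2
        constructor <;> linarith
      have h1 := norm_sum_mul_le_of_monotone (Nat.div_le_div_right hab) (hw0 _)
        (fun n _ _ => hw n.le_succ) hin
      calc _ ≤ K * (2 * W * (13 * A * (√F + X / √F * (m : ℝ)⁻¹))) := by
            refine mul_le_mul (hc m hm.1 hm.2) (h1.trans ?_) (norm_nonneg _) hK
            have h2 : w (b / m) ≤ W := (hw (Nat.div_le_self b m)).trans hW
            gcongr
        _ = _ := by ring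
    · rw [if_neg hV, hcV m (by omega)]
      simp only [Complex.ofReal_zero, zero_mul, norm_zero]
      positivity
  refine (norm_sum_le_of_le _ hterm).trans ?_
  rw [← mul_sum, sum_add_distrib, ← mul_sum, ← sum_filter, sum_const, nsmul_eq_mul, mul_comm
    (1 + Real.log X)]
  have h1 : (((Ioc 0 b).filter (fun m => m ≤ V)).card : ℝ) ≤ V := by
    have h2 : (Ioc 0 b).filter (fun m => m ≤ V) ⊆ Ioc 0 V := by
      intro m hm; simp only [mem_filter, mem_Ioc] at *; omega
    have := card_le_card h2
    rw [Nat.card_Ioc, Nat.sub_zero] at this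
    exact_mod_cast this
  have h2 : ∑ m ∈ Ioc 0 b, (m : ℝ)⁻¹ ≤ 1 + Real.log X := by
    refine (sum_inv_le b).trans ?_
    rcases Nat.eq_zero_or_pos b with rfl | hb0
    · simpa using hlog
    · have : (0 : ℝ) < b := by exact_mod_cast hb0
      gcongr
  gcongr

/-- Exponential sums over primes for a phase of size `F`. -/
theorem norm_sum_vonMangoldt_phase_le {f : ℝ → ℝ} {A F X μ : ℝ} (hA : 1 ≤ A) (hF : 0 < F)
    (hX : 4 ≤ X) (hμ : 0 < μ) (hμ1 : μ ≤ 1) (hf : IsPhase f A F X (μ * X) X) {a b U Q : ℕ}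
    (hab : a ≤ b) (ha : μ * X ≤ a + 1) (hb : (b : ℝ) ≤ X) (hU : 0 < U) (hUa : U ≤ a)
    (hQ : 0 < Q) :
    ‖∑ n ∈ Ioc a b, (ArithmeticFunction.vonMangoldt n : ℂ) * e (f n)‖ ≤
      52 * A * (1 + Real.log X) ^ 3 * (U ^ 2 * √F + X / √F) +
      2 * (1 + Real.log X) ^ 4 * √(6 * X * bilinearBound A F X μ U Q) := by
  set ℓ := 1 + Real.log X with hℓ
  have hX1 : 1 ≤ X := by linarith
  have hX0 : 0 < X := by linarith
  have hlog : 0 ≤ Real.log X := Real.log_nonneg hX1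
  have hℓ1 : 1 ≤ ℓ := by rw [hℓ]; linarith
  have hlogle : ∀ n : ℕ, (n : ℝ) ≤ X → Real.log n ≤ ℓ := by
    intro n hn
    rcases Nat.eq_zero_or_pos n with rfl | h
    · simp; linarith
    · have := Real.log_le_log (by exact_mod_cast h) hn
      linarith
  set M : ArithmeticFunction ℝ := (ArithmeticFunction.moebius : ArithmeticFunction ℝ) with hM
  set Lam := ArithmeticFunction.vonMangoldt with hLam
  set Z : ArithmeticFunction ℝ := (ArithmeticFunction.zeta : ArithmeticFunction ℝ) with hZ
  have h1 : ‖∑ n ∈ Ioc a b, ((truncate M U * ArithmeticFunction.log) n : ℂ) * e (f n)‖ ≤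
      26 * A * (1 * ℓ) * ((U : ℕ) * √F + ℓ * (X / √F)) := by
    rw [sum_Ioc_mul_apply _ _ (fun n => e (f n))]
    have := norm_sum_typeI_le hA hF hX1 hf hab ha hb (c := truncate M U)
      (w := ArithmeticFunction.log) (K := 1) (W := ℓ) (V := U) zero_le_one
      (fun m _ _ => abs_truncate_moebius_le U m)
      (fun m hm => by rw [truncate_apply, if_neg (by omega)]) ?_ ?_ ?_
    · push_cast
      exact this
    · intro m n hmn
      simp only [ArithmeticFunction.log_apply]
      rcases Nat.eq_zero_or_pos m with rfl | h
      · simpa using Real.log_natCast_nonneg n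
      · exact Real.log_le_log (by exact_mod_cast h) (by exact_mod_cast hmn)
    · intro n; simpa using Real.log_natCast_nonneg n
    · simpa using hlogle b hb
  have h2 : ‖∑ n ∈ Ioc a b, ((truncate M U * truncate Lam U * Z) n : ℂ) * e (f n)‖ ≤
      26 * A * (ℓ * 1) * ((U * U : ℕ) * √F + ℓ * (X / √F)) := by
    rw [sum_Ioc_mul_apply _ _ (fun n => e (f n))]
    have := norm_sum_typeI_le hA hF hX1 hf hab ha hb (c := ⇑(truncate M U * truncate Lam U))
      (w := Z) (K := ℓ) (W := 1) (V := U * U) (by linarith)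
      (fun m _ hm => (abs_truncate_mul_truncate_le U m).trans
        (hlogle m (le_trans (by exact_mod_cast hm) hb)))
      (fun m hm => truncate_mul_truncate_eq_zero _ _ hm) ?_ ?_ ?_
    · push_cast at this ⊢
      exact this
    · intro m n hmn
      simp only [hZ, ArithmeticFunction.natCoe_apply, ArithmeticFunction.zeta_apply]
      by_cases hm : m = 0
      · rw [if_pos hm, Nat.cast_zero]; exact Nat.cast_nonneg _
      · rw [if_neg hm, if_neg (by omega)]
    · intro n; simp only [hZ, ArithmeticFunction.natCoe_apply]; positivity
    · simp only [hZ, ArithmeticFunction.natCoe_apply, ArithmeticFunction.zeta_apply]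
      split_ifs <;> simp
  have h3 : ‖∑ n ∈ Ioc a b, (((M - truncate M U) * Z * (Lam - truncate Lam U)) n : ℂ) *
      e (f n)‖ ≤ 2 * (ℓ * √(6 * X * (ℓ ^ 3) ^ 2 * bilinearBound A F X μ U Q)) := by
    refine norm_sum_mul_phase_le hA hF hX hμ hμ1 hf ha hb (by positivity) ?_ ?_ hU hQ
      (fun l hl => sub_truncate_mul_zeta_eq_zero hl)
      (fun l hl => by rw [sub_truncate_apply, if_pos hl])
    · intro N hN
      calc _ ≤ ∑ n ∈ Ioc 0 N, (n.divisors.card : ℝ) ^ 2 := by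
            refine sum_le_sum fun n _ => ?_
            exact sq_le_sq' (by have := abs_le.mp (abs_sub_truncate_mul_zeta_le U n); linarith)
              (le_of_abs_le (abs_sub_truncate_mul_zeta_le U n))
        _ ≤ N * (1 + Real.log N) ^ 3 := sum_card_divisors_sq_le N
        _ ≤ _ := by
            have h0 := Real.log_natCast_nonneg N
            rcases Nat.eq_zero_or_pos N with rfl | hN0
            · simp
            · have : (0 : ℝ) < N := by exact_mod_cast hN0
              have h4 : 1 + Real.log N ≤ ℓ := by rw [hℓ]; gcongr
              gcongr
    · intro N hN
      calc _ ≤ ∑ n ∈ Ioc 0 N, ℓ ^ 3 := by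
            refine sum_le_sum fun n hn => ?_
            rw [mem_Ioc] at hn
            have hnN : (n : ℝ) ≤ N := by exact_mod_cast hn.2
            have h4 : (Lam - truncate Lam U) n ≤ ℓ := by
              rw [sub_truncate_apply]
              split_ifs
              · linarith
              · exact (ArithmeticFunction.vonMangoldt_le_log).trans (hlogle n (hnN.trans hN))
            have h5 : 0 ≤ (Lam - truncate Lam U) n := by
              rw [sub_truncate_apply]
              split_ifs
              · exact le_rfl
              · exact ArithmeticFunction.vonMangoldt_nonneg
            calc _ ≤ ℓ ^ 2 := by gcongr
              _ ≤ _ := pow_le_pow_right₀ hℓ1 (by norm_num)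
        _ = _ := by simp
  have hsum : ∑ n ∈ Ioc a b, (Lam n : ℂ) * e (f n) =
      ∑ n ∈ Ioc a b, ((truncate M U * ArithmeticFunction.log) n : ℂ) * e (f n) -
      ∑ n ∈ Ioc a b, ((truncate M U * truncate Lam U * Z) n : ℂ) * e (f n) +
      ∑ n ∈ Ioc a b, (((M - truncate M U) * Z * (Lam - truncate Lam U)) n : ℂ) * e (f n) := by
    rw [← sum_sub_distrib, ← sum_add_distrib]
    refine sum_congr rfl fun n hn => ?_
    rw [mem_Ioc] at hn
    have h4 := congrArg (fun g : ArithmeticFunction ℝ => g n) (vaughan U)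
    simp only [sub_eq_add_neg, ArithmeticFunction.add_apply] at h4
    have h5 : truncate Lam U n = 0 := by rw [truncate_apply, if_neg (by omega)]
    have h6 : ∀ g : ArithmeticFunction ℝ, (-g) n = - g n := fun g => rfl
    rw [h5, h6, zero_add] at h4
    simp only [sub_eq_add_neg]
    rw [hLam, h4]
    push_cast
    ring
  rw [hsum]
  refine (norm_add_le_of_le (norm_sub_le_of_le h1 h2) h3).trans ?_
  have hU1 : (1 : ℝ) ≤ U := by exact_mod_cast hU
  have e3 : 2 * (ℓ * √(6 * X * (ℓ ^ 3) ^ 2 * bilinearBound A F X μ U Q)) =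
      2 * ℓ ^ 4 * √(6 * X * bilinearBound A F X μ U Q) := by
    rw [show 6 * X * (ℓ ^ 3) ^ 2 * bilinearBound A F X μ U Q =
      (ℓ ^ 3) ^ 2 * (6 * X * bilinearBound A F X μ U Q) by ring, Real.sqrt_mul (by positivity),
      Real.sqrt_sq (by positivity)]
    ring
  rw [e3]
  gcongr ?_ + _
  push_cast
  set s := √F
  have hs : 0 < s := Real.sqrt_pos.mpr hF
  have hY : 0 ≤ X / s := by positivity
  have hU2 : (U : ℝ) ≤ U ^ 2 := by nlinarith
  have i1 : (U : ℝ) * s + ℓ * (X / s) ≤ ℓ * (U ^ 2 * s + X / s) := by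
    have h7 : (U : ℝ) * s ≤ U ^ 2 * s := by gcongr
    have h8 : (U : ℝ) ^ 2 * s ≤ ℓ * (U ^ 2 * s) := le_mul_of_one_le_left (by positivity) hℓ1
    linarith
  have i2 : (U * U : ℝ) * s + ℓ * (X / s) ≤ ℓ * (U ^ 2 * s + X / s) := by
    have h8 : (U : ℝ) ^ 2 * s ≤ ℓ * (U ^ 2 * s) := le_mul_of_one_le_left (by positivity) hℓ1
    linarith
  have hC : 0 ≤ 26 * A * ℓ := by positivity
  have j1 := mul_le_mul_of_nonneg_left i1 hC
  have j2 := mul_le_mul_of_nonneg_left i2 hC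
  have hT : 0 ≤ 52 * A * ℓ ^ 2 * (U ^ 2 * s + X / s) := by positivity
  have j3 : 52 * A * ℓ ^ 2 * (U ^ 2 * s + X / s) ≤ 52 * A * ℓ ^ 3 * (U ^ 2 * s + X / s) := by
    have : ℓ ^ 2 ≤ ℓ ^ 3 := pow_le_pow_right₀ hℓ1 (by norm_num)
    gcongr
  nlinarith

/-- The sawtooth function. -/
noncomputable def saw (x : ℝ) : ℝ := Int.fract x - 1 / 2

/-- Half of the second periodic Bernoulli function, an antiderivative of `saw`. -/
noncomputable def halfBernoulli (x : ℝ) : ℝ := (Int.fract x ^ 2 - Int.fract x + 6⁻¹) / 2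

/-- The average of `saw` over `[x, x + Δ]`. -/
noncomputable def smoothSaw (Δ x : ℝ) : ℝ := (halfBernoulli (x + Δ) - halfBernoulli x) / Δ

lemma fract_add_of_lt {x Δ : ℝ} (hΔ : 0 ≤ Δ) (h : Int.fract x + Δ < 1) :
    Int.fract (x + Δ) = Int.fract x + Δ := by
  rw [Int.fract_eq_iff]
  refine ⟨by have := Int.fract_nonneg x; linarith, h, ⌊x⌋, ?_⟩
  have := Int.fract_add_floor x; linarith

lemma fract_add_of_le {x Δ : ℝ} (hΔ : Δ ≤ 1) (h : 1 ≤ Int.fract x + Δ) :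
    Int.fract (x + Δ) = Int.fract x + Δ - 1 := by
  rw [Int.fract_eq_iff]
  refine ⟨by linarith, by have := Int.fract_lt_one x; linarith, ⌊x⌋ + 1, ?_⟩
  have := Int.fract_add_floor x; push_cast; linarith

lemma smoothSaw_le {Δ : ℝ} (h0 : 0 < Δ) (h1 : Δ ≤ 1) (x : ℝ) :
    smoothSaw Δ x ≤ saw x + Δ := by
  rw [smoothSaw, div_le_iff₀ h0, saw, halfBernoulli, halfBernoulli]
  have h2 := Int.fract_nonneg x
  rcases lt_or_ge (Int.fract x + Δ) 1 with h | h
  · rw [fract_add_of_lt h0.le h]; nlinarith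
  · rw [fract_add_of_le h1 h]; nlinarith

lemma saw_le_smoothSaw {Δ : ℝ} (h0 : 0 < Δ) (h1 : Δ ≤ 1) (x : ℝ) :
    saw x ≤ smoothSaw Δ (x - Δ) + Δ := by
  rw [← sub_le_iff_le_add, smoothSaw, le_div_iff₀ h0, sub_add_cancel]
  set y := x - Δ with hy
  have hx : x = y + Δ := by rw [hy]; ring
  rw [hx, saw, halfBernoulli, halfBernoulli]
  have h2 := Int.fract_nonneg y
  have h3 := Int.fract_lt_one y
  rcases lt_or_ge (Int.fract y + Δ) 1 with h | h
  · rw [fract_add_of_lt h0.le h]; nlinarith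
  · rw [fract_add_of_le h1 h]; nlinarith

lemma two_mul_cos_eq (x : ℝ) : ((2 * Real.cos (2 * Real.pi * x) : ℝ) : ℂ) = e x + e (-x) := by
  rw [e_eq, e_eq]
  push_cast
  rw [Complex.two_cos]
  congr 2; ring

lemma hasSum_halfBernoulli (x : ℝ) :
    HasSum (fun h : ℕ => ((1 / (4 * Real.pi ^ 2 * h ^ 2) : ℝ) : ℂ) * (e (h * x) + e (-(h * x))))
      (halfBernoulli x : ℂ) := by
  have h := hasSum_one_div_nat_pow_mul_cos one_ne_zero (x := Int.fract x)
    ⟨Int.fract_nonneg x, (Int.fract_lt_one x).le⟩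
  have hB : Polynomial.eval (Int.fract x)
      (Polynomial.map (algebraMap ℚ ℝ) (Polynomial.bernoulli (2 * 1))) =
      Int.fract x ^ 2 - Int.fract x + 6⁻¹ := bernoulliFun_two _
  rw [hB] at h
  have h2 := h.mul_left (1 / (2 * Real.pi ^ 2))
  have h3 := (Complex.hasSum_ofReal).mpr h2
  convert h3 using 1
  · funext n
    have hper : e (n * x) = e (n * Int.fract x) := by
      have : (n * x : ℝ) = n * Int.fract x + ((n * ⌊x⌋ : ℤ) : ℝ) := by
        have := Int.fract_add_floor x; push_cast; rw [← mul_add, this]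
      rw [this, e_add_int]
    rw [e_neg, hper, ← e_neg, ← two_mul_cos_eq, ← Complex.ofReal_mul]
    congr 1
    rw [show 2 * Real.pi * (n * Int.fract x) = 2 * Real.pi * n * Int.fract x by ring]
    rcases Nat.eq_zero_or_pos n with rfl | hn
    · simp
    · have : (n : ℝ) ≠ 0 := by positivity
      field_simp
      ring
  · rw [halfBernoulli]
    congr 1
    have : (Real.pi : ℝ) ≠ 0 := Real.pi_ne_zero
    have h2 : ((2 * 1).factorial : ℝ) = 2 := by norm_num
    rw [h2]
    field_simp
    ring

lemma hasSum_smoothSaw {ι : Type*} (s : Finset ι) (z : ι → ℂ) (x : ι → ℝ) (Δ θ : ℝ) :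
    HasSum (fun h : ℕ => ((1 / (4 * Real.pi ^ 2 * h ^ 2 * Δ) : ℝ) : ℂ) *
      ((e (h * Δ) - 1) * e (h * θ) * ∑ n ∈ s, z n * e (h * x n) +
       (e (-(h * Δ)) - 1) * e (-(h * θ)) * ∑ n ∈ s, z n * e (-(h * x n))))
      (∑ n ∈ s, z n * (smoothSaw Δ (x n + θ) : ℂ)) := by
  have key : ∀ n ∈ s, HasSum (fun h : ℕ => z n * (((1 / (4 * Real.pi ^ 2 * h ^ 2 * Δ) : ℝ) : ℂ) *
      ((e (h * Δ) - 1) * e (h * θ) * e (h * x n) +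
       (e (-(h * Δ)) - 1) * e (-(h * θ)) * e (-(h * x n)))))
      (z n * (smoothSaw Δ (x n + θ) : ℂ)) := by
    intro n _
    have h := ((hasSum_halfBernoulli (x n + θ + Δ)).sub (hasSum_halfBernoulli (x n + θ))).mul_left
      ((Δ⁻¹ : ℝ) : ℂ)
    have h' := h.mul_left (z n)
    convert h' using 1
    · rfl
    · funext k
      congr 1
      have e1 : e (k * (x n + θ + Δ)) = e (k * x n) * e (k * θ) * e (k * Δ) := by
        rw [← e_add, ← e_add]; congr 1; ring
      have e2 : e (-(k * (x n + θ + Δ))) = e (-(k * x n)) * e (-(k * θ)) * e (-(k * Δ)) := by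
        rw [← e_add, ← e_add]; congr 1; ring
      have e3 : e (k * (x n + θ)) = e (k * x n) * e (k * θ) := by
        rw [← e_add]; congr 1; ring
      have e4 : e (-(k * (x n + θ))) = e (-(k * x n)) * e (-(k * θ)) := by
        rw [← e_add]; congr 1; ring
      rw [e1, e2, e3, e4]
      have : (1 / (4 * Real.pi ^ 2 * k ^ 2 * Δ) : ℝ) = Δ⁻¹ * (1 / (4 * Real.pi ^ 2 * k ^ 2)) := by
        rw [one_div, mul_inv, one_div]; ring
      rw [this]
      push_cast
      ring
    · rw [smoothSaw]; push_cast; ring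
  convert hasSum_sum key using 1
  funext h
  simp_rw [mul_sum, ← sum_add_distrib, mul_sum]
  refine sum_congr rfl fun n _ => by ring

lemma norm_e_sub_one_le (x : ℝ) : ‖e x - 1‖ ≤ 2 * Real.pi * |x| := by
  rw [e_eq, mul_comm]
  refine Real.norm_exp_I_mul_ofReal_sub_one_le.trans ?_
  rw [Real.norm_eq_abs, abs_mul, abs_of_pos (by positivity)]

lemma norm_e_sub_one_le_two (x : ℝ) : ‖e x - 1‖ ≤ 2 :=
  (norm_sub_le _ _).trans (by rw [norm_e, norm_one]; norm_num)

/-- Fourier expansion bound for sums weighted by the smoothed sawtooth. -/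
lemma norm_sum_smoothSaw_le {ι : Type*} (s : Finset ι) (z : ι → ℂ) (x : ι → ℝ) {Δ B T : ℝ}
    (hΔ : 0 < Δ) (θ : ℝ) {H : ℕ} (hH : 0 < H) (hB : 0 ≤ B) (hT : 0 ≤ T)
    (h1 : ∀ h : ℕ, 0 < h → h ≤ H → ‖∑ n ∈ s, z n * e (h * x n)‖ ≤ B * (1 + √(h * Δ)))
    (h2 : ∀ h : ℕ, 0 < h → h ≤ H → ‖∑ n ∈ s, z n * e (-(h * x n))‖ ≤ B * (1 + √(h * Δ)))
    (h3 : ∑ n ∈ s, ‖z n‖ ≤ T) :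
    ‖∑ n ∈ s, z n * (smoothSaw Δ (x n + θ) : ℂ)‖ ≤
      2 * B * (1 + Real.log H) + T / (H * Δ) := by
  have hpi := Real.pi_gt_three
  have hS : ∀ y : ι → ℝ, ‖∑ n ∈ s, z n * e (y n)‖ ≤ T := by
    intro y
    refine (norm_sum_le _ _).trans ((sum_le_sum fun n _ => ?_).trans h3)
    rw [norm_mul, norm_e, mul_one]
  set cf : ℕ → ℝ := fun h => 1 / (4 * Real.pi ^ 2 * h ^ 2 * Δ) with hcf
  have hgen : ∀ (h : ℕ) (C : ℝ), ‖∑ n ∈ s, z n * e (h * x n)‖ ≤ C →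
      ‖∑ n ∈ s, z n * e (-(h * x n))‖ ≤ C → ∀ w : ℝ, ‖e (h * Δ) - 1‖ ≤ w →
      ‖e (-(h * Δ)) - 1‖ ≤ w →
      ‖((cf h : ℝ) : ℂ) *
      ((e (h * Δ) - 1) * e (h * θ) * ∑ n ∈ s, z n * e (h * x n) +
       (e (-(h * Δ)) - 1) * e (-(h * θ)) * ∑ n ∈ s, z n * e (-(h * x n)))‖ ≤ 2 * (cf h * w * C) := by
    intro h C hC1 hC2 w hw1 hw2
    have hw0 : 0 ≤ w := (norm_nonneg _).trans hw1
    have hcf0 : 0 ≤ cf h := by positivity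
    rw [norm_mul, Complex.norm_real, Real.norm_of_nonneg hcf0]
    have i1 : ‖(e (h * Δ) - 1) * e (h * θ) * ∑ n ∈ s, z n * e (h * x n)‖ ≤ w * C := by
      rw [norm_mul, norm_mul, norm_e, mul_one]; gcongr
    have i2 : ‖(e (-(h * Δ)) - 1) * e (-(h * θ)) * ∑ n ∈ s, z n * e (-(h * x n))‖ ≤ w * C := by
      rw [norm_mul, norm_mul, norm_e, mul_one]; gcongr
    calc _ ≤ cf h * (w * C + w * C) := by
          gcongr; exact norm_add_le_of_le i1 i2
      _ = _ := by ring
  set g : ℕ → ℝ := fun h => (if h ∈ Ioc 0 H then 2 * B * (h : ℝ)⁻¹ else 0) +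
    (if H < h then T / Δ * ((h : ℝ) ^ 2)⁻¹ else 0) with hg
  have hterm : ∀ h : ℕ, ‖((cf h : ℝ) : ℂ) *
      ((e (h * Δ) - 1) * e (h * θ) * ∑ n ∈ s, z n * e (h * x n) +
       (e (-(h * Δ)) - 1) * e (-(h * θ)) * ∑ n ∈ s, z n * e (-(h * x n)))‖ ≤ g h := by
    intro h
    rcases Nat.eq_zero_or_pos h with rfl | hpos
    · simp [hcf, hg]
    have hh : (0 : ℝ) < h := by exact_mod_cast hpos
    by_cases hhH : h ≤ H
    · simp only [hg, mem_Ioc, hpos, hhH, and_self, if_true, if_neg (not_lt.mpr hhH), add_zero]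
      rcases le_or_gt (h * Δ) 1 with hs | hs
      · have hw1 := norm_e_sub_one_le (h * Δ)
        have hw2 := norm_e_sub_one_le (-(h * Δ))
        rw [abs_neg] at hw2
        rw [abs_of_pos (by positivity)] at hw1 hw2
        refine (hgen h _ (h1 h hpos hhH) (h2 h hpos hhH) _ hw1 hw2).trans ?_
        have hs1 : √(h * Δ) ≤ 1 := Real.sqrt_le_one.mpr hs
        calc _ ≤ 2 * (cf h * (2 * Real.pi * (h * Δ)) * (B * (1 + 1))) := by gcongr
          _ = 2 * B * (h : ℝ)⁻¹ * (1 / Real.pi) := by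
              simp only [hcf]; field_simp; ring
          _ ≤ 2 * B * (h : ℝ)⁻¹ * 1 := by
              gcongr
              rw [div_le_one (by positivity)]; linarith
          _ = _ := mul_one _
      · refine (hgen h _ (h1 h hpos hhH) (h2 h hpos hhH) 2 (norm_e_sub_one_le_two _)
          (norm_e_sub_one_le_two _)).trans ?_
        have hs1 : 1 + √(h * Δ) ≤ 2 * (h * Δ) := by
          have : √(h * Δ) ≤ h * Δ := by
            rw [Real.sqrt_le_left (by positivity)]; nlinarith
          linarith
        calc _ ≤ 2 * (cf h * 2 * (B * (2 * (h * Δ)))) := by gcongr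
          _ = 2 * B * (h : ℝ)⁻¹ * (1 / Real.pi ^ 2) := by
              simp only [hcf]; field_simp; ring
          _ ≤ 2 * B * (h : ℝ)⁻¹ * 1 := by
              gcongr
              rw [div_le_one (by positivity)]; nlinarith
          _ = _ := mul_one _
    · have hlt : H < h := not_le.mp hhH
      simp only [hg, mem_Ioc, hhH, and_false, if_false, if_pos hlt, zero_add]
      refine (hgen h T (hS _) (hS _) 2 (norm_e_sub_one_le_two _)
          (norm_e_sub_one_le_two _)).trans ?_
      calc _ = T / Δ * ((h : ℝ) ^ 2)⁻¹ * (1 / Real.pi ^ 2) := by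
            simp only [hcf]; field_simp; ring
        _ ≤ T / Δ * ((h : ℝ) ^ 2)⁻¹ * 1 := by
            gcongr
            rw [div_le_one (by positivity)]; nlinarith
        _ = _ := mul_one _
  refine le_of_tendsto (hasSum_smoothSaw s z x Δ θ).tendsto_sum_nat.norm
    (Filter.Eventually.of_forall fun N => ?_)
  refine (norm_sum_le_of_le _ fun h _ => hterm h).trans ?_
  simp only [hg]
  rw [sum_add_distrib]
  gcongr ?_ + ?_
  · rw [← sum_filter]
    calc _ ≤ ∑ h ∈ Ioc 0 H, 2 * B * (h : ℝ)⁻¹ := by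
          apply sum_le_sum_of_subset_of_nonneg
          · intro h hh; exact (mem_filter.mp hh).2
          · intros; positivity
      _ ≤ _ := by rw [← mul_sum]; gcongr; exact sum_inv_le H
  · rw [← sum_filter]
    calc _ ≤ ∑ h ∈ Ioc H (max H N), T / Δ * ((h : ℝ) ^ 2)⁻¹ := by
          apply sum_le_sum_of_subset_of_nonneg
          · intro h hh
            simp only [mem_filter, mem_range] at hh
            rw [mem_Ioc]
            exact ⟨hh.2, le_max_of_le_right hh.1.le⟩
          · intros; positivity
      _ ≤ T / Δ * ((H : ℝ))⁻¹ := by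
          rw [← mul_sum]
          gcongr
          refine (sum_Ioc_inv_sq_le_sub hH.ne' (le_max_left _ _)).trans ?_
          have : (0 : ℝ) ≤ ((max H N : ℕ) : ℝ)⁻¹ := by positivity
          linarith
      _ = _ := by field_simp

/-- Sums weighted by the sawtooth, in terms of exponential sums. -/
lemma norm_sum_saw_le {ι : Type*} (s : Finset ι) (z : ι → ℂ) (x : ι → ℝ) {Δ B R N : ℝ}
    (hΔ : 0 < Δ) (hΔ1 : Δ ≤ 1) {H : ℕ} (hH : 0 < H) (hB : 0 ≤ B) (hR : 1 ≤ R)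
    (hN : (s.card : ℝ) ≤ N) (hz : ∀ n ∈ s, ‖z n‖ ≤ R)
    (h1 : ∀ h : ℕ, 0 < h → h ≤ H → ‖∑ n ∈ s, z n * e (h * x n)‖ ≤ B * (1 + √(h * Δ)))
    (h2 : ∀ h : ℕ, 0 < h → h ≤ H → ‖∑ n ∈ s, z n * e (-(h * x n))‖ ≤ B * (1 + √(h * Δ)))
    (h3 : ∀ h : ℕ, 0 < h → h ≤ H → ‖∑ n ∈ s, e (h * x n)‖ ≤ B * (1 + √(h * Δ))) :
    ‖∑ n ∈ s, z n * (saw (x n) : ℂ)‖ ≤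
      R * (6 * B * (1 + Real.log H) + 3 * N / (H * Δ) + 3 * Δ * N) := by
  have hR0 : 0 ≤ R := by linarith
  have hN0 : 0 ≤ N := (Nat.cast_nonneg _).trans hN
  set V := 2 * B * (1 + Real.log H) + N / (H * Δ) with hV
  have hV0 : 0 ≤ V := by have := Real.log_natCast_nonneg H; positivity
  have hone : ∀ θ, ‖∑ n ∈ s, (1 : ℂ) * (smoothSaw Δ (x n + θ) : ℂ)‖ ≤ V := by
    intro θ
    refine norm_sum_smoothSaw_le s (fun _ => 1) x hΔ θ hH hB hN0 ?_ ?_ ?_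
    · intro h i j; simpa using h3 h i j
    · intro h i j
      have := norm_sum_e_neg s (fun n => h * x n)
      simpa [this] using h3 h i j
    · simpa using hN
  have hone' : ∀ θ, |∑ n ∈ s, smoothSaw Δ (x n + θ)| ≤ V := by
    intro θ
    have := hone θ
    simp only [one_mul] at this
    rwa [← Complex.ofReal_sum, Complex.norm_real, Real.norm_eq_abs] at this
  have hmain := norm_sum_smoothSaw_le s z x hΔ 0 hH hB (T := R * N) (by positivity) h1 h2 (by
    refine (sum_le_card_nsmul _ _ _ hz).trans ?_
    rw [nsmul_eq_mul, mul_comm]; gcongr)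
  have hdiff : ‖∑ n ∈ s, z n * ((saw (x n) - smoothSaw Δ (x n + 0) : ℝ) : ℂ)‖ ≤
      R * (2 * V + 3 * Δ * N) := by
    calc _ ≤ ∑ n ∈ s, R * (smoothSaw Δ (x n + -Δ) - smoothSaw Δ (x n + 0) + 3 * Δ) := by
          refine norm_sum_le_of_le _ fun n hn => ?_
          rw [norm_mul, Complex.norm_real, Real.norm_eq_abs]
          refine mul_le_mul (hz n hn) ?_ (abs_nonneg _) hR0
          have i1 := smoothSaw_le hΔ hΔ1 (x n)
          have i2 := saw_le_smoothSaw hΔ hΔ1 (x n)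
          rw [add_zero, ← sub_eq_add_neg, abs_le]
          constructor <;> linarith
      _ = R * (∑ n ∈ s, smoothSaw Δ (x n + -Δ) - ∑ n ∈ s, smoothSaw Δ (x n + 0) +
          3 * Δ * s.card) := by
          rw [← mul_sum, sum_add_distrib, sum_sub_distrib, sum_const, nsmul_eq_mul]
          ring
      _ ≤ _ := by
          have i1 := (abs_le.mp (hone' (-Δ))).2
          have i2 := (abs_le.mp (hone' 0)).1
          have i3 : 3 * Δ * (s.card : ℝ) ≤ 3 * Δ * N := by gcongr
          gcongr
          linarith
  have hsplit : ∑ n ∈ s, z n * (saw (x n) : ℂ) = ∑ n ∈ s, z n * (smoothSaw Δ (x n + 0) : ℂ) +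
      ∑ n ∈ s, z n * ((saw (x n) - smoothSaw Δ (x n + 0) : ℝ) : ℂ) := by
    rw [← sum_add_distrib]
    refine sum_congr rfl fun n _ => ?_
    push_cast; ring
  rw [hsplit]
  refine (norm_add_le_of_le hmain hdiff).trans ?_
  have i1 : 2 * B * (1 + Real.log H) ≤ R * (2 * B * (1 + Real.log H)) :=
    le_mul_of_one_le_left (by have := Real.log_natCast_nonneg H; positivity) hR
  have i2 : R * N / (H * Δ) = R * (N / (H * Δ)) := by ring
  have i3 : 3 * N / (H * Δ) = 3 * (N / (H * Δ)) := by ring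
  rw [i2, i3]
  calc _ ≤ R * (2 * B * (1 + Real.log H)) + R * (N / (H * Δ)) + R * (2 * V + 3 * Δ * N) := by
        gcongr
    _ = _ := by rw [hV]; ring

lemma hasDerivAt_const_mul_add_rpow (C p j : ℝ) {u : ℝ} (hu : 0 < u + j) :
    HasDerivAt (fun u : ℝ => C * (u + j) ^ p) (C * p * (u + j) ^ (p - 1)) u := by
  have h := ((Real.hasDerivAt_rpow_const (p := p) (Or.inl hu.ne')).comp_add_const u j).const_mul C
  rw [mul_assoc]
  exact h

set_option maxHeartbeats 1000000 in
/-- The phase `t u ^ c + s h (u + j) ^ γ`, when dominated by its second term. -/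
lemma isPhase_add_rpow {μ γ c t s h j X : ℝ} (hμ : 0 < μ) (hμ1 : μ ≤ 1) (hγ1 : 11 / 12 < γ)
    (hγ2 : γ < 1) (hc1 : 1 < c) (hc3 : c < 3) (hs : s = 1 ∨ s = -1) (hh : 0 < h)
    (hj : 0 ≤ j) (hj1 : j ≤ 1) (hX : 1 ≤ μ * X)
    (ht : 18 * μ⁻¹ ^ 2 * (|t| * X ^ c) ≤ h * γ * (1 - γ) * X ^ γ / 16) :
    IsPhase (fun u => t * (u + 0) ^ c + s * h * (u + j) ^ γ) (16 * μ⁻¹ ^ 2 + 1)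
      (h * γ * (1 - γ) * X ^ γ / 8) X (μ * X) X := by
  have hX0 : 0 < X := by
    rcases le_or_gt X 0 with h0 | h0
    · nlinarith
    · exact h0
  set P := h * γ * (1 - γ) with hP
  have hP0 : 0 < P := by
    have : 0 < 1 - γ := by linarith
    positivity
  set W := P * X ^ γ with hW
  have hW0 : 0 < W := by positivity
  set f1 : ℝ → ℝ := fun u => t * c * (u + 0) ^ (c - 1) + s * h * γ * (u + j) ^ (γ - 1) with hf1
  set f2 : ℝ → ℝ := fun u => t * c * (c - 1) * (u + 0) ^ (c - 1 - 1) +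
    s * h * γ * (γ - 1) * (u + j) ^ (γ - 1 - 1) with hf2
  set k1 : ℝ → ℝ := fun u => 2 * u * f2 u + u ^ 2 * (t * c * (c - 1) * (c - 1 - 1) *
    (u + 0) ^ (c - 1 - 1 - 1) + s * h * γ * (γ - 1) * (γ - 1 - 1) * (u + j) ^ (γ - 1 - 1 - 1))
    with hk1
  have hss : s * s = 1 := by rcases hs with rfl | rfl <;> norm_num
  have hsabs : |s| = 1 := by rcases hs with rfl | rfl <;> norm_num
  refine ⟨f1, f2, k1, -s, -s, ?_, ?_, ?_⟩
  · rcases hs with rfl | rfl <;> simp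
  · rcases hs with rfl | rfl <;> simp
  rintro u ⟨hu1, hu2⟩
  have hu0 : 0 < u := by linarith
  have hu00 : 0 < u + 0 := by linarith
  have huj : 0 < u + j := by linarith
  refine ⟨(hasDerivAt_const_mul_add_rpow t c 0 hu00).add
    (hasDerivAt_const_mul_add_rpow (s * h) γ j huj),
    (hasDerivAt_const_mul_add_rpow (t * c) (c - 1) 0 hu00).add
    (hasDerivAt_const_mul_add_rpow (s * h * γ) (γ - 1) j huj), ?_, ?_⟩
  · have d1 := (hasDerivAt_const_mul_add_rpow (t * c * (c - 1)) (c - 1 - 1) 0 hu00).add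
      (hasDerivAt_const_mul_add_rpow (s * h * γ * (γ - 1)) (γ - 1 - 1) j huj)
    have d2 := (hasDerivAt_pow 2 u).mul d1
    refine d2.congr_deriv ?_
    simp only [hk1, hf2, Pi.add_apply]
    push_cast; ring
  set v := u + j with hv
  have hvu : u ≤ v := by linarith
  have hv2u : v ≤ 2 * u := by linarith
  have hv2X : v ≤ 2 * X := by linarith
  have hμv : μ * X ≤ v := by linarith
  have hv1 : 1 ≤ v := by linarith
  have hi1 : 1 ≤ μ⁻¹ := (one_le_inv₀ hμ).mpr hμ1
  have hi2 : μ⁻¹ ≤ μ⁻¹ ^ 2 := by nlinarith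
  -- size of `v ^ (γ - 1)`
  have hg1 : X ^ γ / 2 ≤ X * v ^ (γ - 1) := by
    have h1 : (2 * X) ^ (γ - 1) ≤ v ^ (γ - 1) :=
      Real.rpow_le_rpow_of_nonpos huj hv2X (by linarith)
    have h2 : (2 : ℝ)⁻¹ ≤ 2 ^ (γ - 1) := by
      rw [← Real.rpow_neg_one]
      exact Real.rpow_le_rpow_of_exponent_le (by norm_num) (by linarith)
    rw [Real.mul_rpow (by norm_num) hX0.le] at h1
    have h3 : X ^ γ = X * X ^ (γ - 1) := by
      rw [Real.rpow_sub_one hX0.ne']; field_simp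
    have h4 : 0 < X ^ (γ - 1) := by positivity
    rw [h3, mul_div_assoc]
    gcongr
    nlinarith
  have hg2 : X * v ^ (γ - 1) ≤ μ⁻¹ * X ^ γ := by
    have h1 : v ^ (γ - 1) ≤ (μ * X) ^ (γ - 1) :=
      Real.rpow_le_rpow_of_nonpos (by linarith) hμv (by linarith)
    have h2 : μ ^ (γ - 1) ≤ μ⁻¹ := by
      rw [← Real.rpow_neg_one]
      exact Real.rpow_le_rpow_of_exponent_ge hμ hμ1 (by linarith)
    rw [Real.mul_rpow hμ.le hX0.le] at h1
    have h3 : X ^ γ = X * X ^ (γ - 1) := by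
      rw [Real.rpow_sub_one hX0.ne']; field_simp
    have h4 : 0 < X ^ (γ - 1) := by positivity
    have h5 : μ ^ (γ - 1) * X ^ (γ - 1) ≤ μ⁻¹ * X ^ (γ - 1) := by gcongr
    calc _ ≤ X * (μ⁻¹ * X ^ (γ - 1)) := by gcongr; linarith
      _ = _ := by rw [h3]; ring
  have hvp : v ^ (γ - 1) = v * v ^ (γ - 1 - 1) := by
    rw [Real.rpow_sub_one huj.ne' (γ - 1)]; field_simp
  have hvp2 : v ^ (γ - 1 - 1) = v * v ^ (γ - 1 - 1 - 1) := by
    rw [Real.rpow_sub_one huj.ne' (γ - 1 - 1)]; field_simp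
  set y := v ^ (γ - 1 - 1 - 1) with hy
  have hy0 : 0 < y := by positivity
  set q := v ^ (γ - 1 - 1) with hq
  have hq0 : 0 < q := by positivity
  -- the perturbation
  have hcu : u ^ (c - 1) ≤ X ^ (c - 1) := Real.rpow_le_rpow hu0.le hu2 (by linarith)
  have hXc : X ^ c = X * X ^ (c - 1) := by rw [Real.rpow_sub_one hX0.ne']; field_simp
  have hup : u ^ (c - 1) = u * u ^ (c - 1 - 1) := by
    rw [Real.rpow_sub_one hu0.ne' (c - 1)]; field_simp
  have hup2 : u ^ (c - 1 - 1) = u * u ^ (c - 1 - 1 - 1) := by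
    rw [Real.rpow_sub_one hu0.ne' (c - 1 - 1)]; field_simp
  set r := u ^ (c - 1 - 1) with hr
  have hr0 : 0 < r := by positivity
  set T := |t| * X ^ c with hT
  have hT0 : 0 ≤ T := by positivity
  have hE2 : |t * c ^ 2 * (c - 1) * u ^ (c - 1)| * X ≤ W / 16 := by
    rw [abs_mul, abs_mul, abs_mul, abs_of_pos (by positivity : 0 < c ^ 2),
      abs_of_pos (by linarith : 0 < c - 1), abs_of_pos (by positivity : 0 < u ^ (c - 1))]
    calc _ ≤ |t| * 3 ^ 2 * 2 * X ^ (c - 1) * X := by gcongr; linarith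
      _ = 18 * T := by rw [hT, hXc]; ring
      _ ≤ 18 * μ⁻¹ ^ 2 * T := by nlinarith [mul_nonneg hT0 (by linarith : 0 ≤ μ⁻¹ ^ 2 - 1)]
      _ ≤ _ := ht
  have hE1 : |t * c * (c - 1) * r| * X ^ 2 ≤ W / 16 := by
    rw [abs_mul, abs_mul, abs_mul, abs_of_pos (by linarith : 0 < c),
      abs_of_pos (by linarith : 0 < c - 1), abs_of_pos hr0]
    have h1 : r * X ^ 2 ≤ μ⁻¹ * X ^ c := by
      have h2 : μ * X * r ≤ X ^ (c - 1) := by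
        rw [hup] at hcu
        exact le_trans (by gcongr) hcu
      rw [hXc]
      calc r * X ^ 2 = μ⁻¹ * X * (μ * X * r) := by field_simp
        _ ≤ μ⁻¹ * X * X ^ (c - 1) := by gcongr
        _ = _ := by ring
    calc |t| * c * (c - 1) * r * X ^ 2 = |t| * c * (c - 1) * (r * X ^ 2) := by ring
      _ ≤ |t| * 3 * 2 * (μ⁻¹ * X ^ c) := by gcongr; linarith
      _ = 6 * μ⁻¹ * T := by rw [hT]; ring
      _ ≤ 18 * μ⁻¹ ^ 2 * T := by
          gcongr; norm_num
      _ ≤ _ := ht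
  have hf2' : -s * f2 u = P * q - s * (t * c * (c - 1) * r) := by
    simp only [hf2, add_zero, ← hv, ← hq, ← hr, hP]
    linear_combination (h * γ * (1 - γ) * q) * hss
  have hk1' : -s * k1 u = P * (u * (2 * v + (γ - 2) * u) * y) -
      s * (t * c ^ 2 * (c - 1) * u ^ (c - 1)) := by
    simp only [hk1, hf2, add_zero, ← hv, ← hq, ← hr, ← hy, hP]
    rw [hup, hup2, hvp2]
    linear_combination (h * γ * (1 - γ) * y * u * (2 * v + (γ - 2) * u)) * hss
  have habs1 : |s * (t * c * (c - 1) * r)| * X ^ 2 ≤ W / 16 := by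
    rw [abs_mul, hsabs, one_mul]; exact hE1
  have habs2 : |s * (t * c ^ 2 * (c - 1) * u ^ (c - 1))| * X ≤ W / 16 := by
    rw [abs_mul, hsabs, one_mul]; exact hE2
  set E1 := s * (t * c * (c - 1) * r)
  set E2 := s * (t * c ^ 2 * (c - 1) * u ^ (c - 1))
  have a1 := mul_le_mul_of_nonneg_right (le_abs_self E1) (by positivity : 0 ≤ X ^ 2)
  have a2 := mul_le_mul_of_nonneg_right (neg_abs_le E1) (by positivity : 0 ≤ X ^ 2)
  have a3 := mul_le_mul_of_nonneg_right (le_abs_self E2) hX0.le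
  have a4 := mul_le_mul_of_nonneg_right (neg_abs_le E2) hX0.le
  have hPX1 : W / 2 ≤ P * (X * v ^ (γ - 1)) := by
    rw [hW, mul_div_assoc]; gcongr
  have hPX2 : P * (X * v ^ (γ - 1)) ≤ μ⁻¹ * W := by
    calc _ ≤ P * (μ⁻¹ * X ^ γ) := by gcongr
      _ = _ := by rw [hW]; ring
  have hq1 : W / 4 ≤ P * q * X ^ 2 := by
    have : X * v ^ (γ - 1) ≤ 2 * (q * X ^ 2) := by
      rw [hvp]
      have : v * (X * q) ≤ 2 * X * (X * q) := by gcongr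
      linarith only [this]
    have := mul_le_mul_of_nonneg_left this hP0.le
    linarith only [this, hPX1]
  have hq2 : P * q * X ^ 2 ≤ μ⁻¹ ^ 2 * W := by
    have : q * X ^ 2 ≤ μ⁻¹ * (X * v ^ (γ - 1)) := by
      rw [hvp]
      have : μ * X * (X * q) ≤ v * (X * q) := by gcongr
      calc q * X ^ 2 = μ⁻¹ * (μ * X * (X * q)) := by field_simp
        _ ≤ μ⁻¹ * (v * (X * q)) := by gcongr
        _ = _ := by ring
    calc P * q * X ^ 2 = P * (q * X ^ 2) := by ring
      _ ≤ P * (μ⁻¹ * (X * v ^ (γ - 1))) := by gcongr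
      _ = μ⁻¹ * (P * (X * v ^ (γ - 1))) := by ring
      _ ≤ μ⁻¹ * (μ⁻¹ * W) := by gcongr
      _ = _ := by ring
  have hvy : v ^ (γ - 1) = v ^ 2 * y := by rw [hvp, hvp2]; ring
  have hm1 : 11 / 24 * v ^ 2 ≤ u * (2 * v + (γ - 2) * u) := by
    have i1 : 11 / 12 * v ≤ 2 * v + (γ - 2) * u := by
      have i3 : (2 - γ) * u ≤ (2 - γ) * v := mul_le_mul_of_nonneg_left hvu (by linarith only [hγ2])
      have i4 : 11 / 12 * v ≤ γ * v := mul_le_mul_of_nonneg_right hγ1.le huj.le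
      linarith only [i3, i4]
    have i2 : v / 2 ≤ u := by linarith only [hv2u]
    calc 11 / 24 * v ^ 2 = v / 2 * (11 / 12 * v) := by ring
      _ ≤ _ := by gcongr
  have hm2 : u * (2 * v + (γ - 2) * u) ≤ 2 * v ^ 2 := by
    have i1 : 2 * v + (γ - 2) * u ≤ 2 * v := by
      have i3 : 0 ≤ (2 - γ) * u := mul_nonneg (by linarith only [hγ2]) hu0.le
      linarith only [i3]
    calc _ ≤ u * (2 * v) := by gcongr
      _ ≤ v * (2 * v) := by gcongr
      _ = _ := by ring
  set m := u * (2 * v + (γ - 2) * u)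
  have hk2 : 11 / 48 * W ≤ P * (m * y) * X := by
    have : 11 / 24 * (P * (X * v ^ (γ - 1))) ≤ P * (m * y) * X := by
      rw [hvy]
      have := mul_le_mul_of_nonneg_left hm1 (by positivity : 0 ≤ P * X * y)
      linarith only [this]
    linarith only [this, hPX1]
  have hk3 : P * (m * y) * X ≤ 2 * (μ⁻¹ * W) := by
    have : P * (m * y) * X ≤ 2 * (P * (X * v ^ (γ - 1))) := by
      rw [hvy]
      have := mul_le_mul_of_nonneg_left hm2 (by positivity : 0 ≤ P * X * y)
      linarith only [this]
    linarith only [this, hPX2]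
  have hμW : μ⁻¹ * W ≤ μ⁻¹ ^ 2 * W := by gcongr
  refine ⟨⟨?_, ?_⟩, ?_, ?_⟩
  · rw [hf2', div_le_iff₀ (by positivity)]
    linarith only [a1, a2, a3, a4, habs1, habs2, hq1, hq2, hk2, hk3, hμW, hW0]
  · rw [hf2', ← mul_div_assoc, le_div_iff₀ (by positivity)]
    linarith only [a1, a2, a3, a4, habs1, habs2, hq1, hq2, hk2, hk3, hμW, hW0]
  · rw [hk1', div_le_iff₀ hX0]
    linarith only [a1, a2, a3, a4, habs1, habs2, hq1, hq2, hk2, hk3, hμW, hW0]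
  · rw [hk1', ← mul_div_assoc, le_div_iff₀ hX0]
    linarith only [a1, a2, a3, a4, habs1, habs2, hq1, hq2, hk2, hk3, hμW, hW0]

lemma sqrt_div_le_of_pow {y F X : ℝ} (hy : 1 ≤ y) (hX : X = y ^ 12) (hF : y ^ 11 ≤ F) :
    X / √F ≤ y ^ 7 := by
  have hy0 : 0 < y := by linarith
  have h1 : y ^ 5 ≤ √F := by
    apply Real.le_sqrt_of_sq_le
    calc (y ^ 5) ^ 2 = y ^ 10 := by ring
      _ ≤ y ^ 11 := pow_le_pow_right₀ hy (by norm_num)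
      _ ≤ F := hF
  rw [div_le_iff₀ (lt_of_lt_of_le (by positivity) h1), hX]
  calc y ^ 12 = y ^ 7 * y ^ 5 := by ring
    _ ≤ _ := by gcongr

lemma bilinearBound_le_of_pow {A F X μ U y φ : ℝ} (hA : 1 ≤ A) (hμ : 0 < μ) (hμ1 : μ ≤ 1)
    (hy : 1 ≤ y) (hX : X = y ^ 12) (hF : y ^ 11 ≤ F) (hφ : 0 ≤ φ) (hFφ : F = φ ^ 2 * y ^ 12)
    (hU1 : y ^ 2 ≤ U) (hU2 : U ≤ 2 * y ^ 2) :
    bilinearBound A F X μ U U ≤ 210 * (A / μ) * y ^ 10 * (1 + φ) := by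
  have hy0 : 0 < y := by linarith
  have hU0 : 0 < U := lt_of_lt_of_le (by positivity) hU1
  have hF0 : 0 < F := lt_of_lt_of_le (by positivity) hF
  have hsX : √X = y ^ 6 := by
    rw [hX, show y ^ 12 = (y ^ 6) ^ 2 by ring, Real.sqrt_sq (by positivity)]
  have t1 : X / U ≤ y ^ 10 := by
    rw [div_le_iff₀ hU0, hX]
    calc y ^ 12 = y ^ 10 * y ^ 2 := by ring
      _ ≤ _ := by gcongr
  have t2 : √(F * U * √X) ≤ 2 * φ * y ^ 10 := by
    apply Real.sqrt_le_iff.mpr ⟨by positivity, ?_⟩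
    rw [hsX, hFφ]
    calc φ ^ 2 * y ^ 12 * U * y ^ 6 ≤ φ ^ 2 * y ^ 12 * (2 * y ^ 2) * y ^ 6 := by gcongr
      _ = 2 * (φ * y ^ 10) ^ 2 := by ring
      _ ≤ _ := by nlinarith [sq_nonneg (φ * y ^ 10)]
  have t3 := sqrt_div_le_of_pow hy hX hF
  have t4 : X * √(√X / (F * U)) ≤ y ^ 9 := by
    have h1 : √(√X / (F * U)) ≤ (y ^ 3)⁻¹ := by
      apply Real.sqrt_le_iff.mpr ⟨by positivity, ?_⟩
      rw [hsX, ← inv_pow, inv_pow, inv_pow, div_le_iff₀ (by positivity)]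
      have h2 : y ^ 12 ≤ F * U := by
        calc y ^ 12 ≤ y ^ 13 := pow_le_pow_right₀ hy (by norm_num)
          _ = y ^ 11 * y ^ 2 := by ring
          _ ≤ _ := by gcongr
      rw [← div_eq_inv_mul, le_div_iff₀ (by positivity)]
      calc y ^ 6 * (y ^ 3) ^ 2 = y ^ 12 := by ring
        _ ≤ _ := h2
    calc _ ≤ y ^ 12 * (y ^ 3)⁻¹ := by rw [hX] at *; gcongr
      _ = y ^ 9 := by field_simp
  have p7 : y ^ 7 ≤ y ^ 10 := pow_le_pow_right₀ hy (by norm_num)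
  have p9 : y ^ 9 ≤ y ^ 10 := pow_le_pow_right₀ hy (by norm_num)
  have hAμ : 1 ≤ A / μ := by rw [le_div_iff₀ hμ]; linarith
  rw [bilinearBound]
  have e1 : 104 * A / μ = 104 * (A / μ) := by ring
  rw [e1]
  set G := A / μ
  calc _ ≤ y ^ 10 + y ^ 10 + 104 * G * (2 * φ * y ^ 10 + y ^ 10 + y ^ 10) := by
        gcongr
        · linarith
        · linarith
    _ = 2 * y ^ 10 + 208 * G * (1 + φ) * y ^ 10 := by ring
    _ ≤ 2 * (G * (1 + φ)) * y ^ 10 + 208 * G * (1 + φ) * y ^ 10 := by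
        have : 1 ≤ G * (1 + φ) := by nlinarith
        nlinarith [pow_pos hy0 10]
    _ = _ := by ring

/-- Exponential sums over primes with a phase of size between `X ^ (11/12)` and `X ^ (7/6)`. -/
lemma norm_sum_vonMangoldt_phase_le_rpow {f : ℝ → ℝ} {A F X μ : ℝ} (hA : 1 ≤ A)
    (hX : 4 ≤ X) (hμ : 0 < μ) (hμ1 : μ ≤ 1) (hf : IsPhase f A F X (μ * X) X)
    (hF : X ^ ((11 : ℝ) / 12) ≤ F) {a b : ℕ}
    (hab : a ≤ b) (ha : μ * X ≤ a + 1) (hb : (b : ℝ) ≤ X) (hUa : 2 * X ^ ((1 : ℝ) / 6) ≤ a) :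
    ‖∑ n ∈ Ioc a b, (ArithmeticFunction.vonMangoldt n : ℂ) * e (f n)‖ ≤
      280 * (A / μ) * (1 + Real.log X) ^ 4 * X ^ ((11 : ℝ) / 12) * (1 + √(F / X)) ∧
    ‖∑ n ∈ Ioc a b, e (f n)‖ ≤
      280 * (A / μ) * (1 + Real.log X) ^ 4 * X ^ ((11 : ℝ) / 12) * (1 + √(F / X)) := by
  have hX0 : 0 < X := by linarith
  set y := X ^ ((1 : ℝ) / 12) with hy
  have hy1 : 1 ≤ y := Real.one_le_rpow (by linarith) (by norm_num)
  have hy0 : 0 < y := by linarith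
  have hpow : ∀ k : ℕ, y ^ k = X ^ ((k : ℝ) / 12) := by
    intro k; rw [hy, ← Real.rpow_natCast, ← Real.rpow_mul hX0.le]; congr 1; ring
  have hXy : X = y ^ 12 := by rw [hpow]; norm_num
  have h11 : X ^ ((11 : ℝ) / 12) = y ^ 11 := by rw [hpow]; norm_num
  have h2 : X ^ ((1 : ℝ) / 6) = y ^ 2 := by rw [hpow]; norm_num
  rw [h2] at hUa
  rw [h11] at hF ⊢
  have hF0 : 0 < F := lt_of_lt_of_le (by positivity) hF
  set φ := √(F / X) with hφ
  have hφ0 : 0 ≤ φ := Real.sqrt_nonneg _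
  have hFφ : F = φ ^ 2 * y ^ 12 := by
    rw [hφ, Real.sq_sqrt (by positivity), ← hXy]; field_simp
  have hsF : √F = φ * y ^ 6 := by
    rw [hFφ, show φ ^ 2 * y ^ 12 = (φ * y ^ 6) ^ 2 by ring, Real.sqrt_sq (by positivity)]
  have hAμ : 1 ≤ A / μ := by rw [le_div_iff₀ hμ]; linarith
  have hAle : A ≤ A / μ := by rw [le_div_iff₀ hμ]; nlinarith
  set G := A / μ with hG
  set ℓ := 1 + Real.log X with hℓ
  have hℓ1 : 1 ≤ ℓ := by have := Real.log_nonneg (by linarith : 1 ≤ X); rw [hℓ]; linarith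
  have hXF := sqrt_div_le_of_pow hy1 hXy hF
  have p7 : y ^ 7 ≤ y ^ 11 := pow_le_pow_right₀ hy1 (by norm_num)
  have p6 : y ^ 6 ≤ y ^ 11 := pow_le_pow_right₀ hy1 (by norm_num)
  constructor
  · set U := ⌈y ^ 2⌉₊ with hU
    have hy2 : 1 ≤ y ^ 2 := one_le_pow₀ hy1
    have hU1 : y ^ 2 ≤ U := Nat.le_ceil _
    have hU2 : (U : ℝ) ≤ 2 * y ^ 2 := by
      have := Nat.ceil_lt_add_one (by positivity : 0 ≤ y ^ 2); linarith
    have hU0 : 0 < U := Nat.ceil_pos.mpr (by positivity)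
    have hUa' : U ≤ a := by exact_mod_cast hU2.trans hUa
    refine (norm_sum_vonMangoldt_phase_le hA hF0 hX hμ hμ1 hf hab ha hb hU0 hUa' hU0).trans ?_
    have hT := bilinearBound_le_of_pow hA hμ hμ1 hy1 hXy hF hφ0 hFφ hU1 hU2
    have hsq : √(6 * X * bilinearBound A F X μ U U) ≤ 36 * G * y ^ 11 * (1 + φ) := by
      apply Real.sqrt_le_iff.mpr ⟨by positivity, ?_⟩
      have hG2 : G ≤ G ^ 2 := by nlinarith
      have hφ2 : 1 + φ ≤ (1 + φ) ^ 2 := by nlinarith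
      calc _ ≤ 6 * y ^ 12 * (210 * G * y ^ 10 * (1 + φ)) := by
            rw [← hXy]; gcongr
        _ = 1260 * (G * (1 + φ)) * y ^ 22 := by ring
        _ ≤ 1296 * (G ^ 2 * (1 + φ) ^ 2) * y ^ 22 := by gcongr; norm_num
        _ = _ := by ring
    have hfirst : (U : ℝ) ^ 2 * √F + X / √F ≤ 4 * y ^ 11 * (1 + φ) := by
      have h3 : (U : ℝ) ^ 2 * √F ≤ 4 * φ * y ^ 11 := by
        rw [hsF]
        calc _ ≤ (2 * y ^ 2) ^ 2 * (φ * y ^ 6) := by gcongr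
          _ = 4 * φ * y ^ 10 := by ring
          _ ≤ _ := by
              have : y ^ 10 ≤ y ^ 11 := pow_le_pow_right₀ hy1 (by norm_num)
              gcongr
      have : 0 < y ^ 11 := by positivity
      linarith
    have hℓ34 : ℓ ^ 3 ≤ ℓ ^ 4 := pow_le_pow_right₀ hℓ1 (by norm_num)
    calc _ ≤ 52 * G * ℓ ^ 4 * (4 * y ^ 11 * (1 + φ)) + 2 * ℓ ^ 4 * (36 * G * y ^ 11 * (1 + φ)) := by
          gcongr
      _ = _ := by ring
  · have h := norm_sum_phase_le hA hF0 hX0 hf le_rfl (m := 1) (p := a) (q := b) one_pos (by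
      intro n h1 h2
      have h3 : (a : ℝ) + 1 ≤ n := by exact_mod_cast h1
      have h4 : (n : ℝ) ≤ b := by exact_mod_cast h2
      push_cast
      constructor <;> linarith)
    simp only [Nat.cast_one, one_mul, inv_one, mul_one] at h
    refine h.trans ?_
    have h3 : √F + X / √F ≤ y ^ 11 * (1 + φ) := by
      rw [hsF] at *
      have : φ * y ^ 6 ≤ φ * y ^ 11 := by gcongr
      linarith
    have hℓ4 : 1 ≤ ℓ ^ 4 := one_le_pow₀ hℓ1
    calc _ ≤ 13 * G * (y ^ 11 * (1 + φ)) := by gcongr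
      _ ≤ (280 * ℓ ^ 4) * G * (y ^ 11 * (1 + φ)) := by gcongr; linarith
      _ = _ := by ring

open Filter in
lemma eventually_mul_log_pow_le (C : ℝ) (k : ℕ) {ε : ℝ} (hε : 0 < ε) :
    ∀ᶠ X : ℝ in atTop, C * (1 + Real.log X) ^ k ≤ X ^ ε := by
  have h1 := isLittleO_log_rpow_rpow_atTop (k : ℝ) hε
  have h2 := h1.bound (c := (|C| * 2 ^ k + 1)⁻¹) (by positivity)
  filter_upwards [h2, eventually_ge_atTop (Real.exp 1)] with X hX hXe
  have hX0 : 0 < X := (Real.exp_pos 1).trans_le hXe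
  have hlog : 1 ≤ Real.log X := by rwa [Real.le_log_iff_exp_le hX0]
  rw [Real.rpow_natCast, Real.norm_of_nonneg (by positivity), Real.norm_of_nonneg (by positivity),
    ← div_eq_inv_mul, le_div_iff₀ (by positivity)] at hX
  calc C * (1 + Real.log X) ^ k ≤ |C| * (2 * Real.log X) ^ k := by
        gcongr
        · exact le_abs_self C
        · linarith
    _ = Real.log X ^ k * (|C| * 2 ^ k) := by rw [mul_pow]; ring
    _ ≤ Real.log X ^ k * (|C| * 2 ^ k + 1) := by gcongr; linarith
    _ ≤ _ := hX

set_option maxHeartbeats 1000000 in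
lemma norm_sum_vonMangoldt_saw_le {μ γ c t j X : ℝ} (hμ : 0 < μ) (hμ1 : μ ≤ 1)
    (hγ1 : 11 / 12 < γ) (hγ2 : γ < 1) (hc1 : 1 < c) (hc3 : c < 3)
    (hj : 0 ≤ j) (hj1 : j ≤ 1) (hX : 4 ≤ X) (hμX : 1 ≤ μ * X)
    (hμX6 : 2 * X ^ ((1 : ℝ) / 6) ≤ ⌊μ * X⌋₊)
    (hκ : 8 ≤ γ * (1 - γ) * X ^ (γ - 11 / 12))
    (ht : 288 * μ⁻¹ ^ 2 * (|t| * X ^ c) ≤ γ * (1 - γ) * X ^ γ) {k : ℕ} (hk : ⌊μ * X⌋₊ ≤ k)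
    (hkX : (k : ℝ) ≤ X) :
    ‖∑ n ∈ Ioc ⌊μ * X⌋₊ k, ((ArithmeticFunction.vonMangoldt n : ℂ) * e (t * (n : ℝ) ^ c)) *
        (saw (-((n : ℝ) + j) ^ γ) : ℂ)‖ ≤
      (5040 * ((16 * μ⁻¹ ^ 2 + 1) / μ) + 6) * (1 + Real.log X) ^ 6 *
        X ^ (γ - (γ - 11 / 12) / 2) := by
  have hX0 : 0 < X := by linarith
  have hX1 : 1 ≤ X := by linarith
  have hlog : 0 ≤ Real.log X := Real.log_nonneg hX1
  set A := 16 * μ⁻¹ ^ 2 + 1 with hAdef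
  have hA : 1 ≤ A := by have : 0 ≤ 16 * μ⁻¹ ^ 2 := by positivity
                        linarith
  set κ := γ - 11 / 12 with hκdef
  have hκ0 : 0 < κ := by linarith
  have hγγ : 0 < γ * (1 - γ) := mul_pos (by linarith) (by linarith)
  set Δ := X ^ (γ - 1 - κ) with hΔ
  have hΔ0 : 0 < Δ := by positivity
  have hΔ1 : Δ ≤ 1 := Real.rpow_le_one_of_one_le_of_nonpos hX1 (by linarith)
  set ℓ := 1 + Real.log X with hℓ
  have hℓ1 : 1 ≤ ℓ := by linarith
  set B := 280 * (A / μ) * ℓ ^ 4 * X ^ ((11 : ℝ) / 12 + κ / 2) with hB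
  have hB0 : 0 ≤ B := by positivity
  have ha1 : μ * X ≤ (⌊μ * X⌋₊ : ℝ) + 1 := (Nat.lt_floor_add_one _).le
  have key : ∀ (t' : ℝ), |t'| ≤ |t| → ∀ s' : ℝ, (s' = 1 ∨ s' = -1) → ∀ h : ℕ, 0 < h →
      ‖∑ n ∈ Ioc ⌊μ * X⌋₊ k, (ArithmeticFunction.vonMangoldt n : ℂ) *
        e (t' * ((n : ℝ) + 0) ^ c + s' * h * ((n : ℝ) + j) ^ γ)‖ ≤ B * (1 + √(h * Δ)) ∧
      ‖∑ n ∈ Ioc ⌊μ * X⌋₊ k,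
        e (t' * ((n : ℝ) + 0) ^ c + s' * h * ((n : ℝ) + j) ^ γ)‖ ≤ B * (1 + √(h * Δ)) := by
    intro t' ht' s' hs' h hh
    have hh1 : (1 : ℝ) ≤ h := by exact_mod_cast hh
    have hh0 : (0 : ℝ) < h := by linarith
    have hph := isPhase_add_rpow (t := t') (s := s') (h := h) (j := j) hμ hμ1 hγ1 hγ2 hc1 hc3 hs'
      hh0 hj hj1 hμX (by
        have h1 : |t'| * X ^ c ≤ |t| * X ^ c := by gcongr
        have h2 : 0 < γ * (1 - γ) * X ^ γ := by positivity
        have h3 : 18 * μ⁻¹ ^ 2 * (|t'| * X ^ c) ≤ 18 * μ⁻¹ ^ 2 * (|t| * X ^ c) := by gcongr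
        have h4 : γ * (1 - γ) * X ^ γ ≤ h * (γ * (1 - γ) * X ^ γ) := le_mul_of_one_le_left h2.le hh1
        have h5 : h * γ * (1 - γ) * X ^ γ / 16 = h * (γ * (1 - γ) * X ^ γ) / 16 := by ring
        rw [h5]; linarith only [h3, h4, ht])
    have hF : X ^ ((11 : ℝ) / 12) ≤ h * γ * (1 - γ) * X ^ γ / 8 := by
      have e1 : X ^ γ = X ^ κ * X ^ ((11 : ℝ) / 12) := by
        rw [← Real.rpow_add hX0]; congr 1; rw [hκdef]; ring
      have h2 : 8 ≤ h * (γ * (1 - γ) * X ^ κ) := by nlinarith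
      have h3 : 0 < X ^ ((11 : ℝ) / 12) := by positivity
      rw [e1]
      have := mul_le_mul_of_nonneg_right h2 h3.le
      linarith
    have hfin : 280 * (A / μ) * ℓ ^ 4 * X ^ ((11 : ℝ) / 12) *
        (1 + √(h * γ * (1 - γ) * X ^ γ / 8 / X)) ≤ B * (1 + √(h * Δ)) := by
      have h1 : √(h * γ * (1 - γ) * X ^ γ / 8 / X) ≤ √(h * Δ) * X ^ (κ / 2) := by
        apply Real.sqrt_le_iff.mpr ⟨by positivity, ?_⟩
        rw [mul_pow, Real.sq_sqrt (by positivity), ← Real.rpow_natCast (X ^ (κ / 2)),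
          ← Real.rpow_mul hX0.le, mul_assoc (h : ℝ) Δ, hΔ, ← Real.rpow_add hX0]
        have e2 : γ - 1 - κ + κ / 2 * (2 : ℕ) = γ - 1 := by push_cast; ring
        rw [e2, Real.rpow_sub_one hX0.ne']
        have h3 : γ * (1 - γ) ≤ 1 := by nlinarith
        have h4 : 0 < X ^ γ / X := by positivity
        calc h * γ * (1 - γ) * X ^ γ / 8 / X = h * (γ * (1 - γ) / 8 * (X ^ γ / X)) := by ring
          _ ≤ h * (1 * (X ^ γ / X)) := by gcongr; linarith
          _ = _ := by ring
      have h2 : 1 ≤ X ^ (κ / 2) := Real.one_le_rpow hX1 (by linarith)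
      rw [hB, Real.rpow_add hX0]
      calc _ ≤ 280 * (A / μ) * ℓ ^ 4 * X ^ ((11 : ℝ) / 12) *
            (X ^ (κ / 2) + √(h * Δ) * X ^ (κ / 2)) := by gcongr
        _ = _ := by ring
    have := norm_sum_vonMangoldt_phase_le_rpow hA hX hμ hμ1 hph hF hk ha1 hkX hμX6
    exact ⟨this.1.trans hfin, this.2.trans hfin⟩
  set H := ⌈X ^ 2⌉₊ with hH
  have hH2 : X ^ 2 ≤ H := Nat.le_ceil _
  have hHle : (H : ℝ) ≤ 2 * X ^ 2 := by
    have := (Nat.ceil_lt_add_one (show 0 ≤ X ^ 2 by positivity)).le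
    nlinarith
  have hH0 : 0 < H := by
    have : (0 : ℝ) < H := lt_of_lt_of_le (by positivity) hH2
    exact_mod_cast this
  have hH0' : (0 : ℝ) < H := by exact_mod_cast hH0
  have hexp : ∀ (n : ℕ) (h : ℕ) (s' : ℝ),
      ((ArithmeticFunction.vonMangoldt n : ℂ) * e (t * (n : ℝ) ^ c)) *
        e (s' * h * ((n : ℝ) + j) ^ γ) = (ArithmeticFunction.vonMangoldt n : ℂ) *
        e (t * ((n : ℝ) + 0) ^ c + s' * h * ((n : ℝ) + j) ^ γ) := by
    intro n h s'
    rw [e_add, add_zero]; ring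
  have main := norm_sum_saw_le (Ioc ⌊μ * X⌋₊ k)
    (fun n => (ArithmeticFunction.vonMangoldt n : ℂ) * e (t * (n : ℝ) ^ c))
    (fun n => -((n : ℝ) + j) ^ γ) (Δ := Δ) (B := B) (R := ℓ) (N := X) hΔ0 hΔ1 hH0 hB0 hℓ1
    (by
      rw [Nat.card_Ioc]
      refine le_trans ?_ hkX
      exact_mod_cast Nat.sub_le _ _)
    (by
      intro n hn
      rw [mem_Ioc] at hn
      have hn0 : (0 : ℝ) < n := by exact_mod_cast (Nat.zero_le _).trans_lt hn.1
      have hnk : (n : ℝ) ≤ k := by exact_mod_cast hn.2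
      rw [norm_mul, norm_e, mul_one, Complex.norm_real,
        Real.norm_of_nonneg ArithmeticFunction.vonMangoldt_nonneg]
      calc _ ≤ Real.log n := ArithmeticFunction.vonMangoldt_le_log
        _ ≤ Real.log X := Real.log_le_log hn0 (hnk.trans hkX)
        _ ≤ ℓ := by linarith)
    (by
      intro h hh _
      have := (key t le_rfl (-1) (Or.inr rfl) h hh).1
      refine le_of_eq_of_le ?_ this
      congr 1
      refine Finset.sum_congr rfl fun n _ => ?_
      rw [← hexp]; congr 2; ring)
    (by
      intro h hh _
      have := (key t le_rfl 1 (Or.inl rfl) h hh).1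
      refine le_of_eq_of_le ?_ this
      congr 1
      refine Finset.sum_congr rfl fun n _ => ?_
      rw [← hexp]; congr 2; ring)
    (by
      intro h hh _
      have := (key 0 (by simp) (-1) (Or.inr rfl) h hh).2
      refine le_of_eq_of_le ?_ this
      congr 1
      refine Finset.sum_congr rfl fun n _ => ?_
      congr 1; ring)
  refine main.trans ?_
  have hlogH : 1 + Real.log H ≤ 3 * ℓ := by
    have h1 : Real.log H ≤ Real.log (X ^ 3) := by
      apply Real.log_le_log hH0'
      nlinarith [sq_nonneg X]
    rw [Real.log_pow] at h1
    push_cast at h1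
    linarith
  set P := X ^ (γ - κ / 2) with hP
  have hP0 : 0 < P := by positivity
  have p1 : X ^ ((11 : ℝ) / 12 + κ / 2) = P := by rw [hP]; congr 1; rw [hκdef]; ring
  have p2 : 3 * X / (H * Δ) ≤ 3 * P := by
    rw [div_le_iff₀ (by positivity)]
    have h1 : X ≤ P * (X ^ 2 * Δ) := by
      rw [← Real.rpow_natCast X 2, hP, hΔ, ← Real.rpow_add hX0, ← Real.rpow_add hX0]
      nth_rewrite 1 [← Real.rpow_one X]
      apply Real.rpow_le_rpow_of_exponent_le hX1
      push_cast; linarith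
    have h2 : P * (X ^ 2 * Δ) ≤ P * (H * Δ) := by gcongr
    linarith
  have p3 : 3 * Δ * X ≤ 3 * P := by
    have : Δ * X ≤ P := by
      rw [hΔ, ← Real.rpow_add_one hX0.ne', hP]
      apply Real.rpow_le_rpow_of_exponent_le hX1
      linarith
    linarith
  have p4 : 6 * B * (1 + Real.log H) ≤ 5040 * (A / μ) * ℓ ^ 5 * P := by
    calc _ ≤ 6 * B * (3 * ℓ) := by gcongr
      _ = _ := by rw [hB, p1]; ring
  have p5 : 1 ≤ ℓ ^ 5 := one_le_pow₀ hℓ1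
  calc ℓ * (6 * B * (1 + Real.log H) + 3 * X / (H * Δ) + 3 * Δ * X)
      ≤ ℓ * (5040 * (A / μ) * ℓ ^ 5 * P + 3 * P + 3 * P) := by gcongr
    _ = 5040 * (A / μ) * ℓ ^ 6 * P + 6 * ℓ * P * 1 := by ring
    _ ≤ 5040 * (A / μ) * ℓ ^ 6 * P + 6 * ℓ * P * ℓ ^ 5 := by gcongr
    _ = _ := by ring

open Filter in
lemma eventually_norm_sum_rpow_mul_saw_le {μ γ c δ : ℝ} (hμ : 0 < μ) (hμ1 : μ < 1)
    (hγ1 : 11 / 12 < γ) (hγ2 : γ < 1) (hc1 : 1 < c) (hc3 : c < 3) (hδ : 0 < δ) :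
    ∀ᶠ X : ℝ in atTop, ∀ t : ℝ, |t| ≤ X ^ ((4 * γ - 3 * c - 1) / 3 - δ) →
      ∀ j : ℝ, 0 ≤ j → j ≤ 1 →
      ‖∑ n ∈ Ioc ⌊μ * X⌋₊ ⌊X⌋₊, (((n : ℝ) ^ (1 - γ) : ℝ) : ℂ) *
        (((ArithmeticFunction.vonMangoldt n : ℂ) * e (t * (n : ℝ) ^ c)) *
        (saw (-((n : ℝ) + j) ^ γ) : ℂ))‖ ≤ X ^ (1 - (γ - 11 / 12) / 4) := by
  have hγγ : 0 < γ * (1 - γ) := mul_pos (by linarith) (by linarith)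
  set C := 5040 * ((16 * μ⁻¹ ^ 2 + 1) / μ) + 6 with hC
  have hC0 : 0 < C := by positivity
  have ev1 := ((tendsto_rpow_atTop (show 0 < γ - 11 / 12 by linarith)).const_mul_atTop
    hγγ).eventually_ge_atTop 8
  have ev2 := ((tendsto_rpow_atTop (show 0 < (1 - γ) / 3 by linarith)).const_mul_atTop
    hγγ).eventually_ge_atTop (288 * μ⁻¹ ^ 2)
  have ev3 := ((tendsto_rpow_atTop (show (0 : ℝ) < 5 / 6 by norm_num)).const_mul_atTop
    hμ).eventually_ge_atTop 3
  have ev4 := eventually_mul_log_pow_le (2 * C) 6 (show 0 < (γ - 11 / 12) / 4 by linarith)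
  filter_upwards [ev1, ev2, ev3, ev4, eventually_ge_atTop 4, eventually_ge_atTop μ⁻¹] with
    X h1 h2 h3 h4 hX hXμ t ht j hj hj1
  have hX0 : 0 < X := by linarith
  have hX1 : 1 ≤ X := by linarith
  have hμX : 1 ≤ μ * X := by
    calc 1 = μ * μ⁻¹ := (mul_inv_cancel₀ hμ.ne').symm
      _ ≤ _ := by gcongr
  have hab : ⌊μ * X⌋₊ ≤ ⌊X⌋₊ := Nat.floor_le_floor (by nlinarith)
  have hlog : 0 ≤ Real.log X := Real.log_nonneg hX1
  have hfl : 2 * X ^ ((1 : ℝ) / 6) ≤ ⌊μ * X⌋₊ := by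
    have e1 : X = X ^ ((5 : ℝ) / 6) * X ^ ((1 : ℝ) / 6) := by
      rw [← Real.rpow_add hX0]; norm_num
    have e2 : 1 ≤ X ^ ((1 : ℝ) / 6) := Real.one_le_rpow hX1 (by norm_num)
    have e3 : 3 * X ^ ((1 : ℝ) / 6) ≤ μ * X := by
      calc _ ≤ (μ * X ^ ((5 : ℝ) / 6)) * X ^ ((1 : ℝ) / 6) := by gcongr
        _ = μ * (X ^ ((5 : ℝ) / 6) * X ^ ((1 : ℝ) / 6)) := by ring
        _ = _ := by rw [← e1]
    have := Nat.lt_floor_add_one (μ * X)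
    linarith
  have htX : 288 * μ⁻¹ ^ 2 * (|t| * X ^ c) ≤ γ * (1 - γ) * X ^ γ := by
    have e1 : |t| * X ^ c ≤ X ^ (γ - (1 - γ) / 3) := by
      calc _ ≤ X ^ ((4 * γ - 3 * c - 1) / 3 - δ) * X ^ c := by gcongr
        _ = X ^ ((4 * γ - 3 * c - 1) / 3 - δ + c) := (Real.rpow_add hX0 _ _).symm
        _ ≤ _ := Real.rpow_le_rpow_of_exponent_le hX1 (by linarith)
    calc _ ≤ γ * (1 - γ) * X ^ ((1 - γ) / 3) * X ^ (γ - (1 - γ) / 3) := by gcongr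
      _ = γ * (1 - γ) * (X ^ ((1 - γ) / 3) * X ^ (γ - (1 - γ) / 3)) := by ring
      _ = _ := by rw [← Real.rpow_add hX0]; congr 2; ring
  have main := norm_sum_mul_le_of_monotone (w := fun n : ℕ => (n : ℝ) ^ (1 - γ))
    (z := fun n : ℕ => ((ArithmeticFunction.vonMangoldt n : ℂ) * e (t * (n : ℝ) ^ c)) *
        (saw (-((n : ℝ) + j) ^ γ) : ℂ)) hab (by positivity)
    (by
      intro n _ _
      have : 0 ≤ 1 - γ := by linarith
      push_cast
      gcongr
      linarith)
    (fun k hk hk' => norm_sum_vonMangoldt_saw_le hμ hμ1.le hγ1 hγ2 hc1 hc3 hj hj1 hX hμX hfl h1 htX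
      hk ((Nat.cast_le.mpr hk').trans (Nat.floor_le hX0.le)))
  refine main.trans ?_
  have hw : (⌊X⌋₊ : ℝ) ^ (1 - γ) ≤ X ^ (1 - γ) := by
    have : 0 ≤ 1 - γ := by linarith
    gcongr
    exact Nat.floor_le hX0.le
  calc _ ≤ 2 * X ^ (1 - γ) * (C * (1 + Real.log X) ^ 6 * X ^ (γ - (γ - 11 / 12) / 2)) := by
        gcongr
    _ = 2 * C * (1 + Real.log X) ^ 6 * (X ^ (1 - γ) * X ^ (γ - (γ - 11 / 12) / 2)) := by ring
    _ ≤ X ^ ((γ - 11 / 12) / 4) * (X ^ (1 - γ) * X ^ (γ - (γ - 11 / 12) / 2)) := by gcongr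
    _ = _ := by
      rw [← Real.rpow_add hX0, ← Real.rpow_add hX0]; congr 1; ring

lemma isPS_iff {γ : ℝ} (hγ0 : 0 < γ) {n : ℕ} (hn : 0 < n) :
    isPS γ n ↔ ∃ k : ℤ, (n : ℝ) ^ γ ≤ k ∧ (k : ℝ) < ((n : ℝ) + 1) ^ γ := by
  have hn0 : (0 : ℝ) < n := by exact_mod_cast hn
  have main : ∀ k : ℝ, 0 ≤ k → (((n : ℝ) ≤ k ^ (1 / γ) ↔ (n : ℝ) ^ γ ≤ k) ∧
      (k ^ (1 / γ) < (n : ℝ) + 1 ↔ k < ((n : ℝ) + 1) ^ γ)) := by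
    intro k hk
    rw [one_div]
    exact ⟨Real.le_rpow_inv_iff_of_pos hn0.le hk hγ0,
      Real.rpow_inv_lt_iff_of_pos hk (by positivity) hγ0⟩
  constructor
  · rintro ⟨k, hk, h⟩
    have h' := (Nat.floor_eq_iff (by positivity)).mp h.symm
    refine ⟨k, ?_, ?_⟩
    · exact_mod_cast (main k (by positivity)).1.mp h'.1
    · exact_mod_cast (main k (by positivity)).2.mp h'.2
  · rintro ⟨k, h1, h2⟩
    have hk0 : (0 : ℝ) < k := lt_of_lt_of_le (by positivity) h1
    have hk : 0 < k := by exact_mod_cast hk0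
    lift k to ℕ using hk.le
    push_cast at h1 h2 hk0
    refine ⟨k, by exact_mod_cast hk, ((Nat.floor_eq_iff (by positivity)).mpr ⟨?_, ?_⟩).symm⟩
    · exact (main k hk0.le).1.mpr h1
    · exact (main k hk0.le).2.mpr h2

lemma rpow_succ_sub_le {γ : ℝ} (hγ0 : 0 < γ) (hγ2 : γ < 1) {n : ℕ} (hn : 0 < n) :
    ((n : ℝ) + 1) ^ γ - (n : ℝ) ^ γ ≤ γ * (n : ℝ) ^ (γ - 1) ∧
      γ * ((n : ℝ) + 1) ^ (γ - 1) ≤ ((n : ℝ) + 1) ^ γ - (n : ℝ) ^ γ := by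
  have hn0 : (0 : ℝ) < n := by exact_mod_cast hn
  obtain ⟨ξ, hξ, h⟩ := exists_hasDerivAt_eq_slope (fun u : ℝ => u ^ γ)
    (fun u => γ * u ^ (γ - 1)) (show (n : ℝ) < n + 1 by linarith)
    (by intro u hu
        exact (Real.continuousAt_rpow_const _ _ (Or.inr hγ0.le)).continuousWithinAt)
    (fun u hu => Real.hasDerivAt_rpow_const (Or.inl (by linarith [hu.1])))
  have e1 : (n : ℝ) + 1 - n = 1 := by ring
  rw [e1, div_one] at h
  rw [← h]
  constructor
  · gcongr γ * ?_
    exact Real.rpow_le_rpow_of_nonpos hn0 hξ.1.le (by linarith)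
  · gcongr γ * ?_
    exact Real.rpow_le_rpow_of_nonpos (hn0.trans hξ.1) hξ.2.le (by linarith)

lemma indicator_isPS_eq {γ : ℝ} (hγ0 : 0 < γ) (hγ2 : γ < 1) {n : ℕ} (hn : 0 < n) :
    (if isPS γ n then (1 : ℝ) else 0) = (((n : ℝ) + 1) ^ γ - (n : ℝ) ^ γ) +
      (saw (-((n : ℝ) + 1) ^ γ) - saw (-((n : ℝ) + 0) ^ γ)) := by
  have hn1 : (1 : ℝ) ≤ n := by exact_mod_cast hn
  have hn0 : (0 : ℝ) < n := by linarith
  have hd := rpow_succ_sub_le hγ0 hγ2 hn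
  have hlt1 : ((n : ℝ) + 1) ^ γ < (n : ℝ) ^ γ + 1 := by
    have h1 : (n : ℝ) ^ (γ - 1) ≤ 1 := Real.rpow_le_one_of_one_le_of_nonpos hn1 (by linarith)
    have : γ * (n : ℝ) ^ (γ - 1) ≤ γ * 1 := by gcongr
    linarith [hd.1]
  have hlt2 : (n : ℝ) ^ γ < ((n : ℝ) + 1) ^ γ := by
    have : 0 < γ * ((n : ℝ) + 1) ^ (γ - 1) := by positivity
    linarith [hd.2]
  rw [add_zero]
  set u := (n : ℝ) ^ γ
  set v := ((n : ℝ) + 1) ^ γ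
  have hs : (v - u) + (saw (-v) - saw (-u)) = ((⌈v⌉ - ⌈u⌉ : ℤ) : ℝ) := by
    have h1 := Int.self_sub_floor (-v)
    have h2 := Int.self_sub_floor (-u)
    rw [Int.floor_neg] at h1 h2
    simp only [saw]
    push_cast at h1 h2 ⊢
    linarith
  rw [hs]
  have hu := Int.le_ceil u
  have hu' := Int.ceil_lt_add_one u
  split_ifs with h
  · obtain ⟨k, hk1, hk2⟩ := (isPS_iff hγ0 hn).mp h
    have a1 : ⌈u⌉ ≤ k := Int.ceil_le.mpr hk1
    have a2 : k < ⌈v⌉ := Int.lt_ceil.mpr hk2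
    have a3 : ⌈v⌉ ≤ ⌈u⌉ + 1 := by
      apply Int.ceil_le.mpr; push_cast; linarith
    have : ⌈v⌉ - ⌈u⌉ = 1 := by omega
    rw [this]; simp
  · have a1 : ⌈u⌉ ≤ ⌈v⌉ := Int.ceil_le_ceil hlt2.le
    have a2 : ¬ ⌈u⌉ < ⌈v⌉ := by
      intro h2
      exact h ((isPS_iff hγ0 hn).mpr ⟨⌈u⌉, hu, Int.lt_ceil.mp h2⟩)
    have : ⌈v⌉ - ⌈u⌉ = 0 := by omega
    rw [this]; simp

lemma abs_rpow_mul_sub_le {γ : ℝ} (hγ0 : 0 < γ) (hγ2 : γ < 1) {n : ℕ} (hn : 0 < n) :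
    |(n : ℝ) ^ (1 - γ) * (((n : ℝ) + 1) ^ γ - (n : ℝ) ^ γ) - γ| ≤ (n : ℝ)⁻¹ := by
  have hn0 : (0 : ℝ) < n := by exact_mod_cast hn
  obtain ⟨h1, h2⟩ := rpow_succ_sub_le hγ0 hγ2 hn
  have hw : 0 < (n : ℝ) ^ (1 - γ) := by positivity
  have e1 : (n : ℝ) ^ (1 - γ) * (n : ℝ) ^ (γ - 1) = 1 := by
    rw [← Real.rpow_add hn0]; simp
  have up : (n : ℝ) ^ (1 - γ) * (((n : ℝ) + 1) ^ γ - (n : ℝ) ^ γ) ≤ γ := by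
    calc _ ≤ (n : ℝ) ^ (1 - γ) * (γ * (n : ℝ) ^ (γ - 1)) := by gcongr
      _ = γ * ((n : ℝ) ^ (1 - γ) * (n : ℝ) ^ (γ - 1)) := by ring
      _ = γ := by rw [e1, mul_one]
  have e2 : (n : ℝ) ^ (1 - γ) * ((n : ℝ) + 1) ^ (γ - 1) ≥ n / (n + 1) := by
    have e3 : ((n : ℝ) + 1) ^ (γ - 1) = (((n : ℝ) + 1) ^ (1 - γ))⁻¹ := by
      rw [← Real.rpow_neg (by positivity)]; congr 1; ring
    rw [e3, ← div_eq_mul_inv, ← Real.div_rpow (by positivity) (by positivity)]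
    have hx0 : (0 : ℝ) < n / (n + 1) := by positivity
    have hx1 : (n : ℝ) / (n + 1) ≤ 1 := by rw [div_le_one (by positivity)]; linarith
    calc (n : ℝ) / (n + 1) = (n / (n + 1) : ℝ) ^ (1 : ℝ) := (Real.rpow_one _).symm
      _ ≤ _ := Real.rpow_le_rpow_of_exponent_ge hx0 hx1 (by linarith)
  have lo : γ * (n / (n + 1)) ≤ (n : ℝ) ^ (1 - γ) * (((n : ℝ) + 1) ^ γ - (n : ℝ) ^ γ) := by
    calc _ ≤ γ * ((n : ℝ) ^ (1 - γ) * ((n : ℝ) + 1) ^ (γ - 1)) := by gcongr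
      _ = (n : ℝ) ^ (1 - γ) * (γ * ((n : ℝ) + 1) ^ (γ - 1)) := by ring
      _ ≤ _ := by gcongr
  have e4 : (n : ℝ) / (n + 1) ≥ 1 - (n : ℝ)⁻¹ := by
    rw [ge_iff_le, le_div_iff₀ (by positivity)]
    have : (1 - (n : ℝ)⁻¹) * (n + 1) = n - (n : ℝ)⁻¹ := by field_simp; ring
    rw [this]
    have : 0 < (n : ℝ)⁻¹ := by positivity
    linarith
  have hinv : 0 < (n : ℝ)⁻¹ := by positivity
  rw [abs_le]
  constructor
  · nlinarith
  · linarith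

open MeasureTheory in
lemma norm_sum_mul_sub_integral_le {g g' : ℝ → ℂ} {z : ℕ → ℂ} {a b M V : ℝ} (ha : 0 ≤ a)
    (hab : a ≤ b) (hg : ∀ x ∈ Set.Icc a b, HasDerivAt g (g' x) x)
    (hg' : ContinuousOn g' (Set.Icc a b)) (hg1 : ∀ x ∈ Set.Icc a b, ‖g x‖ ≤ 1)
    (hV : ∀ x ∈ Set.Icc a b, ‖g' x‖ ≤ V)
    (hM : ∀ x ∈ Set.Icc a b, ‖(∑ k ∈ Icc 0 ⌊x⌋₊, z k) - (x : ℂ)‖ ≤ M) :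
    ‖(∑ n ∈ Ioc ⌊a⌋₊ ⌊b⌋₊, g n * z n) - ∫ x in a..b, g x‖ ≤ M * (2 + V * (b - a)) := by
  have haI : a ∈ Set.Icc a b := ⟨le_rfl, hab⟩
  have hbI : b ∈ Set.Icc a b := ⟨hab, le_rfl⟩
  have hM0 : 0 ≤ M := (norm_nonneg _).trans (hM a haI)
  have hu : Set.uIcc a b = Set.Icc a b := Set.uIcc_of_le hab
  have hder : Set.EqOn (deriv g) g' (Set.Icc a b) := fun x hx => (hg x hx).deriv
  have hint' : IntegrableOn g' (Set.Icc a b) := hg'.integrableOn_Icc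
  have hint : IntegrableOn (deriv g) (Set.Icc a b) :=
    hint'.congr_fun hder.symm measurableSet_Icc
  have h1 := sum_mul_eq_sub_sub_integral_mul z ha hab (fun x hx => (hg x hx).differentiableAt) hint
  have h2 := intervalIntegral.integral_mul_deriv_eq_deriv_mul (u := g) (u' := g')
    (v := fun x : ℝ => (x : ℂ)) (v' := fun _ => 1) (a := a) (b := b)
    (by rw [hu]; exact hg) (fun x _ => Complex.ofRealCLM.hasDerivAt)
    (by rw [intervalIntegrable_iff_integrableOn_Icc_of_le hab]; exact hint')
    (by simp)
  simp only [mul_one] at h2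
  have hS : IntervalIntegrable (fun x : ℝ => g' x * ∑ k ∈ Icc 0 ⌊x⌋₊, z k) volume a b := by
    rw [intervalIntegrable_iff_integrableOn_Icc_of_le hab]
    refine (integrableOn_mul_sum_Icc z (m := 0) ha hint').congr_fun (fun x _ => rfl)
      measurableSet_Icc
  have hX : IntervalIntegrable (fun x : ℝ => g' x * (x : ℂ)) volume a b := by
    apply ContinuousOn.intervalIntegrable
    rw [hu]
    exact hg'.mul Complex.continuous_ofReal.continuousOn
  have h3 : ∫ x in Set.Ioc a b, deriv g x * ∑ k ∈ Icc 0 ⌊x⌋₊, z k =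
      ∫ x in a..b, g' x * ∑ k ∈ Icc 0 ⌊x⌋₊, z k := by
    rw [intervalIntegral.integral_of_le hab]
    exact setIntegral_congr_fun measurableSet_Ioc fun x hx => by
      simp only [hder (Set.Ioc_subset_Icc_self hx)]
  have h4 : (∫ x in a..b, g' x * ∑ k ∈ Icc 0 ⌊x⌋₊, z k) - ∫ x in a..b, g' x * (x : ℂ) =
      ∫ x in a..b, g' x * ((∑ k ∈ Icc 0 ⌊x⌋₊, z k) - (x : ℂ)) := by
    rw [← intervalIntegral.integral_sub hS hX]
    simp only [mul_sub]
  have h5 : ‖∫ x in a..b, g' x * ((∑ k ∈ Icc 0 ⌊x⌋₊, z k) - (x : ℂ))‖ ≤ V * M * |b - a| := by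
    apply intervalIntegral.norm_integral_le_of_norm_le_const
    intro x hx
    rw [Set.uIoc_of_le hab] at hx
    have hx' := Set.Ioc_subset_Icc_self hx
    rw [norm_mul]
    exact mul_le_mul (hV x hx') (hM x hx') (norm_nonneg _) ((norm_nonneg _).trans (hV x hx'))
  rw [abs_of_nonneg (by linarith)] at h5
  have h6 : (∑ n ∈ Ioc ⌊a⌋₊ ⌊b⌋₊, g n * z n) - ∫ x in a..b, g x =
      g b * ((∑ k ∈ Icc 0 ⌊b⌋₊, z k) - (b : ℂ)) - g a * ((∑ k ∈ Icc 0 ⌊a⌋₊, z k) - (a : ℂ)) -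
        ∫ x in a..b, g' x * ((∑ k ∈ Icc 0 ⌊x⌋₊, z k) - (x : ℂ)) := by
    rw [← h4, h2, ← h3]
    have : ∑ n ∈ Ioc ⌊a⌋₊ ⌊b⌋₊, g n * z n = ∑ n ∈ Ioc ⌊a⌋₊ ⌊b⌋₊, g (n : ℝ) * z n := rfl
    rw [h1]; ring
  have hbound : ∀ x ∈ Set.Icc a b, ‖g x * ((∑ k ∈ Icc 0 ⌊x⌋₊, z k) - (x : ℂ))‖ ≤ M := by
    intro x hx
    rw [norm_mul]
    calc _ ≤ 1 * M := mul_le_mul (hg1 x hx) (hM x hx) (norm_nonneg _) zero_le_one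
      _ = M := one_mul _
  rw [h6]
  refine (norm_sub_le _ _).trans ?_
  have := norm_sub_le (g b * ((∑ k ∈ Icc 0 ⌊b⌋₊, z k) - (b : ℂ)))
    (g a * ((∑ k ∈ Icc 0 ⌊a⌋₊, z k) - (a : ℂ)))
  linarith [hbound a haI, hbound b hbI]

lemma norm_sum_mul_e_sub_integral_le {μ c X t M : ℝ} {z : ℕ → ℂ} (hμ : 0 < μ) (hμ1 : μ ≤ 1)
    (hc1 : 1 < c) (hc3 : c < 3) (hX : 0 < X)
    (hM : ∀ x ∈ Set.Icc (μ * X) X, ‖(∑ k ∈ Icc 0 ⌊x⌋₊, z k) - (x : ℂ)‖ ≤ M) :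
    ‖(∑ n ∈ Ioc ⌊μ * X⌋₊ ⌊X⌋₊, z n * e (t * (n : ℝ) ^ c)) - ∫ y in (μ * X)..X, e (t * y ^ c)‖ ≤
      M * (2 + 24 * (|t| * X ^ c)) := by
  have hμX : 0 < μ * X := by positivity
  have hle : μ * X ≤ X := by nlinarith
  have hM0 : 0 ≤ M := (norm_nonneg _).trans (hM X ⟨hle, le_rfl⟩)
  have hd : ∀ x ∈ Set.Icc (μ * X) X, HasDerivAt (fun y : ℝ => e (t * y ^ c))
      (e (t * x ^ c) * (2 * Real.pi * Complex.I * ((t * (c * x ^ (c - 1)) : ℝ) : ℂ))) x := by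
    intro x hx
    have hx0 : 0 < x := hμX.trans_le hx.1
    have h1 := ((Real.hasDerivAt_rpow_const (p := c) (Or.inl hx0.ne')).const_mul t).ofReal_comp
    exact (h1.const_mul (2 * Real.pi * Complex.I)).cexp
  have main := norm_sum_mul_sub_integral_le (z := z) (V := 8 * (3 * (|t| * X ^ c) / X)) hμX.le hle hd
    (by
      apply ContinuousOn.mul (fun x hx => (hd x hx).continuousAt.continuousWithinAt)
      apply continuousOn_const.mul
      apply Complex.continuous_ofReal.comp_continuousOn
      apply continuousOn_const.mul
      apply continuousOn_const.mul
      exact continuousOn_id.rpow_const fun x hx => Or.inl (hμX.trans_le hx.1).ne')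
    (fun x _ => (norm_e _).le)
    (by
      intro x hx
      have hx0 : 0 < x := hμX.trans_le hx.1
      rw [norm_mul, norm_e, one_mul, norm_mul, norm_mul, norm_mul, Complex.norm_I, Complex.norm_real,
        Complex.norm_real, Complex.norm_ofNat, Real.norm_eq_abs, Real.norm_eq_abs,
        abs_of_pos Real.pi_pos, mul_one, abs_mul, abs_of_pos (by positivity : 0 < c * x ^ (c - 1))]
      have h1 : x ^ (c - 1) ≤ X ^ (c - 1) := Real.rpow_le_rpow hx0.le hx.2 (by linarith)
      rw [Real.rpow_sub_one hX.ne'] at h1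
      calc 2 * Real.pi * (|t| * (c * x ^ (c - 1))) ≤ 2 * 4 * (|t| * (3 * (X ^ c / X))) := by
            gcongr
            exact Real.pi_le_four
        _ = _ := by ring)
    hM
  refine le_trans (le_of_eq ?_) (main.trans ?_)
  · congr 2
    exact Finset.sum_congr rfl fun n _ => mul_comm _ _
  · have h1 : 8 * (3 * (|t| * X ^ c) / X) * (X - μ * X) ≤ 24 * (|t| * X ^ c) := by
      calc _ ≤ 8 * (3 * (|t| * X ^ c) / X) * X := by gcongr; linarith
        _ = _ := by rw [mul_assoc, div_mul_cancel₀ _ hX.ne']; ring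
    exact mul_le_mul_of_nonneg_left (by linarith) hM0

open Filter in
/-- The sum over Piatetski-Shapiro numbers is `γ` times the sum over all integers, up to a power
saving. -/
lemma eventually_norm_sum_isPS_sub_le {μ γ c δ : ℝ} (hμ : 0 < μ) (hμ1 : μ < 1)
    (hγ1 : 11 / 12 < γ) (hγ2 : γ < 1) (hc1 : 1 < c) (hc3 : c < 3) (hδ : 0 < δ) :
    ∀ᶠ X : ℝ in atTop, ∀ t : ℝ, |t| ≤ X ^ ((4 * γ - 3 * c - 1) / 3 - δ) →
      ‖(∑ n ∈ Ioc ⌊μ * X⌋₊ ⌊X⌋₊,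
          if isPS γ n then
            (ArithmeticFunction.vonMangoldt n : ℂ) * ((n : ℝ) ^ (1 - γ) : ℝ)
              * e (t * (n : ℝ) ^ c)
          else 0) - (γ : ℂ) * ∑ n ∈ Ioc ⌊μ * X⌋₊ ⌊X⌋₊,
            (ArithmeticFunction.vonMangoldt n : ℂ) * e (t * (n : ℝ) ^ c)‖ ≤
        2 * X ^ (1 - (γ - 11 / 12) / 4) + (1 + Real.log X) ^ 2 := by
  have hγ0 : 0 < γ := by linarith
  filter_upwards [eventually_norm_sum_rpow_mul_saw_le hμ hμ1 hγ1 hγ2 hc1 hc3 hδ,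
    eventually_ge_atTop 4] with X hev hX t ht
  have hX0 : 0 < X := by linarith
  have hlog : 0 ≤ Real.log X := Real.log_nonneg (by linarith)
  have h1 := hev t ht 1 zero_le_one le_rfl
  have h0 := hev t ht 0 le_rfl zero_le_one
  set T : ℝ → ℂ := fun j => ∑ n ∈ Ioc ⌊μ * X⌋₊ ⌊X⌋₊, (((n : ℝ) ^ (1 - γ) : ℝ) : ℂ) *
        (((ArithmeticFunction.vonMangoldt n : ℂ) * e (t * (n : ℝ) ^ c)) *
        (saw (-((n : ℝ) + j) ^ γ) : ℂ)) with hT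
  set D : ℂ := ∑ n ∈ Ioc ⌊μ * X⌋₊ ⌊X⌋₊, ((ArithmeticFunction.vonMangoldt n : ℂ) *
    e (t * (n : ℝ) ^ c)) *
      (((n : ℝ) ^ (1 - γ) * (((n : ℝ) + 1) ^ γ - (n : ℝ) ^ γ) - γ : ℝ) : ℂ) with hD
  have hsplit : (∑ n ∈ Ioc ⌊μ * X⌋₊ ⌊X⌋₊,
          if isPS γ n then
            (ArithmeticFunction.vonMangoldt n : ℂ) * ((n : ℝ) ^ (1 - γ) : ℝ)
              * e (t * (n : ℝ) ^ c)
          else 0) - (γ : ℂ) * ∑ n ∈ Ioc ⌊μ * X⌋₊ ⌊X⌋₊,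
            (ArithmeticFunction.vonMangoldt n : ℂ) * e (t * (n : ℝ) ^ c) = D + (T 1 - T 0) := by
    rw [hD, hT, Finset.mul_sum, ← Finset.sum_sub_distrib, ← Finset.sum_sub_distrib,
      ← Finset.sum_add_distrib]
    refine Finset.sum_congr rfl fun n hn => ?_
    have hn0 : 0 < n := (Nat.zero_le _).trans_lt (mem_Ioc.mp hn).1
    have hind := indicator_isPS_eq hγ0 hγ2 hn0
    have e1 : (if isPS γ n then (ArithmeticFunction.vonMangoldt n : ℂ) * ((n : ℝ) ^ (1 - γ) : ℝ)
        * e (t * (n : ℝ) ^ c) else 0) = (ArithmeticFunction.vonMangoldt n : ℂ) *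
          ((n : ℝ) ^ (1 - γ) : ℝ) * e (t * (n : ℝ) ^ c) *
          (((if isPS γ n then (1 : ℝ) else 0) : ℝ) : ℂ) := by
      split_ifs <;> simp
    rw [e1, hind]
    push_cast; ring
  rw [hsplit]
  have hDle : ‖D‖ ≤ (1 + Real.log X) ^ 2 := by
    calc ‖D‖ ≤ ∑ n ∈ Ioc ⌊μ * X⌋₊ ⌊X⌋₊, Real.log X * (n : ℝ)⁻¹ := by
          refine norm_sum_le_of_le _ fun n hn => ?_
          have hn0 : 0 < n := (Nat.zero_le _).trans_lt (mem_Ioc.mp hn).1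
          have hnX : (n : ℝ) ≤ X :=
            (Nat.cast_le.mpr (mem_Ioc.mp hn).2).trans (Nat.floor_le hX0.le)
          rw [norm_mul, norm_mul, norm_e, mul_one, Complex.norm_real, Complex.norm_real,
            Real.norm_of_nonneg ArithmeticFunction.vonMangoldt_nonneg, Real.norm_eq_abs]
          gcongr
          · exact ArithmeticFunction.vonMangoldt_le_log.trans
              (Real.log_le_log (by exact_mod_cast hn0) hnX)
          · exact abs_rpow_mul_sub_le hγ0 hγ2 hn0
      _ = Real.log X * ∑ n ∈ Ioc ⌊μ * X⌋₊ ⌊X⌋₊, (n : ℝ)⁻¹ := by rw [Finset.mul_sum]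
      _ ≤ Real.log X * ∑ n ∈ Ioc 0 ⌊X⌋₊, (n : ℝ)⁻¹ := by
          gcongr
          exact Nat.zero_le _
      _ ≤ Real.log X * (1 + Real.log X) := by
          gcongr
          refine (sum_inv_le _).trans ?_
          gcongr
          · have : 1 ≤ ⌊X⌋₊ := Nat.le_floor (by norm_num; linarith)
            exact_mod_cast this
          · exact Nat.floor_le hX0.le
      _ ≤ _ := by nlinarith
  calc ‖D + (T 1 - T 0)‖ ≤ ‖D‖ + (‖T 1‖ + ‖T 0‖) := by
        refine (norm_add_le _ _).trans ?_
        gcongr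
        exact norm_sub_le _ _
    _ ≤ _ := by linarith

lemma isPhase_rpow {μ c t X : ℝ} (hμ : 0 < μ) (hμ1 : μ ≤ 1) (hc1 : 1 < c) (hc3 : c < 3)
    (hX : 0 < X) (ht : t ≠ 0) :
    IsPhase (fun u => t * u ^ c) (3 * μ⁻¹ ^ 5) (c * (c - 1) * μ ^ 3 * (|t| * X ^ c)) X (μ * X) X := by
  obtain ⟨s, hs, hst⟩ : ∃ s : ℝ, (s = 1 ∨ s = -1) ∧ s * t = |t| := by
    rcases abs_choice t with h | h
    · exact ⟨1, Or.inl rfl, by rw [h]; ring⟩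
    · exact ⟨-1, Or.inr rfl, by rw [h]; ring⟩
  have ht0 : 0 < |t| := abs_pos.mpr ht
  have hc0 : 0 < c - 1 := by linarith
  refine ⟨fun u => t * c * (u + 0) ^ (c - 1), fun u => t * c * (c - 1) * (u + 0) ^ (c - 1 - 1),
    fun u => t * c ^ 2 * (c - 1) * u ^ (c - 1), s, s, hs, hs, ?_⟩
  intro u hu
  have hμX : 0 < μ * X := by positivity
  have hu0 : 0 < u := hμX.trans_le hu.1
  have hu00 : 0 < u + 0 := by linarith
  have hf := hasDerivAt_const_mul_add_rpow t c 0 hu00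
  have hk : HasDerivAt (fun u : ℝ => u ^ 2 * (t * c * (c - 1) * (u + 0) ^ (c - 1 - 1)))
      (t * c ^ 2 * (c - 1) * u ^ (c - 1)) u := by
    have h1 := (Real.hasDerivAt_rpow_const (p := c) (Or.inl hu0.ne')).const_mul (t * c * (c - 1))
    refine (h1.congr_of_eventuallyEq ?_).congr_deriv (by ring)
    filter_upwards [eventually_gt_nhds hu0] with w hw
    have : w ^ c = w ^ 2 * w ^ (c - 1 - 1) := by
      rw [← Real.rpow_natCast w 2, ← Real.rpow_add hw]; congr 1; push_cast; ring
    rw [add_zero, this]; ring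
  refine ⟨by simpa only [add_zero] using hf,
    hasDerivAt_const_mul_add_rpow (t * c) (c - 1) 0 hu00, hk, ?_⟩
  have p1 : u ^ (c - 1) = u ^ c / u := Real.rpow_sub_one hu0.ne' c
  have p2 : u ^ (c - 1 - 1) = u ^ c / u ^ 2 := by
    rw [Real.rpow_sub_one hu0.ne', p1, div_div]; ring
  have hup : u ^ c ≤ X ^ c := Real.rpow_le_rpow hu0.le hu.2 (by linarith)
  have hlo : μ ^ 3 * X ^ c ≤ u ^ c := by
    calc μ ^ 3 * X ^ c ≤ μ ^ c * X ^ c := by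
          gcongr
          rw [← Real.rpow_natCast μ 3]
          exact Real.rpow_le_rpow_of_exponent_ge hμ hμ1 (by push_cast; linarith)
      _ = (μ * X) ^ c := (Real.mul_rpow hμ.le hX.le).symm
      _ ≤ u ^ c := Real.rpow_le_rpow hμX.le hu.1 (by linarith)
  have hXc : 0 < X ^ c := by positivity
  have huX : u ≤ X := hu.2
  have huμ : μ * X ≤ u := hu.1
  have huc : 0 < u ^ c := by positivity
  have e2 : s * (t * c * (c - 1) * (u + 0) ^ (c - 1 - 1)) = |t| * c * (c - 1) * (u ^ c / u ^ 2) := by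
    rw [add_zero, p2, ← hst]; ring
  have e3 : s * (t * c ^ 2 * (c - 1) * u ^ (c - 1)) = |t| * c ^ 2 * (c - 1) * (u ^ c / u) := by
    rw [p1, ← hst]; ring
  have hμ2 : 1 ≤ μ⁻¹ := (one_le_inv₀ hμ).mpr hμ1
  have lo2 : μ ^ 3 * X ^ c / X ^ 2 ≤ u ^ c / u ^ 2 := by gcongr
  have lo1 : μ ^ 3 * X ^ c / X ≤ u ^ c / u := by gcongr
  have hi2 : u ^ c / u ^ 2 ≤ X ^ c / (μ * X) ^ 2 := by gcongr
  have hi1 : u ^ c / u ≤ X ^ c / (μ * X) := by gcongr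
  rw [e2, e3]
  refine ⟨⟨?_, ?_⟩, ?_, ?_⟩
  · calc c * (c - 1) * μ ^ 3 * (|t| * X ^ c) / X ^ 2
        = |t| * c * (c - 1) * (μ ^ 3 * X ^ c / X ^ 2) := by ring
      _ ≤ _ := by gcongr
  · calc |t| * c * (c - 1) * (u ^ c / u ^ 2) ≤ |t| * c * (c - 1) * (X ^ c / (μ * X) ^ 2) := by gcongr
      _ = 1 * μ⁻¹ ^ 5 * (c * (c - 1) * μ ^ 3 * (|t| * X ^ c) / X ^ 2) := by field_simp
      _ ≤ _ := by gcongr; norm_num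
  · calc c * (c - 1) * μ ^ 3 * (|t| * X ^ c) / X
        = |t| * (c * 1) * (c - 1) * (μ ^ 3 * X ^ c / X) := by ring
      _ ≤ |t| * (c * c) * (c - 1) * (u ^ c / u) := by gcongr
      _ = _ := by ring
  · calc |t| * c ^ 2 * (c - 1) * (u ^ c / u) ≤ |t| * c ^ 2 * (c - 1) * (X ^ c / (μ * X)) := by gcongr
      _ = c * (|t| * c * (c - 1) * (X ^ c / X) * μ⁻¹ * 1) := by field_simp
      _ ≤ 3 * (|t| * c * (c - 1) * (X ^ c / X) * μ⁻¹ * μ⁻¹) := by gcongr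
      _ = _ := by field_simp

set_option maxHeartbeats 2000000 in
/-- For a phase `t * u ^ c` of large size, both the sum over primes and the integral are small. -/
lemma norm_le_of_large_phase {μ c t X v R C : ℝ} (hμ : 0 < μ) (hμ1 : μ ≤ 1) (hc1 : 1 < c) (hc3 : c < 3)
    (hX : 4 ≤ X) (hv : 1 ≤ v) (hR0 : 0 < R) (hR : R ^ 2 = c * (c - 1) * μ ^ 3)
    (hC : C = 24 * (2 + 208 * (3 * μ⁻¹ ^ 5 / μ) * (R + R⁻¹)) + 624 * μ⁻¹ ^ 5 * (R + R⁻¹) + 26)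
    (hτ1 : v ^ 10 ≤ |t| * X ^ c) (hτ2 : |t| * X ^ c * v ^ 10 ≤ X) (hvX : v ^ 42 ≤ X)
    (hva : 2 * v ^ 8 ≤ ⌊μ * X⌋₊) (hCv : C * (1 + Real.log X) ^ 8 ≤ v) :
    ‖∑ n ∈ Ioc ⌊μ * X⌋₊ ⌊X⌋₊, (ArithmeticFunction.vonMangoldt n : ℂ) * e (t * (n : ℝ) ^ c)‖ ≤
      2 * (X / v ^ 2) ∧
    ‖∫ y in (μ * X)..X, e (t * y ^ c)‖ ≤ 2 * (X / v ^ 2) := by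
  have hX0 : 0 < X := by linarith
  have hv0 : 0 < v := by linarith
  have hlog : 0 ≤ Real.log X := Real.log_nonneg (by linarith)
  set ℓ := 1 + Real.log X with hℓ
  have hℓ1 : 1 ≤ ℓ := by linarith
  set τ := |t| * X ^ c with hτ
  have hτ0 : 0 < τ := lt_of_lt_of_le (by positivity) hτ1
  have ht : t ≠ 0 := by
    rintro rfl
    simp [hτ] at hτ0
  have hph := isPhase_rpow hμ hμ1 hc1 hc3 hX0 ht
  set A := 3 * μ⁻¹ ^ 5 with hA
  have hμ2 : 1 ≤ μ⁻¹ := (one_le_inv₀ hμ).mpr hμ1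
  have hA1 : 1 ≤ A := by
    have : 1 ≤ μ⁻¹ ^ 5 := one_le_pow₀ hμ2
    linarith
  set Y := √X with hY
  have hY0 : 0 < Y := Real.sqrt_pos.mpr hX0
  have hYX : X = Y ^ 2 := (Real.sq_sqrt hX0.le).symm
  set S := √τ with hS
  have hS0 : 0 < S := Real.sqrt_pos.mpr hτ0
  have hSτ : τ = S ^ 2 := (Real.sq_sqrt hτ0.le).symm
  rw [← hτ, ← hR, hSτ, ← mul_pow] at hph
  have hF0 : 0 < (R * S) ^ 2 := by positivity
  have hsF : √((R * S) ^ 2) = R * S := Real.sqrt_sq (by positivity)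
  have hS1 : v ^ 5 ≤ S := Real.le_sqrt_of_sq_le (by rw [← pow_mul]; exact hτ1)
  have hY21 : v ^ 21 ≤ Y := Real.le_sqrt_of_sq_le (by rw [← pow_mul]; exact hvX)
  have hSY : S * v ^ 5 ≤ Y := by
    apply Real.le_sqrt_of_sq_le
    rw [mul_pow, ← hSτ, ← pow_mul]; exact hτ2
  set G := R + R⁻¹ with hG
  have hRi : 0 < R⁻¹ := by positivity
  have hG0 : 0 < G := by positivity
  have hXF : X / (R * S) ≤ R⁻¹ * (X / v ^ 5) := by
    rw [← div_div, div_eq_inv_mul X R, mul_div_assoc]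
    gcongr
  have hvp : ∀ {i j : ℕ}, i ≤ j → X / v ^ j ≤ X / v ^ i := by
    intro i j hij
    have := pow_le_pow_right₀ hv hij
    gcongr
  have hYle : Y ≤ X / v ^ 21 := by
    rw [le_div_iff₀ (by positivity), hYX, sq]; gcongr
  have hSle : S ≤ X / v ^ 21 := by
    refine le_trans ?_ hYle
    exact (le_mul_of_one_le_right hS0.le (one_le_pow₀ hv)).trans hSY
  have hℓ8 : ∀ {k : ℕ}, k ≤ 8 → ∀ {D : ℝ}, 0 ≤ D → D ≤ C → D * ℓ ^ k ≤ v := by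
    intro k hk D hD hDC
    refine le_trans ?_ hCv
    exact mul_le_mul hDC (pow_le_pow_right₀ hℓ1 hk) (by positivity) (hD.trans hDC)
  have hC1 : 0 ≤ 624 * μ⁻¹ ^ 5 * G := by positivity
  have hC2 : 0 ≤ 24 * (2 + 208 * (A / μ) * G) := by positivity
  set Q := ⌈Y⌉₊ with hQ
  have hQ1 : Y ≤ Q := Nat.le_ceil _
  have hQ0 : 0 < Q := Nat.ceil_pos.mpr hY0
  have hQ2 : (Q : ℝ) ≤ 2 * Y := by
    have h1 := (Nat.ceil_lt_add_one hY0.le).le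
    have h2 : 1 ≤ Y := (one_le_pow₀ hv).trans hY21
    linarith
  set U := ⌈v ^ 8⌉₊ with hU
  have hU1 : v ^ 8 ≤ U := Nat.le_ceil _
  have hU0 : 0 < U := Nat.ceil_pos.mpr (by positivity)
  have hU2 : (U : ℝ) ≤ 2 * v ^ 8 := by
    have h1 := (Nat.ceil_lt_add_one (show 0 ≤ v ^ 8 by positivity)).le
    have h2 : 1 ≤ v ^ 8 := one_le_pow₀ hv
    linarith
  have hU0' : (0 : ℝ) < U := by exact_mod_cast hU0
  have hQ0' : (0 : ℝ) < Q := by exact_mod_cast hQ0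
  have hμX : 0 < μ * X := by positivity
  have hle : μ * X ≤ X := by nlinarith
  have ha1 : μ * X ≤ (⌊μ * X⌋₊ : ℝ) + 1 := (Nat.lt_floor_add_one _).le
  have hbX : (⌊X⌋₊ : ℝ) ≤ X := Nat.floor_le hX0.le
  constructor
  · have main := norm_sum_vonMangoldt_phase_le hA1 hF0 hX hμ hμ1 hph (a := ⌊μ * X⌋₊) (b := ⌊X⌋₊)
      (U := U) (Q := Q) (Nat.floor_le_floor hle) ha1 hbX hU0 (by exact_mod_cast hU2.trans hva) hQ0
    rw [hsF] at main
    refine main.trans ?_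
    have b1 : (U : ℝ) ^ 2 * (R * S) ≤ 4 * (R * (X / v ^ 5)) := by
      calc (U : ℝ) ^ 2 * (R * S) ≤ (2 * v ^ 8) ^ 2 * (R * (X / v ^ 21)) := by gcongr
        _ = 4 * (R * (X / v ^ 5)) := by field_simp; ring
    have b2 : 52 * A * ℓ ^ 3 * ((U : ℝ) ^ 2 * (R * S) + X / (R * S)) ≤ X / v ^ 2 := by
      have hXv : 0 < X / v ^ 5 := by positivity
      calc _ ≤ 52 * A * ℓ ^ 3 * (4 * (R * (X / v ^ 5)) + 4 * (R⁻¹ * (X / v ^ 5))) := by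
            gcongr
            have : 0 < R⁻¹ * (X / v ^ 5) := by positivity
            linarith
        _ = (624 * μ⁻¹ ^ 5 * G * ℓ ^ 3) * (X / v ^ 5) := by rw [hA, hG]; ring
        _ ≤ v * (X / v ^ 5) := by
            gcongr
            exact hℓ8 (by norm_num) hC1 (by rw [hC]; linarith)
        _ = X / v ^ 4 := by field_simp
        _ ≤ _ := hvp (by norm_num)
    have b3 : bilinearBound A ((R * S) ^ 2) X μ U Q ≤ (2 + 208 * (A / μ) * G) * (X / v ^ 5) := by
      have c1 : X / U ≤ X / v ^ 5 := by
        refine le_trans ?_ (hvp (show 5 ≤ 8 by norm_num))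
        gcongr
      have c2 : X / Q ≤ X / v ^ 5 := by
        refine le_trans ?_ (hvp (show 5 ≤ 21 by norm_num))
        refine le_trans ?_ hYle
        rw [div_le_iff₀ hQ0', hYX, sq]; gcongr
      have c3 : √((R * S) ^ 2 * Q * √X) ≤ 2 * (R * (X / v ^ 5)) := by
        have d1 : R * S * Y ≤ R * (X / v ^ 5) := by
          have : S * Y ≤ X / v ^ 5 := by
            rw [le_div_iff₀ (by positivity)]
            calc S * Y * v ^ 5 = (S * v ^ 5) * Y := by ring
              _ ≤ Y * Y := by gcongr
              _ = X := by rw [hYX, sq]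
          rw [mul_assoc]; gcongr
        refine le_trans (Real.sqrt_le_iff.mpr ⟨by positivity, ?_⟩) (mul_le_mul_of_nonneg_left d1 zero_le_two)
        calc (R * S) ^ 2 * Q * √X ≤ (R * S) ^ 2 * (2 * Y) * Y := by gcongr
          _ = 2 * (R * S * Y) ^ 2 := by ring
          _ ≤ (2 * (R * S * Y)) ^ 2 := by nlinarith [sq_nonneg (R * S * Y)]
      have c4 : X * √(√X / ((R * S) ^ 2 * Q)) ≤ R⁻¹ * (X / v ^ 5) := by
        refine le_trans ?_ hXF
        rw [div_eq_mul_inv X]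
        gcongr
        apply Real.sqrt_le_iff.mpr ⟨by positivity, ?_⟩
        rw [div_le_iff₀ (by positivity), inv_pow, inv_mul_cancel_left₀ hF0.ne']
        exact hQ1
      rw [bilinearBound, hsF, show 104 * A / μ = 104 * (A / μ) by ring]
      calc _ ≤ X / v ^ 5 + X / v ^ 5 + 104 * (A / μ) * (2 * (R * (X / v ^ 5)) + R⁻¹ * (X / v ^ 5) +
            R⁻¹ * (X / v ^ 5)) := by gcongr
        _ = _ := by rw [hG]; ring
    have b4 : 2 * ℓ ^ 4 * √(6 * X * bilinearBound A ((R * S) ^ 2) X μ U Q) ≤ X / v ^ 2 := by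
      rw [← le_div_iff₀' (by positivity)]
      apply Real.sqrt_le_iff.mpr ⟨by positivity, ?_⟩
      rw [div_pow, le_div_iff₀ (by positivity)]
      calc 6 * X * bilinearBound A ((R * S) ^ 2) X μ U Q * (2 * ℓ ^ 4) ^ 2
          ≤ 6 * X * ((2 + 208 * (A / μ) * G) * (X / v ^ 5)) * (2 * ℓ ^ 4) ^ 2 := by gcongr
        _ = (24 * (2 + 208 * (A / μ) * G) * ℓ ^ 8) * (X * (X / v ^ 5)) := by ring
        _ ≤ v * (X * (X / v ^ 5)) := by
            gcongr
            exact hℓ8 le_rfl hC2 (by rw [hC]; linarith)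
        _ = (X / v ^ 2) ^ 2 := by field_simp
    linarith only [b2, b4]
  · have h1 := norm_sum_mul_e_sub_integral_le (z := fun _ => 1) (M := 1) (t := t) hμ hμ1 hc1 hc3 hX0
      (by
        intro x hx
        have hx0 : 0 < x := hμX.trans_le hx.1
        have e1 : (∑ k ∈ Icc 0 ⌊x⌋₊, (1 : ℂ)) - (x : ℂ) = ((⌊x⌋₊ + 1 - x : ℝ) : ℂ) := by simp
        rw [e1, Complex.norm_real, Real.norm_eq_abs, abs_le]
        have h2 := Nat.lt_floor_add_one x
        have h3 := Nat.floor_le hx0.le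
        constructor <;> linarith)
    simp only [one_mul] at h1
    rw [← hτ] at h1
    have h2 := norm_sum_phase_le hA1 hF0 hX0 hph le_rfl (m := 1) (p := ⌊μ * X⌋₊) (q := ⌊X⌋₊) one_pos
      (by
        intro n hn hn'
        rw [Nat.cast_one, one_mul]
        exact ⟨(Nat.lt_of_floor_lt hn).le, (Nat.cast_le.mpr hn').trans hbX⟩)
    simp only [Nat.cast_one, one_mul, inv_one, mul_one, hsF] at h2
    have hXv : 0 < X / v ^ 5 := by positivity
    have c1 : 13 * A * (R * S + X / (R * S)) ≤ X / v ^ 4 := by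
      have : S ≤ X / v ^ 5 := hSle.trans (hvp (by norm_num))
      calc _ ≤ 16 * (13 * A * (R * (X / v ^ 5) + R⁻¹ * (X / v ^ 5))) := by
            refine le_trans ?_ (le_mul_of_one_le_left (by positivity) (by norm_num))
            gcongr
        _ = (624 * μ⁻¹ ^ 5 * G * ℓ ^ 0) * (X / v ^ 5) := by rw [hA, hG]; ring
        _ ≤ v * (X / v ^ 5) := by
            gcongr
            exact hℓ8 (by norm_num) hC1 (by rw [hC]; linarith)
        _ = _ := by field_simp
    have c2 : 2 + 24 * τ ≤ 26 * (X / v ^ 10) := by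
      have d1 : τ ≤ X / v ^ 10 := by rwa [le_div_iff₀ (by positivity)]
      have d2 : 1 ≤ τ := (one_le_pow₀ hv).trans hτ1
      linarith
    have c3 : 26 * (X / v ^ 10) ≤ X / v ^ 9 := by
      have : 26 * ℓ ^ 0 ≤ v := hℓ8 (by norm_num) (by norm_num) (by rw [hC]; linarith)
      calc 26 * (X / v ^ 10) ≤ v * (X / v ^ 10) := by gcongr; linarith
        _ = _ := by field_simp
    have c4 := norm_sub_norm_le (∫ y in (μ * X)..X, e (t * y ^ c))
      (∑ n ∈ Ioc ⌊μ * X⌋₊ ⌊X⌋₊, e (t * (n : ℝ) ^ c))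
    rw [norm_sub_rev] at c4
    linarith only [c1, c2, c3, c4, h1, h2, hvp (show 2 ≤ 4 by norm_num),
      hvp (show 2 ≤ 9 by norm_num)]

section

open Filter

lemma tendsto_log_rpow_atTop {a : ℝ} (ha : 0 < a) :
    Tendsto (fun X : ℝ => Real.log X ^ a) atTop atTop :=
  (tendsto_rpow_atTop ha).comp Real.tendsto_log_atTop

lemma eventually_mul_log_pow_le_exp (C : ℝ) (k : ℕ) :
    ∀ᶠ X : ℝ in atTop, C * (1 + Real.log X) ^ k ≤ Real.exp (Real.log X ^ ((1 : ℝ) / 5) / 2) := by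
  have h1 := eventually_mul_log_pow_le (|C| * 32 ^ k) (5 * k) one_pos
  have ht : Tendsto (fun X : ℝ => Real.exp (Real.log X ^ ((1 : ℝ) / 5) / 2)) atTop atTop :=
    Real.tendsto_exp_atTop.comp ((tendsto_log_rpow_atTop (by norm_num)).atTop_div_const two_pos)
  filter_upwards [ht.eventually h1, eventually_ge_atTop 1] with X hX hX1
  have hlog : 0 ≤ Real.log X := Real.log_nonneg hX1
  rw [Real.log_exp, Real.rpow_one] at hX
  set w := Real.log X ^ ((1 : ℝ) / 5) with hw
  have hw0 : 0 ≤ w := by positivity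
  have hw5 : Real.log X = w ^ 5 := by
    rw [hw, ← Real.rpow_natCast, ← Real.rpow_mul hlog]; norm_num
  refine le_trans ?_ hX
  have h2 : 1 + w ^ 5 ≤ 32 * (1 + w / 2) ^ 5 := by
    have : 32 * (1 + w / 2) ^ 5 = (2 + w) ^ 5 := by ring
    rw [this]
    have h3 : 0 ≤ w ^ 2 ∧ 0 ≤ w ^ 3 ∧ 0 ≤ w ^ 4 := ⟨by positivity, by positivity, by positivity⟩
    have : (2 + w) ^ 5 = 32 + 80 * w + 80 * w ^ 2 + 40 * w ^ 3 + 10 * w ^ 4 + w ^ 5 := by ring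
    linarith
  rw [hw5]
  calc C * (1 + w ^ 5) ^ k ≤ |C| * (32 * (1 + w / 2) ^ 5) ^ k := by
        gcongr
        exact le_abs_self C
    _ = _ := by rw [mul_pow, ← pow_mul]; ring

lemma eventually_exp_pow_le_rpow (k : ℕ) {ε : ℝ} (hε : 0 < ε) :
    ∀ᶠ X : ℝ in atTop, Real.exp (Real.log X ^ ((1 : ℝ) / 5) / 2) ^ k ≤ X ^ ε := by
  filter_upwards [(tendsto_log_rpow_atTop (a := 1 / 5) (by norm_num)).eventually_ge_atTop
    (max 1 (k / (2 * ε))), eventually_ge_atTop 1] with X hX hX1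
  have hlog : 0 ≤ Real.log X := Real.log_nonneg hX1
  set w := Real.log X ^ ((1 : ℝ) / 5) with hw
  have hw1 : 1 ≤ w := (le_max_left _ _).trans hX
  have hwk : k / (2 * ε) ≤ w := (le_max_right _ _).trans hX
  have hw5 : Real.log X = w ^ 5 := by
    rw [hw, ← Real.rpow_natCast, ← Real.rpow_mul hlog]; norm_num
  rw [← Real.exp_nat_mul, Real.rpow_def_of_pos (by linarith), Real.exp_le_exp, hw5]
  rw [div_le_iff₀ (by positivity)] at hwk
  have h2 : w ^ 2 ≤ w ^ 5 := pow_le_pow_right₀ hw1 (by norm_num)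
  nlinarith

lemma eventually_exp_neg_sqrt_log_mul_le {μ c : ℝ} (C : ℝ) (hμ : 0 < μ) (hc : 0 < c) (k : ℕ) :
    ∀ᶠ X : ℝ in atTop, C * Real.exp (-(c * √(Real.log (μ * X)))) *
      Real.exp (Real.log X ^ ((1 : ℝ) / 5) / 2) ^ k ≤ 1 := by
  filter_upwards [(tendsto_log_rpow_atTop (a := 1 / 5) (by norm_num)).eventually_ge_atTop
    (max 1 ((k + 2 * |C|) / c)), eventually_ge_atTop 1, eventually_ge_atTop (μ⁻¹ ^ 2)] with X hX hX1 hX2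
  have hX0 : 0 < X := by linarith
  have hlog : 0 ≤ Real.log X := Real.log_nonneg hX1
  set w := Real.log X ^ ((1 : ℝ) / 5) with hw
  have hw1 : 1 ≤ w := (le_max_left _ _).trans hX
  have hwk : (k + 2 * |C|) / c ≤ w := (le_max_right _ _).trans hX
  have hw5 : Real.log X = w ^ 5 := by
    rw [hw, ← Real.rpow_natCast, ← Real.rpow_mul hlog]; norm_num
  have h1 : (w ^ 2 / 2) ^ 2 ≤ Real.log (μ * X) := by
    have h2 := Real.log_le_log (by positivity) hX2
    rw [Real.log_pow, Real.log_inv] at h2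
    push_cast at h2
    rw [Real.log_mul hμ.ne' hX0.ne', hw5]
    rw [hw5] at h2
    have h3 : w ^ 4 ≤ w ^ 5 := pow_le_pow_right₀ hw1 (by norm_num)
    have h4 : 0 < w ^ 4 := by positivity
    nlinarith
  have h2 : w ^ 2 / 2 ≤ √(Real.log (μ * X)) := Real.le_sqrt_of_sq_le h1
  rw [div_le_iff₀ hc] at hwk
  have h3 : (k : ℝ) * (w / 2) + |C| ≤ c * √(Real.log (μ * X)) := by
    have h4 : c * (w ^ 2 / 2) ≤ c * √(Real.log (μ * X)) := by gcongr
    have h5 : (k + 2 * |C|) * (w / 2) ≤ (w * c) * (w / 2) := by gcongr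
    have h6 : |C| ≤ |C| * w := le_mul_of_one_le_right (abs_nonneg _) hw1
    nlinarith
  calc C * Real.exp (-(c * √(Real.log (μ * X)))) * Real.exp (w / 2) ^ k
      ≤ Real.exp |C| * Real.exp (-(c * √(Real.log (μ * X)))) * Real.exp (w / 2) ^ k := by
        gcongr
        have := Real.add_one_le_exp |C|
        linarith [le_abs_self C]
    _ = Real.exp (|C| + -(c * √(Real.log (μ * X))) + k * (w / 2)) := by
        rw [Real.exp_add, Real.exp_add, Real.exp_nat_mul]
    _ ≤ 1 := by
        rw [Real.exp_le_one_iff]; linarith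

/-- The prime number theorem for the sums `∑ Λ(n) e(t n^c)`. -/
lemma eventually_norm_sum_vonMangoldt_sub_integral_le {μ γ c δ : ℝ} (hμ : 0 < μ) (hμ1 : μ < 1)
    (hγ2 : γ < 1) (hc1 : 1 < c) (hc3 : c < 3) (hδ : 0 < δ) :
    ∀ᶠ X : ℝ in atTop, ∀ t : ℝ, |t| ≤ X ^ ((4 * γ - 3 * c - 1) / 3 - δ) →
      ‖(∑ n ∈ Ioc ⌊μ * X⌋₊ ⌊X⌋₊, (ArithmeticFunction.vonMangoldt n : ℂ) * e (t * (n : ℝ) ^ c)) -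
        ∫ y in (μ * X)..X, e (t * y ^ c)‖ ≤ 4 * (X / Real.exp (Real.log X ^ ((1 : ℝ) / 5))) := by
  obtain ⟨c₀, C₀, hc₀, hC₀, hpsi⟩ := exists_abs_psi_sub_le
  set R := √(c * (c - 1) * μ ^ 3) with hR
  have hRpos : 0 < c * (c - 1) * μ ^ 3 :=
    mul_pos (mul_pos (by linarith) (by linarith)) (by positivity)
  filter_upwards [eventually_mul_log_pow_le_exp (24 * (2 + 208 * (3 * μ⁻¹ ^ 5 / μ) * (R + R⁻¹)) +
      624 * μ⁻¹ ^ 5 * (R + R⁻¹) + 26) 8, eventually_exp_pow_le_rpow 10 hδ,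
    eventually_exp_pow_le_rpow 42 one_pos,
    eventually_exp_pow_le_rpow 8 (show (0 : ℝ) < 1 / 2 by norm_num),
    eventually_exp_neg_sqrt_log_mul_le (26 * C₀) hμ hc₀ 12,
    ((tendsto_rpow_atTop (show (0 : ℝ) < 1 / 2 by norm_num)).const_mul_atTop
      hμ).eventually_ge_atTop 3, eventually_ge_atTop 4, eventually_ge_atTop μ⁻¹] with
    X h1 h2 h3 h4 h5 h6 hX hXμ t ht
  have hX0 : 0 < X := by linarith
  have hX1 : 1 ≤ X := by linarith
  have hlog : 0 ≤ Real.log X := Real.log_nonneg hX1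
  set v := Real.exp (Real.log X ^ ((1 : ℝ) / 5) / 2) with hv
  have hv1 : 1 ≤ v := Real.one_le_exp (by positivity)
  have hv2 : Real.exp (Real.log X ^ ((1 : ℝ) / 5)) = v ^ 2 := by
    rw [hv, ← Real.exp_nat_mul]; congr 1; push_cast; ring
  rw [hv2]
  rw [Real.rpow_one] at h3
  have hXv : 0 < X / v ^ 2 := by positivity
  have hμX : 1 ≤ μ * X := by
    calc 1 = μ * μ⁻¹ := (mul_inv_cancel₀ hμ.ne').symm
      _ ≤ _ := by gcongr
  rcases le_total (v ^ 10) (|t| * X ^ c) with hτ | hτ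
  · have hτ2 : |t| * X ^ c * v ^ 10 ≤ X := by
      calc |t| * X ^ c * v ^ 10 ≤ X ^ ((4 * γ - 3 * c - 1) / 3 - δ) * X ^ c * X ^ δ := by gcongr
        _ = X ^ ((4 * γ - 3 * c - 1) / 3 - δ + c + δ) := by
            rw [← Real.rpow_add hX0, ← Real.rpow_add hX0]
        _ ≤ X ^ (1 : ℝ) := Real.rpow_le_rpow_of_exponent_le hX1 (by linarith)
        _ = X := Real.rpow_one X
    have hva : 2 * v ^ 8 ≤ ⌊μ * X⌋₊ := by
      have e1 : X = X ^ ((1 : ℝ) / 2) * X ^ ((1 : ℝ) / 2) := by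
        rw [← Real.rpow_add hX0]; norm_num
      have e2 : 3 * X ^ ((1 : ℝ) / 2) ≤ μ * X := by
        calc _ ≤ (μ * X ^ ((1 : ℝ) / 2)) * X ^ ((1 : ℝ) / 2) := by gcongr
          _ = μ * (X ^ ((1 : ℝ) / 2) * X ^ ((1 : ℝ) / 2)) := by ring
          _ = _ := by rw [← e1]
      have e3 : 1 ≤ v ^ 8 := one_le_pow₀ hv1
      have := Nat.lt_floor_add_one (μ * X)
      linarith
    have main := norm_le_of_large_phase hμ hμ1.le hc1 hc3 hX hv1 (Real.sqrt_pos.mpr hRpos)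
      (Real.sq_sqrt hRpos.le) rfl hτ hτ2 h3 hva h1
    refine (norm_sub_le _ _).trans ?_
    linarith [main.1, main.2]
  · have main := norm_sum_mul_e_sub_integral_le
      (z := fun n => (ArithmeticFunction.vonMangoldt n : ℂ)) (t := t)
      (M := C₀ * X * Real.exp (-(c₀ * √(Real.log (μ * X))))) hμ hμ1.le hc1 hc3 hX0
      (by
        intro x hx
        have hx1 : 1 ≤ x := hμX.trans hx.1
        have e1 : (∑ k ∈ Icc 0 ⌊x⌋₊, (ArithmeticFunction.vonMangoldt k : ℂ)) - (x : ℂ) =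
            ((Chebyshev.psi x - x : ℝ) : ℂ) := by
          rw [Chebyshev.psi_eq_sum_Icc]; push_cast; rfl
        rw [e1, Complex.norm_real, Real.norm_eq_abs]
        refine (hpsi x hx1).trans ?_
        gcongr
        · exact hx.2
        · exact hx.1)
    refine main.trans ?_
    have e1 : 2 + 24 * (|t| * X ^ c) ≤ 26 * v ^ 10 := by
      have : 1 ≤ v ^ 10 := one_le_pow₀ hv1
      linarith
    calc _ ≤ C₀ * X * Real.exp (-(c₀ * √(Real.log (μ * X)))) * (26 * v ^ 10) := by gcongr
      _ = (26 * C₀ * Real.exp (-(c₀ * √(Real.log (μ * X)))) * v ^ 12) * (X / v ^ 2) := by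
          field_simp
      _ ≤ 1 * (X / v ^ 2) := by gcongr
      _ ≤ _ := by linarith

end

end PiatetskiShapiro

/-- Asymptotic formula for the exponential sum `∑ Λ(n) n^{1-γ} e(t n^c)` over
Piatetski-Shapiro numbers. -/
theorem exponential_sum_piatetski_shapiro_asymptotic (μ γ c : ℝ)
    (hμ0 : 0 < μ) (hμ1 : μ < 1) (hγ1 : (11 : ℝ) / 12 < γ) (hγ2 : γ < 1)
    (hc1 : 1 < c) (hc3 : c < 3) (hc2 : c ≠ 2) :
    ∃ δ₀ > 0, ∀ δ : ℝ, 0 < δ → δ ≤ δ₀ →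
      ∃ K > 0, ∃ X₀ : ℝ, ∀ X : ℝ, X₀ ≤ X →
        ∀ t : ℝ, |t| ≤ X ^ ((4 * γ - 3 * c - 1) / 3 - δ) →
          ‖(∑ n ∈ Ioc ⌊μ * X⌋₊ ⌊X⌋₊,
              if isPS γ n then
                (ArithmeticFunction.vonMangoldt n : ℂ) * ((n : ℝ) ^ (1 - γ) : ℝ)
                  * e (t * (n : ℝ) ^ c)
              else 0)
            - (γ : ℂ) * ∫ y in (μ * X)..X, e (t * y ^ c)‖
          ≤ K * (X / Real.exp (Real.log X ^ ((1 : ℝ) / 5))) := by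
  refine ⟨1, one_pos, fun δ hδ _ => ⟨7, by norm_num, ?_⟩⟩
  refine Filter.eventually_atTop.mp ?_
  filter_upwards [PiatetskiShapiro.eventually_norm_sum_isPS_sub_le hμ0 hμ1 hγ1 hγ2 hc1 hc3 hδ,
    PiatetskiShapiro.eventually_norm_sum_vonMangoldt_sub_integral_le hμ0 hμ1 hγ2 hc1 hc3 hδ,
    PiatetskiShapiro.eventually_exp_pow_le_rpow 2 (show 0 < (γ - 11 / 12) / 4 by linarith),
    PiatetskiShapiro.eventually_exp_pow_le_rpow 2 (show (0 : ℝ) < 1 / 2 by norm_num),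
    PiatetskiShapiro.eventually_mul_log_pow_le 1 2 (show (0 : ℝ) < 1 / 2 by norm_num),
    Filter.eventually_ge_atTop 1] with X h1 h2 h3 h4 h5 hX t ht
  have hX0 : 0 < X := by linarith
  have hexp : Real.exp (Real.log X ^ ((1 : ℝ) / 5) / 2) ^ 2 =
      Real.exp (Real.log X ^ ((1 : ℝ) / 5)) := by
    rw [← Real.exp_nat_mul]; congr 1; push_cast; ring
  rw [hexp] at h3 h4
  have h1 := h1 t ht
  have h2 := h2 t ht
  set u := Real.exp (Real.log X ^ ((1 : ℝ) / 5)) with hu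
  have hu0 : 0 < u := Real.exp_pos _
  set T := ∑ n ∈ Ioc ⌊μ * X⌋₊ ⌊X⌋₊, (ArithmeticFunction.vonMangoldt n : ℂ) * e (t * (n : ℝ) ^ c)
  set P := ∑ n ∈ Ioc ⌊μ * X⌋₊ ⌊X⌋₊, if isPS γ n then
    (ArithmeticFunction.vonMangoldt n : ℂ) * ((n : ℝ) ^ (1 - γ) : ℝ) * e (t * (n : ℝ) ^ c) else 0
  set I := ∫ y in (μ * X)..X, e (t * y ^ c)
  have b1 : X ^ (1 - (γ - 11 / 12) / 4) ≤ X / u := by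
    rw [Real.rpow_sub hX0, Real.rpow_one]; gcongr
  have b2 : (1 + Real.log X) ^ 2 ≤ X / u := by
    rw [one_mul] at h5
    rw [le_div_iff₀ hu0]
    calc (1 + Real.log X) ^ 2 * u ≤ X ^ ((1 : ℝ) / 2) * X ^ ((1 : ℝ) / 2) := by gcongr
      _ = X := by rw [← Real.rpow_add hX0]; norm_num
  have hsplit : P - (γ : ℂ) * I = (P - (γ : ℂ) * T) + (γ : ℂ) * (T - I) := by ring
  have b3 : ‖(γ : ℂ) * (T - I)‖ ≤ 4 * (X / u) := by
    rw [norm_mul, Complex.norm_real, Real.norm_of_nonneg (by linarith)]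
    calc γ * ‖T - I‖ ≤ 1 * ‖T - I‖ := by gcongr
      _ ≤ _ := by rw [one_mul]; exact h2
  rw [hsplit]
  refine (norm_add_le _ _).trans ?_
  linarith
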